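/- Let X ⊆ P^r_K be a non-degenerate variety of degree 6 and codimension 4 which is not a cone, and suppose X is arithmetically Cohen–Macaulay. Then dim X ≤ 4, X is arithmetically Gorenstein, and the minimal free resolution of I_X has the form 0 → S(−6) → S^9(−4) → S^{16}(−3) → S^9(−2) → I_X → 0. -/

import Mathlib

noncomputable section

open MvPolynomial

/-- The polynomial ring `S = K[x_0, …, x_r]`, the homogeneous coordinate ring of `ℙ^r_K`. -/
abbrev PS (K : Type) [Field K] (r : ℕ) : Type := MvPolynomial (Fin (r + 1)) K

namespace AMD

variable (K : Type) [Field K] (r : ℕ)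

/-- `I` is a homogeneous ideal of `S = K[x_0, …, x_r]`. -/
def IsHomIdeal (I : Ideal (PS K r)) : Prop :=
  ∀ p ∈ I, ∀ n : ℕ, homogeneousComponent n p ∈ I

/-- `X = V_+(I)` is non-degenerate: `I` contains no nonzero linear form. -/
def Nondeg (I : Ideal (PS K r)) : Prop :=
  ∀ p ∈ I, p.IsHomogeneous 1 → p = 0

/-- The irrelevant maximal ideal of the homogeneous coordinate ring `A_X = S/I`. -/
def maxIdl (I : Ideal (PS K r)) : Ideal (PS K r ⧸ I) :=
  (Ideal.span (Set.range (X : Fin (r + 1) → PS K r))).map (Ideal.Quotient.mk I)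

/-- `dim X = d`, i.e. the Krull dimension of `A_X = S/I` equals `d + 1`. -/
def DimEq (I : Ideal (PS K r)) (d : ℕ) : Prop :=
  ringKrullDim (PS K r ⧸ I) = (((d : ℕ∞) + 1 : ℕ∞) : WithBot ℕ∞)

/-- The degree-`n` homogeneous component of `A_X = S/I`, as a `K`-subspace. -/
def quotComponent (I : Ideal (PS K r)) (n : ℕ) : Submodule K (PS K r ⧸ I) :=
  (homogeneousSubmodule (Fin (r + 1)) K n).map (Ideal.Quotient.mkₐ K I).toLinearMap

/-- The Hilbert series of the graded algebra `A_X = S/I`. -/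
def hilbSeries (I : Ideal (PS K r)) : PowerSeries ℤ :=
  PowerSeries.mk fun n => (Module.finrank K (quotComponent K r I n) : ℤ)

/-- `deg X = e`, where `d = dim X`:  the numerator polynomial of the Hilbert series of
`A_X` with respect to the denominator `(1 - λ)^(d+1)` takes the value `e` at `λ = 1`. -/
def DegreeEq (I : Ideal (PS K r)) (d e : ℕ) : Prop :=
  ∃ h : Polynomial ℤ,
    hilbSeries K r I * (1 - PowerSeries.X) ^ (d + 1) = PowerSeries.mk (fun n => h.coeff n) ∧
    h.eval 1 = (e : ℤ)

/-- A graded automorphism of `S`, i.e. a linear change of coordinates of `ℙ^r_K`. -/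
def IsGrAut (φ : PS K r ≃ₐ[K] PS K r) : Prop :=
  ∀ i, (φ (X i)).IsHomogeneous 1

/-- `X = V_+(I) ⊆ ℙ^r_K` is a cone (over a variety lying in some hyperplane): after a
linear change of coordinates, `I` is generated by polynomials not involving the last
variable. -/
def IsConeIdeal (I : Ideal (PS K r)) : Prop :=
  ∃ φ : PS K r ≃ₐ[K] PS K r, IsGrAut K r φ ∧
    ∃ J : Ideal (MvPolynomial (Fin r) K),
      Ideal.map φ I = Ideal.map (rename (Fin.castSucc : Fin r → Fin (r + 1))) J

/-- A (weakly) regular sequence on the ring `A`. -/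
def IsRegSeq {A : Type} [CommRing A] (rs : List A) : Prop :=
  ∀ (i : Fin rs.length) (y : A),
    rs.get i * y ∈ Ideal.span {x | x ∈ rs.take i.1} → y ∈ Ideal.span {x | x ∈ rs.take i.1}

/-- `depth A_X = t`: the maximal length of a regular sequence on `A_X = S/I` consisting
of elements of the irrelevant maximal ideal is `t`. -/
def DepthEq (I : Ideal (PS K r)) (t : ℕ) : Prop :=
  (∃ rs : List (PS K r ⧸ I), rs.length = t ∧ (∀ x ∈ rs, x ∈ maxIdl K r I) ∧ IsRegSeq rs) ∧
  ∀ rs : List (PS K r ⧸ I), (∀ x ∈ rs, x ∈ maxIdl K r I) → IsRegSeq rs → rs.length ≤ t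

/-- `X` is arithmetically Cohen-Macaulay: `depth A_X = dim A_X`. -/
def IsACM (I : Ideal (PS K r)) : Prop :=
  ∃ t : ℕ, ringKrullDim (PS K r ⧸ I) = ((t : ℕ∞) : WithBot ℕ∞) ∧ DepthEq K r I t

/-- The socle `{y | m·y = 0}` of `B`, as a `K`-subspace of `B`. -/
def socle (B : Type) [CommRing B] [Algebra K B] (m : Ideal B) : Submodule K B where
  carrier := {y | ∀ z ∈ m, z * y = 0}
  add_mem' := by
    intro a b ha hb z hz
    rw [mul_add, ha z hz, hb z hz, add_zero]
  zero_mem' := by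
    intro z hz
    rw [mul_zero]
  smul_mem' := by
    intro c y hy z hz
    rw [mul_smul_comm, hy z hz, smul_zero]

/-- `X` is arithmetically Gorenstein: `A_X = S/I` is Cohen-Macaulay and its Artinian
reduction by a maximal regular sequence has a one-dimensional socle. -/
def IsArithGorenstein (I : Ideal (PS K r)) : Prop :=
  ∃ (t : ℕ) (rs : List (PS K r ⧸ I)),
    ringKrullDim (PS K r ⧸ I) = ((t : ℕ∞) : WithBot ℕ∞) ∧ rs.length = t ∧
    (∀ x ∈ rs, x ∈ maxIdl K r I) ∧ IsRegSeq rs ∧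
    Module.finrank K
      (socle K ((PS K r ⧸ I) ⧸ Ideal.span {x | x ∈ rs})
        (Ideal.map (Ideal.Quotient.mk (Ideal.span {x | x ∈ rs})) (maxIdl K r I))) = 1

/-- The graded free `S`-module with `β j` generators in "row `j`" for each `j : ℕ`. -/
abbrev FreeGr (β : ℕ → ℕ) : Type := ((j : ℕ) × Fin (β j)) →₀ PS K r

/-- `φ` is a minimal graded homomorphism of graded free modules, where the generator
`(j, t)` of the source has degree `m₁ + j` and the generator `(j', t')` of the target
has degree `m₂ + j'`: every matrix entry of `φ` is either zero or homogeneous of the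
appropriate positive degree. -/
def IsMinGrMap (b₁ b₂ : ℕ → ℕ) (m₁ m₂ : ℕ)
    (φ : FreeGr K r b₁ →ₗ[PS K r] FreeGr K r b₂) : Prop :=
  ∀ (j : ℕ) (t : Fin (b₁ j)) (j' : ℕ) (t' : Fin (b₂ j')),
    (φ (Finsupp.single ⟨j, t⟩ 1)) ⟨j', t'⟩ = 0 ∨
      ∃ dd : ℕ, 1 ≤ dd ∧ dd + (m₂ + j') = m₁ + j ∧
        ((φ (Finsupp.single ⟨j, t⟩ 1)) ⟨j', t'⟩).IsHomogeneous dd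

/-- `b` is the Betti diagram of the ideal `I ⊆ S`, i.e.
`b i j = dim_K Tor_i^S(K, S/I)_{i+j}` for all `i ≥ 1`.  This is expressed by the
existence of a minimal graded free resolution `⋯ → F₂ → F₁ → S → S/I → 0` of `S/I`
in which, for `i ≥ 1`, the free module `F_i` has exactly `b i j` generators of degree
`i + j`. -/
def HasBettiDiagram (I : Ideal (PS K r)) (b : ℕ → ℕ → ℕ) : Prop :=
  ∃ (φ : (i : ℕ) → (FreeGr K r (b (i + 2)) →ₗ[PS K r] FreeGr K r (b (i + 1))))
    (ε : FreeGr K r (b 1) →ₗ[PS K r] PS K r),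
    (∀ (j : ℕ) (t : Fin (b 1 j)), (ε (Finsupp.single ⟨j, t⟩ 1)).IsHomogeneous (1 + j)) ∧
    (∀ i, IsMinGrMap K r (b (i + 2)) (b (i + 1)) (i + 2) (i + 1) (φ i)) ∧
    LinearMap.range ε = I ∧
    LinearMap.ker ε = LinearMap.range (φ 0) ∧
    ∀ i, LinearMap.ker (φ i) = LinearMap.range (φ (i + 1))

/-- The Pfaffian of a (skew-symmetric) `4 × 4` matrix. -/
def pfaff4 {R : Type} [CommRing R] (N : Matrix (Fin 4) (Fin 4) R) : R :=
  N 0 1 * N 2 3 - N 0 2 * N 1 3 + N 0 3 * N 1 2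

/-- The five submaximal (`4 × 4`) Pfaffians of a skew-symmetric `5 × 5` matrix. -/
def subPfaffian {R : Type} [CommRing R] (M : Matrix (Fin 5) (Fin 5) R) (i : Fin 5) : R :=
  pfaff4 (M.submatrix i.succAbove i.succAbove)

/-- `X = V_+(I)` is the Pfaffian variety defined by the five `4 × 4` Pfaffians of a
skew-symmetric `5 × 5` matrix of linear forms. -/
def IsPfaffianVariety (I : Ideal (PS K r)) : Prop :=
  ∃ M : Matrix (Fin 5) (Fin 5) (PS K r),
    M.transpose = -M ∧ (∀ i j, (M i j).IsHomogeneous 1) ∧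
    I = Ideal.span (Set.range (subPfaffian M))

/-- The vanishing ideal of the coordinate point `(0 : ⋯ : 0 : 1) ∈ ℙ^{r+1}_K`. -/
def pointIdl : Ideal (PS K (r + 1)) :=
  Ideal.span ((X : Fin (r + 2) → PS K (r + 1)) '' {i : Fin (r + 2) | i ≠ Fin.last (r + 1)})

/-- `X = V_+(I) ⊆ ℙ^r_K` is the image of `Z = V_+(J) ⊆ ℙ^{r+1}_K` under the projection
from a point `P ∈ ℙ^{r+1}_K ∖ Z`: after a linear change of coordinates moving `P` to
`(0 : ⋯ : 0 : 1)`, the ideal `I` is the contraction of `J` to `K[x_0, …, x_r]`. -/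
def IsProjectionOf (I : Ideal (PS K r)) (J : Ideal (PS K (r + 1))) : Prop :=
  ∃ ψ : PS K (r + 1) ≃ₐ[K] PS K (r + 1), IsGrAut K (r + 1) ψ ∧
    ¬ Ideal.map ψ J ≤ pointIdl K r ∧
    I = Ideal.comap (rename (Fin.castSucc : Fin (r + 1) → Fin (r + 2))) (Ideal.map ψ J)

/-- The ideal of the Veronese surface `F ⊆ ℙ^5_K`, generated by the `2 × 2` minors of
the generic symmetric `3 × 3` matrix with rows `(x₀,x₁,x₂), (x₁,x₃,x₄), (x₂,x₄,x₅)`. -/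
def veroneseIdeal : Ideal (PS K 5) :=
  Ideal.span {X 0 * X 3 - X 1 * X 1, X 0 * X 4 - X 1 * X 2, X 1 * X 4 - X 2 * X 3,
    X 0 * X 5 - X 2 * X 2, X 1 * X 5 - X 2 * X 4, X 3 * X 5 - X 4 * X 4}

/-- The determinant of the generic symmetric `3 × 3` matrix defining the Veronese
surface; it cuts out the secant variety of `F ⊆ ℙ^5_K`. -/
def veroneseDet : PS K 5 :=
  X 0 * X 3 * X 5 - X 0 * X 4 * X 4 - X 1 * X 1 * X 5 + 2 * (X 1 * X 2 * X 4) -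
    X 2 * X 2 * X 3

/-- `X = V_+(I) ⊆ ℙ^4_K` is a generic projection of the Veronese surface `F ⊆ ℙ^5_K`,
i.e. the projection of `F` from a point `P ∈ ℙ^5_K ∖ F` at which the generic symmetric
`3 × 3` matrix `M` has rank `3` (equivalently, `P` does not lie on the secant variety
`{det M = 0}` of `F`). -/
def IsGenProjVeronese4 (I : Ideal (PS K 4)) : Prop :=
  ∃ ψ : PS K 5 ≃ₐ[K] PS K 5, IsGrAut K 5 ψ ∧
    ¬ Ideal.map ψ (Ideal.span {veroneseDet K}) ≤ pointIdl K 4 ∧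
    I = Ideal.comap (rename (Fin.castSucc : Fin 5 → Fin 6)) (Ideal.map ψ (veroneseIdeal K))

/-- `X = V_+(I) ⊆ ℙ^r_K` is a generic projection of the Veronese surface (which forces
`r = 4`). -/
def IsGenProjVeronese (I : Ideal (PS K r)) : Prop :=
  ∃ h : r + 1 = 5, IsGenProjVeronese4 K (Ideal.map (rename (Fin.cast h)) I)

/-- `X = V_+(I) ⊆ ℙ^r_K` is a generic projection of (a cone over) the Veronese surface
`F ⊆ ℙ^5_K`:  `X` is the projection of a cone `Z ⊆ ℙ^{r+1}_K` over `F` from a point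
not lying on the (cone over the) secant variety of `F`. -/
def IsGenProjVeroneseCone (I : Ideal (PS K r)) : Prop :=
  ∃ (h : 6 ≤ r + 2) (ψ : PS K (r + 1) ≃ₐ[K] PS K (r + 1)), IsGrAut K (r + 1) ψ ∧
    ¬ Ideal.map ψ (Ideal.map (rename (Fin.castLE h))
        (Ideal.span {veroneseDet K})) ≤ pointIdl K r ∧
    I = Ideal.comap (rename (Fin.castSucc : Fin (r + 1) → Fin (r + 2)))
      (Ideal.map ψ (Ideal.map (rename (Fin.castLE h)) (veroneseIdeal K)))

/-- The ideal of the rational normal scroll `S(a_1, …, a_k)`, generated by the `2 × 2`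
minors of the standard `2 × (Σ a_i)` matrix of indeterminates. -/
def scrollIdeal (k : ℕ) (a : Fin k → ℕ) :
    Ideal (MvPolynomial ((i : Fin k) × Fin (a i + 1)) K) :=
  Ideal.span {p | ∃ (i : Fin k) (j : Fin (a i)) (i' : Fin k) (j' : Fin (a i')),
    p = X ⟨i, j.castSucc⟩ * X ⟨i', j'.succ⟩ - X ⟨i, j.succ⟩ * X ⟨i', j'.castSucc⟩}

/-- The affine cone in `K^{r+2}` of the projective scheme `V_+(J) ⊆ ℙ^{r+1}_K`. -/
def zeroSet (J : Ideal (PS K (r + 1))) : Set (Fin (r + 2) → K) :=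
  {v | ∀ f ∈ J, MvPolynomial.eval v f = 0}

/-- Restriction of polynomials to the plane spanned by the vectors `p` and `q`
(i.e. to the line through the corresponding projective points). -/
def lineRestrict (p q : Fin (r + 2) → K) : PS K (r + 1) →ₐ[K] MvPolynomial (Fin 2) K :=
  aeval fun i => MvPolynomial.C (p i) * X 0 + MvPolynomial.C (q i) * X 1

/-- The line through the (independent) points `p`, `q` is a secant line of
`Z = V_+(J)`: the scheme `Z ∩ L ⊆ L ≅ ℙ^1` has length at least `2`, i.e. the
restriction of `J` to the line is contained in a principal ideal generated by a
form of degree `≥ 2` (or is zero, in which case `L ⊆ Z`). -/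
def IsSecantLine (J : Ideal (PS K (r + 1))) (p q : Fin (r + 2) → K) : Prop :=
  ∃ h : MvPolynomial (Fin 2) K,
    (∀ f ∈ J, lineRestrict K r p q f ∈ Ideal.span {h}) ∧
    (h = 0 ∨ ∃ dd : ℕ, 2 ≤ dd ∧ h.IsHomogeneous dd)

/-- The (affine cone over the) secant cone `Sec_P(Z)` of `Z = V_+(J)` with respect to
the point `P = [p]`: the union of `{P}` and of all secant lines of `Z` through `P`. -/
def secantCone (J : Ideal (PS K (r + 1))) (p : Fin (r + 2) → K) : Set (Fin (r + 2) → K) :=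
  {v | ∃ a : K, v = a • p} ∪
    {v | ∃ q : Fin (r + 2) → K, LinearIndependent K ![p, q] ∧ IsSecantLine K r J p q ∧
      ∃ a b : K, v = a • p + b • q}

/-- The (homogeneous) vanishing ideal of a subset of the affine cone `K^{r+2}`. -/
def vanishingIdl (T : Set (Fin (r + 2) → K)) : Ideal (PS K (r + 1)) where
  carrier := {f | ∀ v ∈ T, MvPolynomial.eval v f = 0}
  add_mem' := by
    intro a b ha hb v hv
    rw [map_add, ha v hv, hb v hv, add_zero]
  zero_mem' := by
    intro v hv
    rw [map_zero]
  smul_mem' := by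
    intro c f hf v hv
    rw [smul_eq_mul, map_mul, hf v hv, mul_zero]

/-- `X = V_+(I) ⊆ ℙ^r_K` is the image of `Z = V_+(J) ⊆ ℙ^{r+1}_K` under the linear
projection `π : ℙ^{r+1}_K ∖ {P} → ℙ^r_K` from the point `P = [p]`:  `I` is the
contraction of `J` along the substitution homomorphism induced by a surjective linear
map `K^{r+2} → K^{r+1}` with kernel `K·p`. -/
def IsProjectionFromPoint (I : Ideal (PS K r)) (J : Ideal (PS K (r + 1)))
    (p : Fin (r + 2) → K) : Prop :=
  ∃ π : (Fin (r + 2) → K) →ₗ[K] (Fin (r + 1) → K),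
    Function.Surjective π ∧ LinearMap.ker π = Submodule.span K {p} ∧
    I = Ideal.comap
      (aeval (fun j : Fin (r + 1) =>
        ∑ i : Fin (r + 2), MvPolynomial.C (π (Pi.single i 1) j) * X i) :
          PS K r →ₐ[K] PS K (r + 1)) J

end AMD


namespace SixFour
open scoped Matrix

set_option linter.unusedSectionVars false

/-- `a` is a nonzerodivisor modulo `J`. -/
def Rg {R : Type} [CommRing R] (a : R) (J : Ideal R) : Prop := ∀ y, a * y ∈ J → y ∈ J

/-- existence of a (weakly) regular sequence of length `k` in `m` modulo `J` -/
def HasReg {R : Type} [CommRing R] (m : Ideal R) : ℕ → Ideal R → Prop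
  | 0, _ => True
  | k + 1, J => ∃ a ∈ m, Rg a J ∧ HasReg m k (J ⊔ Ideal.span {a})

theorem mem_sup_span {R : Type} [CommRing R] {J : Ideal R} {a x : R} :
    x ∈ J ⊔ Ideal.span {a} ↔ ∃ z, x - a * z ∈ J := by
  constructor
  · intro h
    obtain ⟨j, hj, t, ht, rfl⟩ := Submodule.mem_sup.1 h
    obtain ⟨z, rfl⟩ := Ideal.mem_span_singleton'.1 ht
    exact ⟨z, by convert hj using 1; ring⟩
  · rintro ⟨z, hz⟩
    have : x = (x - a * z) + a * z := by ring
    rw [this]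
    exact Ideal.add_mem _ (Ideal.mem_sup_left hz)
      (Ideal.mem_sup_right (Ideal.mul_mem_right _ _ (Ideal.mem_span_singleton_self a)))

theorem Rg.swap {R : Type} [CommRing R] {J : Ideal R} {a c : R} (ha : Rg a J)
    (hc : Rg c (J ⊔ Ideal.span {a})) : Rg a (J ⊔ Ideal.span {c}) := by
  intro y hy
  obtain ⟨z, hz⟩ := mem_sup_span.1 hy
  have h1 : c * z ∈ J ⊔ Ideal.span {a} := mem_sup_span.2 ⟨y, by
    have := J.neg_mem hz; convert this using 1; ring⟩
  obtain ⟨z', hz'⟩ := mem_sup_span.1 (hc z h1)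
  refine mem_sup_span.2 ⟨z', ha _ ?_⟩
  have := J.add_mem hz (J.mul_mem_left c hz')
  convert this using 1; ring

/-- no socle modulo `J` -/
def NoSoc {R : Type} [CommRing R] (m J : Ideal R) : Prop :=
  ∀ y, (∀ z ∈ m, z * y ∈ J) → y ∈ J

theorem NoSoc.of_rg {R : Type} [CommRing R] {m J : Ideal R} {a : R} (ha : a ∈ m) (h : Rg a J) :
    NoSoc m J := fun y hy => h y (hy a ha)

theorem NoSoc.exchange {R : Type} [CommRing R] {m J : Ideal R} {a b : R} (ha : a ∈ m)
    (hra : Rg a J) (hrb : Rg b J) (h : NoSoc m (J ⊔ Ideal.span {a})) :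
    NoSoc m (J ⊔ Ideal.span {b}) := by
  intro z hz
  obtain ⟨y, hy⟩ := mem_sup_span.1 (hz a ha)
  have h1 : y ∈ J ⊔ Ideal.span {a} := by
    apply h
    intro u hu
    obtain ⟨y', hy'⟩ := mem_sup_span.1 (hz u hu)
    refine mem_sup_span.2 ⟨y', hrb _ ?_⟩
    have := J.sub_mem (J.mul_mem_left a hy') (J.mul_mem_left u hy)
    convert this using 1; ring
  obtain ⟨y'', hy''⟩ := mem_sup_span.1 h1
  refine mem_sup_span.2 ⟨y'', hra _ ?_⟩
  have := J.add_mem hy (J.mul_mem_left b hy'')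
  convert this using 1; ring

section poly
variable {K : Type} [Field K] {σ : Type} [Finite σ]

/-- irrelevant ideal -/
def irr (K : Type) [Field K] (σ : Type) : Ideal (MvPolynomial σ K) :=
  Ideal.span (Set.range (X : σ → MvPolynomial σ K))

theorem exists_avoid [Infinite K] (s : Set (Ideal (MvPolynomial σ K))) (hs : s.Finite)
    (h : ∀ J ∈ s, NoSoc (irr K σ) J) :
    ∃ c : MvPolynomial σ K, c.IsHomogeneous 1 ∧ ∀ J ∈ s, Rg c J := by
  classical
  let V := homogeneousSubmodule σ K 1
  let Ps : Set (Ideal (MvPolynomial σ K)) := ⋃ J ∈ s, associatedPrimes _ (MvPolynomial σ K ⧸ J)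
  have hPs : Ps.Finite := hs.biUnion fun J _ => associatedPrimes.finite _ _
  let sub : Ideal (MvPolynomial σ K) → Submodule K V := fun P =>
    (P.restrictScalars K).comap V.subtype
  have hne : ∀ P ∈ Ps, sub P ≠ ⊤ := by
    intro P hP htop
    simp only [Ps, Set.mem_iUnion] at hP
    obtain ⟨J, hJ, hP⟩ := hP
    have hP' := (AssociatedPrimes.mem_iff.1 hP)
    rw [isAssociatedPrime_iff] at hP'
    obtain ⟨hpr, x, hx⟩ := hP'
    obtain ⟨y, rfl⟩ := Ideal.Quotient.mk_surjective x
    have hle : irr K σ ≤ P := by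
      rw [irr, Ideal.span_le]
      rintro _ ⟨i, rfl⟩
      have : (⟨X i, isHomogeneous_X K i⟩ : V) ∈ sub P := htop ▸ Submodule.mem_top
      exact this
    have hmem : ∀ z, z ∈ P ↔ z * y ∈ J := by
      intro z
      rw [hx, Submodule.mem_colon_singleton, Submodule.mem_bot,
        ← Ideal.Quotient.eq_zero_iff_mem (I := J)]
      rfl
    have hy : y ∈ J := h J hJ y fun z hz => (hmem z).1 (hle hz)
    apply hpr.ne_top
    rw [Ideal.eq_top_iff_one, hmem, one_mul]
    exact hy
  obtain ⟨c, hc⟩ : ∃ c : V, ∀ P ∈ Ps, c ∉ sub P := by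
    by_contra hcon
    push Not at hcon
    have hfin : (sub '' Ps).Finite := hPs.image _
    have := Subspace.biUnion_ne_univ_of_top_notMem (s := hfin.toFinset) (by
      simp only [Set.Finite.mem_toFinset, Set.mem_image, not_exists, not_and]
      exact fun P hP => hne P hP)
    apply this
    rw [Set.eq_univ_iff_forall]
    intro c
    obtain ⟨P, hP, hcP⟩ := hcon c
    simp only [Set.mem_iUnion]
    exact ⟨sub P, by simp; exact ⟨P, hP, rfl⟩, hcP⟩
  refine ⟨c, c.2, fun J hJ y hy => ?_⟩
  by_contra hyJ
  have hne0 : Ideal.Quotient.mk J y ≠ 0 := by rwa [Ne, Ideal.Quotient.eq_zero_iff_mem]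
  have hz : (c : MvPolynomial σ K) ∈ ⋃ p ∈ associatedPrimes (MvPolynomial σ K) (MvPolynomial σ K ⧸ J), (p : Set (MvPolynomial σ K)) := by
    rw [biUnion_associatedPrimes_eq_zero_divisors]
    refine ⟨Ideal.Quotient.mk J y, hne0, ?_⟩
    rw [← Ideal.Quotient.eq_zero_iff_mem] at hy
    rw [map_mul] at hy
    exact hy
  simp only [Set.mem_iUnion] at hz
  obtain ⟨P, hP, hcP⟩ := hz
  exact hc P (by simp only [Ps, Set.mem_iUnion]; exact ⟨J, hJ, hP⟩) hcP

theorem lin_mem_irr {c : MvPolynomial σ K} (hc : c.IsHomogeneous 1) : c ∈ irr K σ := by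
  classical
  rw [irr, ← Set.image_univ, mem_ideal_span_X_image]
  intro m hm
  have h1 : Finsupp.degree m = 1 := by
    by_contra hne
    exact mem_support_iff.1 hm (hc.coeff_eq_zero hne)
  have : m ≠ 0 := by rintro rfl; simp at h1
  obtain ⟨i, hi⟩ := Finsupp.ne_iff.1 this
  exact ⟨i, trivial, hi⟩

theorem hasReg_quot [Infinite K] (k : ℕ) : ∀ (J : Ideal (MvPolynomial σ K)) (b : MvPolynomial σ K),
    HasReg (irr K σ) (k + 1) J → Rg b J → HasReg (irr K σ) k (J ⊔ Ideal.span {b}) := by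
  induction k with
  | zero => intro J b _ _; trivial
  | succ k ih =>
    rintro J b ⟨a, ham, hra, ⟨a2, ha2m, hra2, hrest⟩⟩ hrb
    have n1 : NoSoc (irr K σ) (J ⊔ Ideal.span {a}) := NoSoc.of_rg ha2m hra2
    have n2 := NoSoc.exchange ham hra hrb n1
    obtain ⟨c, hc1, hc⟩ := exists_avoid ({J, J ⊔ Ideal.span {a}, J ⊔ Ideal.span {b}}) (by simp)
      (by
        intro J' hJ'
        simp only [Set.mem_insert_iff, Set.mem_singleton_iff] at hJ'
        rcases hJ' with rfl | rfl | rfl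
        · exact NoSoc.of_rg ham hra
        · exact n1
        · exact n2)
    have hcJ := hc J (by simp)
    have hca := hc (J ⊔ Ideal.span {a}) (by simp)
    have hcb := hc (J ⊔ Ideal.span {b}) (by simp)
    have h1 := ih (J ⊔ Ideal.span {a}) c ⟨a2, ha2m, hra2, hrest⟩ hca
    have h2 : HasReg (irr K σ) (k + 1) (J ⊔ Ideal.span {c}) :=
      ⟨a, ham, Rg.swap hra hca, by rwa [sup_assoc, sup_comm (Ideal.span {c}), ← sup_assoc]⟩
    have h3 := ih _ b h2 (Rg.swap hrb hcb)
    exact ⟨c, lin_mem_irr hc1, hcb, by rwa [sup_assoc, sup_comm (Ideal.span {b}), ← sup_assoc]⟩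

theorem exists_lin_reg [Infinite K] (n : ℕ) : ∀ (J : Ideal (MvPolynomial σ K)),
    HasReg (irr K σ) n J → ∃ l : Fin n → MvPolynomial σ K, (∀ i, (l i).IsHomogeneous 1) ∧
      ∀ i, Rg (l i) (J ⊔ Ideal.span (l '' {j | j < i})) := by
  induction n with
  | zero => intro J _; exact ⟨fun i => i.elim0, fun i => i.elim0, fun i => i.elim0⟩
  | succ n ih =>
    rintro J h
    obtain ⟨a, ham, hra, hr⟩ := h
    obtain ⟨c, hc1, hc⟩ := exists_avoid {J} (by simp) (by
      rintro _ rfl; exact NoSoc.of_rg ham hra)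
    have hcJ := hc J rfl
    obtain ⟨l, hl1, hl⟩ := ih _ (hasReg_quot n J c ⟨a, ham, hra, hr⟩ hcJ)
    refine ⟨Fin.cons c l, fun i => ?_, fun i => ?_⟩
    · refine Fin.cases ?_ (fun i => ?_) i
      · simpa using hc1
      · simpa using hl1 i
    · refine Fin.cases ?_ (fun i => ?_) i
      · have : {j : Fin (n+1) | j < 0} = ∅ := by ext; simp
        simpa [this] using hcJ
      · have : (Fin.cons c l : Fin (n+1) → MvPolynomial σ K) '' {j | j < i.succ}
            = {c} ∪ l '' {j | j < i} := by
          ext x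
          constructor
          · rintro ⟨j, hj, rfl⟩
            revert hj
            refine Fin.cases ?_ (fun j => ?_) j
            · simp
            · intro hj
              right
              exact ⟨j, by simpa using hj, by simp⟩
          · rintro (rfl | ⟨j, hj, rfl⟩)
            · exact ⟨0, by simp, by simp⟩
            · exact ⟨j.succ, by simpa using hj, by simp⟩
        rw [this, Ideal.span_union, ← sup_assoc]
        simpa using hl i

end poly

theorem hasReg_of_list {A : Type} [CommRing A] (m : Ideal A) (rs : List A) : ∀ (J : Ideal A),
    (∀ x ∈ rs, x ∈ m) →
    (∀ (i : Fin rs.length), Rg (rs.get i) (J ⊔ Ideal.span {x | x ∈ rs.take i.1})) →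
    HasReg m rs.length J := by
  induction rs with
  | nil => intro J _ _; trivial
  | cons a t ih =>
    intro J hm h
    refine ⟨a, hm a (by simp), ?_, ih _ (fun x hx => hm x (by simp [hx])) fun i => ?_⟩
    · have := h ⟨0, by simp⟩
      simpa using this
    · have := h i.succ
      have e : {x | x ∈ (a :: t).take (i.succ : Fin (t.length+1)).1} = {a} ∪ {x | x ∈ t.take i.1} := by
        ext x; simp
      rw [e, Ideal.span_union, ← sup_assoc] at this
      simpa using this

theorem hasReg_comap {R : Type} [CommRing R] (I m : Ideal R) (k : ℕ) : ∀ (J : Ideal (R ⧸ I)),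
    HasReg (m.map (Ideal.Quotient.mk I)) k J → HasReg m k (J.comap (Ideal.Quotient.mk I)) := by
  induction k with
  | zero => intro J _; trivial
  | succ k ih =>
    rintro J ⟨a, ham, hra, hr⟩
    obtain ⟨a', ha', rfl⟩ := (Ideal.mem_map_iff_of_surjective _ Ideal.Quotient.mk_surjective).1 ham
    refine ⟨a', ha', fun y hy => ?_, ?_⟩
    · simp only [Ideal.mem_comap, map_mul] at hy ⊢
      exact hra _ hy
    · have := ih _ hr
      convert this using 1
      ext x
      rw [mem_sup_span, Ideal.mem_comap, mem_sup_span]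
      constructor
      · rintro ⟨z, hz⟩
        exact ⟨Ideal.Quotient.mk I z, by simpa using hz⟩
      · rintro ⟨z, hz⟩
        obtain ⟨z, rfl⟩ := Ideal.Quotient.mk_surjective z
        exact ⟨z, by simpa using hz⟩

/-- Output of part A. -/
theorem partA (K : Type) [Field K] [Infinite K] (r : ℕ) (I : Ideal (PS K r)) (d : ℕ)
    (hdim : AMD.DimEq K r I d) (hACM : AMD.IsACM K r I) :
    ∃ l : Fin (d+1) → PS K r, (∀ i, (l i).IsHomogeneous 1) ∧
      ∀ i, Rg (l i) (I ⊔ Ideal.span (l '' {j | j < i})) := by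
  obtain ⟨t, ht, ⟨rs, hlen, hm, hrs⟩, -⟩ := hACM
  have htd : t = d + 1 := by
    rw [AMD.DimEq] at hdim
    rw [hdim] at ht
    have := WithBot.coe_injective ht
    exact_mod_cast this.symm
  subst htd
  apply exists_lin_reg
  have h := hasReg_of_list (AMD.maxIdl K r I) rs ⊥ hm (by
    intro i y hy
    rw [bot_sup_eq] at hy ⊢
    exact hrs i y hy)
  rw [hlen] at h
  have := hasReg_comap I _ _ _ h
  rwa [← RingHom.ker_eq_comap_bot, Ideal.mk_ker] at this

end SixFour

namespace SixFour
open scoped Matrix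

set_option linter.unusedSectionVars false

section hom
variable {K : Type} [Field K] {σ : Type} [Finite σ]

/-- homogeneous ideal -/
def HomI (J : Ideal (MvPolynomial σ K)) : Prop :=
  ∀ p ∈ J, ∀ n : ℕ, homogeneousComponent n p ∈ J

theorem hc_mul {l : MvPolynomial σ K} {k : ℕ} (hl : l.IsHomogeneous k) (z : MvPolynomial σ K)
    (m : ℕ) : homogeneousComponent (m + k) (l * z) = l * homogeneousComponent m z := by
  classical
  have h : ∀ i, homogeneousComponent (m+k) (l * homogeneousComponent i z) =
      if i = m then l * homogeneousComponent i z else 0 := by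
    intro i
    rw [homogeneousComponent_of_mem (hl.mul (homogeneousComponent_isHomogeneous i z))]
    by_cases h : i = m
    · rw [if_pos h, if_pos (by omega)]
    · rw [if_neg h, if_neg (by omega)]
  conv_lhs => rw [← sum_homogeneousComponent z, Finset.mul_sum, map_sum]
  simp_rw [h]
  rw [Finset.sum_ite_eq' (Finset.range (z.totalDegree + 1)) m]
  split_ifs with hm
  · rfl
  · rw [homogeneousComponent_eq_zero, mul_zero]
    simpa using hm

theorem hc_mul_lt {l : MvPolynomial σ K} {k : ℕ} (hl : l.IsHomogeneous k) (z : MvPolynomial σ K)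
    (m : ℕ) (hm : m < k) : homogeneousComponent m (l * z) = 0 := by
  classical
  rw [← sum_homogeneousComponent z, Finset.mul_sum, map_sum]
  apply Finset.sum_eq_zero
  intro i _
  rw [homogeneousComponent_of_mem (hl.mul (homogeneousComponent_isHomogeneous i z)),
    if_neg (by omega)]

theorem HomI.sup {J J' : Ideal (MvPolynomial σ K)} (h : HomI J) (h' : HomI J') : HomI (J ⊔ J') := by
  intro p hp n
  obtain ⟨a, ha, b, hb, rfl⟩ := Submodule.mem_sup.1 hp
  rw [map_add]
  exact Ideal.add_mem _ (Ideal.mem_sup_left (h a ha n)) (Ideal.mem_sup_right (h' b hb n))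

theorem HomI.span {s : Set (MvPolynomial σ K)} {k : ℕ} (h : ∀ x ∈ s, x.IsHomogeneous k) :
    HomI (Ideal.span s) := by
  intro p hp n
  induction hp using Submodule.span_induction generalizing n with
  | mem x hx =>
    classical
    rw [homogeneousComponent_of_mem (h x hx)]
    split_ifs
    · exact Ideal.subset_span hx
    · exact Ideal.zero_mem _
  | zero => simp
  | add x y _ _ hx hy => rw [map_add]; exact Ideal.add_mem _ (hx n) (hy n)
  | smul a x hx ih =>
    classical
    rw [smul_eq_mul]
    rw [← sum_homogeneousComponent a, Finset.sum_mul, map_sum]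
    apply Ideal.sum_mem
    intro i _
    by_cases hi : i ≤ n
    · obtain ⟨j, rfl⟩ := Nat.exists_eq_add_of_le' hi
      rw [hc_mul (homogeneousComponent_isHomogeneous i a)]
      exact Ideal.mul_mem_left _ _ (ih j)
    · rw [hc_mul_lt (homogeneousComponent_isHomogeneous i a) _ _ (by omega)]
      exact Ideal.zero_mem _

/-- degree part of an ideal -/
def dp (J : Ideal (MvPolynomial σ K)) (m : ℕ) : Submodule K (MvPolynomial σ K) :=
  J.restrictScalars K ⊓ homogeneousSubmodule σ K m

theorem mem_dp {J : Ideal (MvPolynomial σ K)} {m : ℕ} {p : MvPolynomial σ K} :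
    p ∈ dp J m ↔ p ∈ J ∧ p.IsHomogeneous m := Iff.rfl

instance fdH (m : ℕ) : FiniteDimensional K (homogeneousSubmodule σ K m) :=
  Module.Finite.iff_fg.2 (homogeneousSubmodule_fg σ K m)

instance fdp (J : Ideal (MvPolynomial σ K)) (m : ℕ) : FiniteDimensional K (dp J m) :=
  Submodule.finiteDimensional_of_le (inf_le_right : dp J m ≤ homogeneousSubmodule σ K m)

theorem one_notMem_sup {J : Ideal (MvPolynomial σ K)} (hJ : HomI J) (h1 : (1 : MvPolynomial σ K) ∉ J)
    {l : MvPolynomial σ K} (hl : l.IsHomogeneous 1) :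
    (1 : MvPolynomial σ K) ∉ J ⊔ Ideal.span {l} := by
  intro h
  obtain ⟨z, hz⟩ := mem_sup_span.1 h
  apply h1
  have := hJ _ hz 0
  rw [map_sub, hc_mul_lt hl z 0 one_pos, sub_zero] at this
  simpa [homogeneousComponent_zero] using this

theorem finrank_step {J : Ideal (MvPolynomial σ K)} (hJ : HomI J)
    (h1 : (1 : MvPolynomial σ K) ∉ J) {l : MvPolynomial σ K} (hl : l.IsHomogeneous 1)
    (hr : Rg l J) (m : ℕ) :
    Module.finrank K (dp (J ⊔ Ideal.span {l}) (m+1)) + Module.finrank K (dp J m) =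
      Module.finrank K (dp J (m+1)) + Module.finrank K (homogeneousSubmodule σ K m) := by
  have hl0 : l ≠ 0 := by
    rintro rfl
    exact h1 (hr 1 (by simp))
  let μ : MvPolynomial σ K →ₗ[K] MvPolynomial σ K := LinearMap.mulLeft K l
  have hμ : Function.Injective μ := by
    intro a b h
    exact mul_left_cancel₀ hl0 h
  have e1 : dp (J ⊔ Ideal.span {l}) (m+1) = dp J (m+1) ⊔ (homogeneousSubmodule σ K m).map μ := by
    apply le_antisymm
    · rintro p ⟨hp, hpm⟩
      obtain ⟨z, hz⟩ := mem_sup_span.1 hp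
      have h2 := hJ _ hz (m+1)
      rw [map_sub, hc_mul hl, homogeneousComponent_eq_self hpm] at h2
      refine Submodule.mem_sup.2 ⟨p - l * homogeneousComponent m z, ⟨h2, ?_⟩,
        l * homogeneousComponent m z, ⟨_, homogeneousComponent_isHomogeneous m z, rfl⟩, by ring⟩
      refine IsHomogeneous.sub hpm ?_
      rw [add_comm m 1]
      exact hl.mul (homogeneousComponent_isHomogeneous m z)
    · refine sup_le ?_ ?_
      · rintro p ⟨hp, hpm⟩
        exact ⟨Ideal.mem_sup_left hp, hpm⟩
      · rintro _ ⟨z, hz, rfl⟩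
        refine ⟨Ideal.mem_sup_right (Ideal.mul_mem_right _ _ (Ideal.mem_span_singleton_self l)), ?_⟩
        rw [add_comm m 1]
        exact hl.mul hz
  have e2 : dp J (m+1) ⊓ (homogeneousSubmodule σ K m).map μ = (dp J m).map μ := by
    apply le_antisymm
    · rintro _ ⟨⟨hp, _⟩, ⟨z, hz, rfl⟩⟩
      exact ⟨z, ⟨hr z hp, hz⟩, rfl⟩
    · rintro _ ⟨z, ⟨hz, hzm⟩, rfl⟩
      refine ⟨⟨Ideal.mul_mem_left _ _ hz, ?_⟩, ⟨z, hzm, rfl⟩⟩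
      rw [add_comm m 1]
      exact hl.mul hzm
  have e3 := Submodule.finrank_sup_add_finrank_inf_eq (dp J (m+1))
    ((homogeneousSubmodule σ K m).map μ)
  rw [← e1, e2, (Submodule.equivMapOfInjective μ hμ _).symm.finrank_eq,
    (Submodule.equivMapOfInjective μ hμ _).symm.finrank_eq] at e3
  exact e3

theorem dp_zero {J : Ideal (MvPolynomial σ K)} (h1 : (1 : MvPolynomial σ K) ∉ J) : dp J 0 = ⊥ := by
  classical
  rw [eq_bot_iff]
  rintro p ⟨hp, hp0⟩
  have := homogeneousComponent_eq_self hp0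
  rw [homogeneousComponent_zero] at this
  rw [Submodule.mem_bot]
  by_contra hne
  apply h1
  have hc : coeff 0 p ≠ 0 := by
    intro h; rw [h, C_0] at this; exact hne this.symm
  have : (1 : MvPolynomial σ K) = C (coeff 0 p)⁻¹ * p := by
    rw [← this, coeff_C, if_pos rfl, ← C_mul, inv_mul_cancel₀ hc, C_1]
  rw [this]
  exact J.mul_mem_left _ hp

end hom

section hilb
variable {K : Type} [Field K] {r : ℕ}

theorem finrank_quot (J : Ideal (PS K r)) (m : ℕ) :
    Module.finrank K (AMD.quotComponent K r J m) + Module.finrank K (dp J m) =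
      Module.finrank K (homogeneousSubmodule (Fin (r+1)) K m) := by
  let f := (Ideal.Quotient.mkₐ K J).toLinearMap.domRestrict (homogeneousSubmodule (Fin (r+1)) K m)
  have h := f.finrank_range_add_finrank_ker
  have h1 : LinearMap.range f = AMD.quotComponent K r J m := by
    rw [AMD.quotComponent]
    exact LinearMap.range_domRestrict _ _
  have h2 : (LinearMap.ker f).map (homogeneousSubmodule (Fin (r+1)) K m).subtype = dp J m := by
    ext p
    constructor
    · rintro ⟨⟨z, hz⟩, hz', rfl⟩
      refine ⟨?_, hz⟩
      exact Ideal.Quotient.eq_zero_iff_mem.1 hz'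
    · rintro ⟨hp, hpm⟩
      exact ⟨⟨p, hpm⟩, Ideal.Quotient.eq_zero_iff_mem.2 hp, rfl⟩
  rw [h1] at h
  rw [← h, ← h2, (Submodule.equivMapOfInjective _ (Submodule.subtype_injective _) _).finrank_eq]

theorem hilb_step {J : Ideal (PS K r)} (hJ : HomI J) (h1 : (1 : PS K r) ∉ J) {l : PS K r}
    (hl : l.IsHomogeneous 1) (hr : Rg l J) :
    AMD.hilbSeries K r (J ⊔ Ideal.span {l}) = AMD.hilbSeries K r J * (1 - PowerSeries.X) := by
  have h1' := one_notMem_sup hJ h1 hl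
  ext m
  rw [mul_sub, mul_one, map_sub]
  cases m with
  | zero =>
    have a := finrank_quot J 0
    have b := finrank_quot (J ⊔ Ideal.span {l}) 0
    rw [dp_zero h1] at a
    rw [dp_zero h1'] at b
    simp only [AMD.hilbSeries, PowerSeries.coeff_mk, PowerSeries.coeff_zero_mul_X, sub_zero]
    simp only [finrank_bot] at a b
    omega
  | succ m =>
    rw [PowerSeries.coeff_succ_mul_X]
    simp only [AMD.hilbSeries, PowerSeries.coeff_mk]
    have a := finrank_quot J (m+1)
    have b := finrank_quot J m
    have c := finrank_quot (J ⊔ Ideal.span {l}) (m+1)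
    have e := finrank_step hJ h1 hl hr m
    omega

theorem span_image_succ {n : ℕ} (I : Ideal (PS K r)) (l : Fin n → PS K r) (i : Fin n) :
    I ⊔ Ideal.span (l '' {j | j.1 < i.1 + 1}) =
      (I ⊔ Ideal.span (l '' {j | j < i})) ⊔ Ideal.span {l i} := by
  have : l '' {j | j.1 < i.1 + 1} = l '' {j | j < i} ∪ {l i} := by
    have : {j : Fin n | j.1 < i.1 + 1} = {j | j < i} ∪ {i} := by
      ext j; simp only [Set.mem_ofPred_eq, Set.mem_union, Set.mem_singleton_iff, Fin.ext_iff,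
        Fin.lt_def]; omega
    rw [this, Set.image_union, Set.image_singleton]
  rw [this, Ideal.span_union, sup_assoc]

theorem hilb_iter {n : ℕ} {I : Ideal (PS K r)} (hI : HomI I) (h1 : (1 : PS K r) ∉ I)
    (l : Fin n → PS K r) (hl : ∀ i, (l i).IsHomogeneous 1)
    (hr : ∀ i, Rg (l i) (I ⊔ Ideal.span (l '' {j | j < i}))) (k : ℕ) (hk : k ≤ n) :
    (1 : PS K r) ∉ I ⊔ Ideal.span (l '' {j | j.1 < k}) ∧
    AMD.hilbSeries K r (I ⊔ Ideal.span (l '' {j | j.1 < k})) =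
      AMD.hilbSeries K r I * (1 - PowerSeries.X) ^ k := by
  induction k with
  | zero => simpa using h1
  | succ k ih =>
    obtain ⟨ih1, ih2⟩ := ih (by omega)
    have e := span_image_succ I l ⟨k, by omega⟩
    simp only at e
    rw [e]
    have hH : HomI (I ⊔ Ideal.span (l '' {j | j.1 < k})) := hI.sup (HomI.span (k := 1) (by
      rintro _ ⟨j, _, rfl⟩; exact hl j))
    refine ⟨one_notMem_sup hH ih1 (hl _), ?_⟩
    rw [pow_succ, ← mul_assoc, ← ih2]
    exact hilb_step hH ih1 (hl _) (hr ⟨k, by omega⟩)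

theorem exists_basis (L : Ideal (PS K r)) (m k : ℕ)
    (h : Module.finrank K (AMD.quotComponent K r L m) = k) :
    ∃ x : Fin k → PS K r, (∀ i, (x i).IsHomogeneous m) ∧
      (∀ c : Fin k → K, ∑ i, C (c i) * x i ∈ L → c = 0) ∧
      ∀ a : PS K r, a.IsHomogeneous m → ∃ c : Fin k → K, a - ∑ i, C (c i) * x i ∈ L := by
  have : Module.Finite K (AMD.quotComponent K r L m) := by
    rw [AMD.quotComponent]; infer_instance
  let b := Module.finBasisOfFinrankEq K (AMD.quotComponent K r L m) h
  have hb : ∀ i, ∃ y : PS K r, y.IsHomogeneous m ∧ Ideal.Quotient.mk L y = (b i : PS K r ⧸ L) := by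
    intro i
    obtain ⟨y, hy, hy'⟩ := (b i).2
    exact ⟨y, hy, hy'⟩
  choose x hx hxb using hb
  have key : ∀ c : Fin k → K, Ideal.Quotient.mk L (∑ i, C (c i) * x i) =
      ((∑ i, c i • b i : AMD.quotComponent K r L m) : PS K r ⧸ L) := by
    intro c
    rw [map_sum, Submodule.coe_sum]
    refine Finset.sum_congr rfl fun i _ => ?_
    rw [← smul_eq_C_mul, Submodule.coe_smul, ← hxb]
    rfl
  refine ⟨x, hx, ?_, ?_⟩
  · intro c hc
    rw [← Ideal.Quotient.eq_zero_iff_mem, key] at hc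
    have h0 : ∑ i, c i • b i = 0 := Subtype.ext hc
    have := Fintype.linearIndependent_iff.1 b.linearIndependent c h0
    exact funext this
  · intro a ha
    let a' : AMD.quotComponent K r L m := ⟨Ideal.Quotient.mk L a, ⟨a, ha, rfl⟩⟩
    refine ⟨fun i => b.repr a' i, ?_⟩
    rw [← Ideal.Quotient.eq_zero_iff_mem, map_sub, key, b.sum_repr, sub_self]

end hilb

/-- A reduction of `S/I` modulo linear forms `l`, with basis `1, x₁, …, x₄, w`. -/
structure Setup {K : Type} [Field K] {r n : ℕ} (I : Ideal (PS K r)) (l : Fin n → PS K r)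
    (x : Fin 4 → PS K r) (w : PS K r) : Prop where
  hl : ∀ i, (l i).IsHomogeneous 1
  hx : ∀ i, (x i).IsHomogeneous 1
  hw : w.IsHomogeneous 2
  reg : ∀ i, Rg (l i) (I ⊔ Ideal.span (l '' {j | j < i}))
  ind : ∀ (c : K) (c' : Fin 4 → K) (e : K),
    C c + ∑ i, C (c' i) * x i + C e * w ∈ I ⊔ Ideal.span (Set.range l) → c = 0 ∧ c' = 0 ∧ e = 0
  span1 : ∀ a : PS K r, a.IsHomogeneous 1 → ∃ c : Fin 4 → K,
    a - ∑ i, C (c i) * x i ∈ I ⊔ Ideal.span (Set.range l)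
  span2 : ∀ a : PS K r, a.IsHomogeneous 2 → ∃ e : K,
    a - C e * w ∈ I ⊔ Ideal.span (Set.range l)
  span3 : ∀ (a : PS K r) (m : ℕ), 3 ≤ m → a.IsHomogeneous m → a ∈ I ⊔ Ideal.span (Set.range l)

theorem hom_succ_mem {K : Type} [Field K] {σ : Type} [Finite σ] (L : Ideal (MvPolynomial σ K)) (m : ℕ)
    (h : ∀ a : MvPolynomial σ K, a.IsHomogeneous m → a ∈ L) (a : MvPolynomial σ K)
    (ha : a.IsHomogeneous (m+1)) : a ∈ L := by
  classical
  rw [← a.support_sum_monomial_coeff]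
  refine Ideal.sum_mem _ fun s hs => ?_
  have hd : s.degree = m + 1 := by
    by_contra hne
    exact mem_support_iff.1 hs (ha.coeff_eq_zero hne)
  have : s ≠ 0 := by rintro rfl; simp at hd
  obtain ⟨i, hi⟩ := Finsupp.ne_iff.1 this
  have hs' : s = (s - Finsupp.single i 1) + Finsupp.single i 1 := by
    rw [tsub_add_cancel_of_le]
    rw [Finsupp.single_le_iff]
    exact Nat.one_le_iff_ne_zero.2 hi
  have hdeg : (s - Finsupp.single i 1).degree = m := by
    have : s.degree = (s - Finsupp.single i 1).degree + 1 := by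
      conv_lhs => rw [hs', map_add, Finsupp.degree_single]
    omega
  rw [hs', ← mul_one (coeff _ a), ← monomial_mul]
  exact L.mul_mem_right _ (h _ (isHomogeneous_monomial _ hdeg))

theorem finrank_lin (K : Type) [Field K] (r : ℕ) :
    Module.finrank K (homogeneousSubmodule (Fin (r+1)) K 1) = r + 1 := by
  rw [homogeneousSubmodule_one_eq_span_X, finrank_span_eq_card]
  · simp
  · exact linearIndependent_X _ _

theorem partB (K : Type) [Field K] (r d : ℕ) (I : Ideal (PS K r)) (hprime : I.IsPrime)
    (hhom : AMD.IsHomIdeal K r I) (hnd : AMD.Nondeg K r I) (hcodim : d + 4 = r)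
    (hdeg : AMD.DegreeEq K r I d 6)
    (l : Fin (d+1) → PS K r) (hl : ∀ i, (l i).IsHomogeneous 1)
    (hr : ∀ i, Rg (l i) (I ⊔ Ideal.span (l '' {j | j < i}))) :
    ∃ x w, Setup I l x w := by
  have h1 : (1 : PS K r) ∉ I := fun h => hprime.ne_top ((Ideal.eq_top_iff_one I).2 h)
  obtain ⟨h, hh, h6⟩ := hdeg
  obtain ⟨hL1, hH⟩ := hilb_iter hhom h1 l hl hr (d+1) le_rfl
  have hrange : l '' {j | j.1 < d + 1} = Set.range l := by
    rw [← Set.image_univ]; congr 1; ext j; simp; omega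
  rw [hrange] at hL1 hH
  set L := I ⊔ Ideal.span (Set.range l) with hLdef
  have hLhom : HomI L := HomI.sup hhom (HomI.span (k := 1) (by rintro _ ⟨j, rfl⟩; exact hl j))
  have hco : ∀ m, (Module.finrank K (AMD.quotComponent K r L m) : ℤ) = h.coeff m := by
    intro m
    have := congrArg (PowerSeries.coeff m) (hH.trans hh)
    simpa [AMD.hilbSeries] using this
  -- coefficients 0 and 1
  have hI0 : Module.finrank K (AMD.quotComponent K r I 0) = 1 := by
    have a := finrank_quot I 0
    rw [dp_zero h1, finrank_bot, add_zero] at a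
    rw [a]
    refine finrank_eq_one_iff'.2 ⟨⟨1, isHomogeneous_one _ _⟩, ?_, ?_⟩
    · intro h; exact one_ne_zero (congrArg Subtype.val h)
    · rintro ⟨p, hp⟩
      refine ⟨coeff 0 p, Subtype.ext ?_⟩
      have := homogeneousComponent_eq_self hp
      rw [homogeneousComponent_zero] at this
      change coeff 0 p • (1 : PS K r) = p
      rw [smul_eq_C_mul, mul_one, this]
  have hI1 : Module.finrank K (AMD.quotComponent K r I 1) = r + 1 := by
    have a := finrank_quot I 1
    have : dp I 1 = ⊥ := by
      rw [eq_bot_iff]; rintro p ⟨hp, hp1⟩; exact hnd p hp hp1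
    rw [this, finrank_bot, add_zero, finrank_lin] at a
    exact a
  have hpow : ∀ k : ℕ, PowerSeries.coeff 1 ((1 - PowerSeries.X : PowerSeries ℤ) ^ k) = -(k : ℤ) ∧
      PowerSeries.coeff 0 ((1 - PowerSeries.X : PowerSeries ℤ) ^ k) = 1 := by
    intro k
    induction k with
    | zero => simp [PowerSeries.coeff_one]
    | succ k ih =>
      rw [pow_succ, mul_sub, mul_one, map_sub, map_sub, PowerSeries.coeff_zero_mul_X,
        PowerSeries.coeff_succ_mul_X, ih.1, ih.2]
      push_cast
      exact ⟨by ring, by norm_num⟩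
  have c0 : h.coeff 0 = 1 := by
    have := congrArg (PowerSeries.coeff 0) hh
    rw [PowerSeries.coeff_mul] at this
    simpa [AMD.hilbSeries, hI0] using this.symm
  have c1 : h.coeff 1 = 4 := by
    have := congrArg (PowerSeries.coeff 1) hh
    rw [PowerSeries.coeff_mul, Finset.Nat.sum_antidiagonal_eq_sum_range_succ_mk,
      Finset.sum_range_succ, Finset.sum_range_one] at this
    simp only [AMD.hilbSeries, PowerSeries.coeff_mk, Nat.sub_zero, Nat.sub_self] at this
    rw [hI0, hI1, (hpow _).1, (hpow _).2] at this
    rw [← this]; push_cast; have : (r : ℤ) = d + 4 := by exact_mod_cast hcodim.symm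
    rw [this]; ring
  have hsum : ∑ i ∈ Finset.range (h.natDegree + 1 + 1 + 1), h.coeff i = 6 := by
    have := Polynomial.eval_eq_sum_range' (p := h) (n := h.natDegree + 1 + 1 + 1) (by omega) 1
    rw [h6] at this
    simpa using this.symm
  have hnn : ∀ m, 0 ≤ h.coeff m := fun m => by rw [← hco]; positivity
  rw [Finset.sum_range_succ', Finset.sum_range_succ', Finset.sum_range_succ'] at hsum
  simp only [zero_add] at hsum
  norm_num at hsum
  rw [c0, c1] at hsum
  have hzero : ∀ m, h.coeff m = 0 → ∀ a : PS K r, a.IsHomogeneous m → a ∈ L := by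
    intro m hm a ha
    have : Module.finrank K (AMD.quotComponent K r L m) = 0 := by
      have := hco m; rw [hm] at this; exact_mod_cast this
    obtain ⟨x, -, -, hx⟩ := exists_basis L m 0 this
    obtain ⟨c, hc⟩ := hx a ha
    simpa using hc
  have hfin0 : ∀ m, (∀ a : PS K r, a.IsHomogeneous m → a ∈ L) → h.coeff m = 0 := by
    intro m hm
    rw [← hco]
    have : AMD.quotComponent K r L m = ⊥ := by
      rw [eq_bot_iff]
      rintro _ ⟨a, ha, rfl⟩
      exact Ideal.Quotient.eq_zero_iff_mem.2 (hm a ha)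
    rw [this, finrank_bot]; rfl
  have c2 : h.coeff 2 ≠ 0 := by
    intro h2
    have hall : ∀ k, ∀ a : PS K r, a.IsHomogeneous (k+2) → a ∈ L := by
      intro k
      induction k with
      | zero => exact hzero 2 h2
      | succ k ih => exact fun a ha => hom_succ_mem L (k+2) ih a ha
    have : ∑ i ∈ Finset.range h.natDegree, h.coeff (i + 1 + 1 + 1) = 0 :=
      Finset.sum_eq_zero fun i _ => hfin0 _ (hall (i+1))
    rw [this, h2] at hsum
    omega
  have hs0 : 0 ≤ ∑ i ∈ Finset.range h.natDegree, h.coeff (i + 1 + 1 + 1) :=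
    Finset.sum_nonneg fun i _ => hnn _
  have c2' : h.coeff 2 = 1 := by have := hnn 2; omega
  have c3 : h.coeff 3 = 0 := by
    have h0 : ∑ i ∈ Finset.range h.natDegree, h.coeff (i + 1 + 1 + 1) = 0 := by omega
    rw [Finset.sum_eq_zero_iff_of_nonneg (fun i _ => hnn _)] at h0
    by_cases hd : 0 < h.natDegree
    · exact h0 0 (by simpa using hd)
    · exact Polynomial.coeff_eq_zero_of_natDegree_lt (by omega)
  have f1 : Module.finrank K (AMD.quotComponent K r L 1) = 4 := by
    have := hco 1; rw [c1] at this; exact_mod_cast this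
  have f2 : Module.finrank K (AMD.quotComponent K r L 2) = 1 := by
    have := hco 2; rw [c2'] at this; exact_mod_cast this
  obtain ⟨x, hx, hxi, hxs⟩ := exists_basis L 1 4 f1
  obtain ⟨w, hw, hwi, hws⟩ := exists_basis L 2 1 f2
  refine ⟨x, w 0, hl, hx, hw 0, hr, ?_, hxs, ?_, ?_⟩
  · intro c c' e hmem
    have hs1 : (∑ i, C (c' i) * x i).IsHomogeneous 1 :=
      IsHomogeneous.sum _ _ _ fun i _ => (hx i).C_mul _
    have hs2 : (C e * w 0).IsHomogeneous 2 := (hw 0).C_mul _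
    have hs0 : (C c : PS K r).IsHomogeneous 0 := isHomogeneous_C _ _
    refine ⟨?_, ?_, ?_⟩
    · have := hLhom _ hmem 0
      rw [map_add, map_add, homogeneousComponent_of_mem hs0, homogeneousComponent_of_mem hs1,
        homogeneousComponent_of_mem hs2] at this
      simp only [if_true, zero_ne_one, if_false, add_zero, (by decide : (0:ℕ) ≠ 2)] at this
      by_contra hc
      apply hL1
      have := L.mul_mem_left (C c⁻¹) this
      rwa [← C_mul, inv_mul_cancel₀ hc, C_1] at this
    · have := hLhom _ hmem 1
      rw [map_add, map_add, homogeneousComponent_of_mem hs0, homogeneousComponent_of_mem hs1,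
        homogeneousComponent_of_mem hs2] at this
      simp only [if_true, one_ne_zero, if_false, add_zero, zero_add, (by decide : (1:ℕ) ≠ 2)] at this
      exact hxi _ this
    · have := hLhom _ hmem 2
      rw [map_add, map_add, homogeneousComponent_of_mem hs0, homogeneousComponent_of_mem hs1,
        homogeneousComponent_of_mem hs2] at this
      simp only [if_true, if_false, add_zero, zero_add, (by decide : (2:ℕ) ≠ 1),
        (by decide : (2:ℕ) ≠ 0)] at this
      have := hwi (fun _ => e) (by simpa using this)
      exact congrFun this 0
  · intro a ha
    obtain ⟨c, hc⟩ := hws a ha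
    exact ⟨c 0, by simpa using hc⟩
  · intro a m hm ha
    obtain ⟨k, rfl⟩ := Nat.exists_eq_add_of_le' hm
    clear hm
    revert a
    induction k with
    | zero => exact fun a ha => hzero 3 c3 a ha
    | succ k ih =>
      intro a ha
      exact hom_succ_mem L (k+3) ih a ha

end SixFour

namespace SixFour
open scoped Matrix
set_option linter.unusedSectionVars false

section coords
variable {K : Type} [Field K] {r n : ℕ} {I : Ideal (PS K r)} {l : Fin n → PS K r}
variable {b : Fin 6 → PS K r}

/-- combination with coefficients in `T = K[t_1, ..., t_n]`. -/
def comb (l : Fin n → PS K r) (b : Fin 6 → PS K r) (c : Fin 6 → MvPolynomial (Fin n) K) : PS K r :=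
  ∑ i, aeval l (c i) * b i

theorem comb_add (c c' : Fin 6 → MvPolynomial (Fin n) K) :
    comb l b (c + c') = comb l b c + comb l b c' := by
  simp [comb, add_mul, Finset.sum_add_distrib]

theorem comb_smul (t : MvPolynomial (Fin n) K) (c : Fin 6 → MvPolynomial (Fin n) K) :
    comb l b (t • c) = aeval l t * comb l b c := by
  simp [comb, Finset.mul_sum, mul_assoc]

theorem comb_sub (c c' : Fin 6 → MvPolynomial (Fin n) K) :
    comb l b (c - c') = comb l b c - comb l b c' := by
  simp [comb, sub_mul, Finset.sum_sub_distrib]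

theorem comb_unique (hreg : ∀ i, Rg (l i) (I ⊔ Ideal.span (l '' {j | j < i})))
    (hind : ∀ c : Fin 6 → K, ∑ i, C (c i) * b i ∈ I ⊔ Ideal.span (Set.range l) → c = 0) :
    ∀ (m : ℕ) (k : ℕ), k + m = n → ∀ (N : ℕ) (c : Fin 6 → MvPolynomial (Fin n) K),
      (∀ i s, coeff s (c i) ≠ 0 → (∀ j : Fin n, j.1 < k → s j = 0) ∧
        (∀ j : Fin n, j.1 = k → s j < N)) →
      comb l b c ∈ I ⊔ Ideal.span (l '' {j | j.1 < k}) → c = 0 := by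
  intro m
  induction m with
  | zero =>
    intro k hk N c hc hmem
    have hcc : ∀ i, c i = C (coeff 0 (c i)) := by
      intro i
      ext s
      rw [coeff_C]
      split_ifs with h
      · rw [← h]
      · by_contra hne
        apply h
        ext j
        exact ((hc i s hne).1 j (by omega)).symm
    have hr : l '' {j | j.1 < k} = Set.range l := by
      rw [← Set.image_univ]; congr 1; ext j; simp; omega
    rw [hr] at hmem
    have := hind (fun i => coeff 0 (c i)) (by
      convert hmem using 1
      unfold comb
      refine Finset.sum_congr rfl fun i _ => ?_
      conv_rhs => rw [hcc i]
      simp only [aeval_C]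
      rfl)
    funext i
    rw [hcc i, congrFun this i]; simp
  | succ m ih =>
    intro k hk
    have hkn : k < n := by omega
    intro N
    induction N with
    | zero =>
      intro c hc _
      funext i
      ext s
      by_contra hne
      exact absurd ((hc i s (by simpa using hne)).2 ⟨k, hkn⟩ rfl) (by omega)
    | succ N ihN =>
      intro c hc hmem
      set e : Fin n →₀ ℕ := Finsupp.single ⟨k, hkn⟩ 1 with he
      let c1 : Fin 6 → MvPolynomial (Fin n) K := fun i => (c i).divMonomial e
      let c0 : Fin 6 → MvPolynomial (Fin n) K := fun i => (c i).modMonomial e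
      have hcc : c = (X ⟨k, hkn⟩ : MvPolynomial (Fin n) K) • c1 + c0 := by
        funext i
        exact (divMonomial_add_modMonomial_single (c i) ⟨k, hkn⟩).symm
      have hcomb : comb l b c = l ⟨k, hkn⟩ * comb l b c1 + comb l b c0 := by
        rw [hcc, comb_add, comb_smul, aeval_X]
      have hset : l '' {j | j.1 < k + 1} = l '' {j | j.1 < k} ∪ {l ⟨k, hkn⟩} := by
        rw [← Set.image_singleton, ← Set.image_union]; congr 1; ext j
        simp [Fin.ext_iff]; omega
      have hle : I ⊔ Ideal.span (l '' {j | j.1 < k}) ≤ I ⊔ Ideal.span (l '' {j | j.1 < k + 1}) := by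
        refine sup_le_sup_left (Ideal.span_mono ?_) _
        rw [hset]; exact Set.subset_union_left
      have hc0 : c0 = 0 := by
        obtain ⟨M, hM⟩ : ∃ M, ∀ i s, coeff s (c0 i) ≠ 0 → ∀ j : Fin n, s j < M := by
          refine ⟨∑ i, (c0 i).totalDegree + 1, fun i s hs j => ?_⟩
          have h1 : s.degree ≤ (c0 i).totalDegree := le_totalDegree (mem_support_iff.2 hs)
          have h2 : s j ≤ s.degree := Finsupp.le_degree j s
          have h3 : (c0 i).totalDegree ≤ ∑ i, (c0 i).totalDegree :=
            Finset.single_le_sum (f := fun i => (c0 i).totalDegree) (fun _ _ => Nat.zero_le _)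
              (Finset.mem_univ i)
          omega
        refine ih (k+1) (by omega) M c0 (fun i s hs => ⟨?_, fun j _ => hM i s hs j⟩) ?_
        · have hnle : ¬ e ≤ s := fun hle => hs (coeff_modMonomial_of_le _ hle)
          have hs' : coeff s (c i) ≠ 0 := by
            rwa [← coeff_modMonomial_of_not_le _ hnle]
          intro j hj
          rcases Nat.lt_succ_iff_lt_or_eq.1 hj with h | h
          · exact (hc i s hs').1 j h
          · by_contra h0
            apply hnle
            rw [he, Finsupp.single_le_iff]
            have : j = ⟨k, hkn⟩ := Fin.ext h
            rw [← this]; omega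
        · have : comb l b c0 = comb l b c - l ⟨k, hkn⟩ * comb l b c1 := by rw [hcomb]; ring
          rw [this]
          refine Ideal.sub_mem _ (hle hmem) (Ideal.mul_mem_right _ _ ?_)
          refine Ideal.mem_sup_right (Ideal.subset_span ?_)
          rw [hset]; right; rfl
      have hc1 : c1 = 0 := by
        refine ihN c1 (fun i s hs => ?_) ?_
        · have hs' : coeff (e + s) (c i) ≠ 0 := by
            rwa [← coeff_divMonomial]
          obtain ⟨p, q⟩ := hc i _ hs'
          refine ⟨fun j hj => ?_, fun j hj => ?_⟩
          · have := p j hj; simp at this; exact this.2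
          · have := q j hj
            have hj' : j = ⟨k, hkn⟩ := Fin.ext hj
            subst hj'
            simp [he] at this; omega
        · have := hreg ⟨k, hkn⟩ (comb l b c1)
          apply this
          rw [hcomb, hc0] at hmem
          have hz : comb l b (0 : Fin 6 → MvPolynomial (Fin n) K) = 0 := by simp [comb]
          rw [hz, add_zero] at hmem
          exact hmem
      rw [hcc, hc0, hc1]; simp

theorem mem_L {a : PS K r} :
    a ∈ I ⊔ Ideal.span (Set.range l) ↔ ∃ f : Fin n → PS K r, a - ∑ j, l j * f j ∈ I := by
  rw [Submodule.mem_sup]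
  constructor
  · rintro ⟨y, hy, z, hz, rfl⟩
    obtain ⟨f, rfl⟩ := (Ideal.mem_span_range_iff_exists_fun).1 hz
    refine ⟨f, ?_⟩
    simpa [mul_comm] using hy
  · rintro ⟨f, hf⟩
    refine ⟨_, hf, ∑ j, l j * f j, ?_, by ring⟩
    exact Ideal.sum_mem _ fun j _ => Ideal.mul_mem_right _ _ (Ideal.subset_span ⟨j, rfl⟩)

theorem mem_L_succ (hI : HomI I) (hl : ∀ i, (l i).IsHomogeneous 1) {a : PS K r} {m : ℕ}
    (ha : a.IsHomogeneous (m+1)) (h : a ∈ I ⊔ Ideal.span (Set.range l)) :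
    ∃ f : Fin n → PS K r, (∀ j, (f j).IsHomogeneous m) ∧ a - ∑ j, l j * f j ∈ I := by
  obtain ⟨f, hf⟩ := mem_L.1 h
  refine ⟨fun j => homogeneousComponent m (f j), fun j => homogeneousComponent_isHomogeneous _ _, ?_⟩
  have := hI _ hf (m+1)
  rw [map_sub, map_sum, homogeneousComponent_eq_self ha] at this
  convert this using 3
  rw [hc_mul (hl _)]

theorem mem_L_zero (hI : HomI I) (hl : ∀ i, (l i).IsHomogeneous 1) {a : PS K r}
    (ha : a.IsHomogeneous 0) (h : a ∈ I ⊔ Ideal.span (Set.range l)) : a ∈ I := by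
  obtain ⟨f, hf⟩ := mem_L.1 h
  have := hI _ hf 0
  rw [map_sub, map_sum, homogeneousComponent_eq_self ha, Finset.sum_eq_zero, sub_zero] at this
  · exact this
  · intro j _
    exact hc_mul_lt (hl j) _ _ (by omega)

theorem comb_C (c : Fin 6 → K) : comb l b (fun i => C (c i)) = ∑ i, C (c i) * b i := by
  unfold comb
  refine Finset.sum_congr rfl fun i _ => ?_
  rw [aeval_C]; rfl

theorem comb_exists (hI : HomI I) (hl : ∀ i, (l i).IsHomogeneous 1) (dg : Fin 6 → ℕ)
    (hb : ∀ i, (b i).IsHomogeneous (dg i))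
    (hspan : ∀ (m : ℕ) (a : PS K r), a.IsHomogeneous m → ∃ c : Fin 6 → K,
      (∀ i, c i ≠ 0 → dg i = m) ∧ a - ∑ i, C (c i) * b i ∈ I ⊔ Ideal.span (Set.range l)) :
    ∀ (m : ℕ) (a : PS K r), a.IsHomogeneous m → ∃ c : Fin 6 → MvPolynomial (Fin n) K,
      (∀ i s, coeff s (c i) ≠ 0 → s.degree + dg i = m) ∧ a - comb l b c ∈ I := by
  have aux : ∀ (m : ℕ) (c : Fin 6 → K), (∀ i, c i ≠ 0 → dg i = m) →
      (∑ i, C (c i) * b i : PS K r).IsHomogeneous m := by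
    intro m c hc
    refine IsHomogeneous.sum _ _ _ fun i _ => ?_
    by_cases h : c i = 0
    · rw [h, C_0, zero_mul]; exact isHomogeneous_zero _ _ _
    · rw [← hc i h]; exact (hb i).C_mul _
  have aux2 : ∀ (m : ℕ) (c : Fin 6 → K), (∀ i, c i ≠ 0 → dg i = m) →
      ∀ i (s : Fin n →₀ ℕ), coeff s (C (c i) : MvPolynomial (Fin n) K) ≠ 0 → s.degree + dg i = m := by
    classical
    intro m c hc i s hs
    rw [coeff_C] at hs
    split_ifs at hs with h
    · subst h; simpa using hc i hs
    · exact absurd rfl hs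
  intro m
  induction m with
  | zero =>
    intro a ha
    obtain ⟨c, hc, hmem⟩ := hspan 0 a ha
    refine ⟨fun i => C (c i), aux2 0 c hc, ?_⟩
    rw [comb_C]
    exact mem_L_zero hI hl (ha.sub (aux 0 c hc)) hmem
  | succ m ih =>
    intro a ha
    obtain ⟨c, hc, hmem⟩ := hspan (m+1) a ha
    obtain ⟨f, hf, hfm⟩ := mem_L_succ hI hl (ha.sub (aux _ c hc)) hmem
    choose g hg hgm using fun j => ih (f j) (hf j)
    refine ⟨(fun i => C (c i)) + ∑ j, (X j : MvPolynomial (Fin n) K) • g j, ?_, ?_⟩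
    · classical
      intro i s hs
      rw [Pi.add_apply, coeff_add, Finset.sum_apply, coeff_sum] at hs
      by_cases h1 : coeff s (C (c i) : MvPolynomial (Fin n) K) = 0
      · rw [h1, zero_add] at hs
        obtain ⟨j, -, hj⟩ := Finset.exists_ne_zero_of_sum_ne_zero hs
        rw [Pi.smul_apply, smul_eq_mul, coeff_X_mul'] at hj
        split_ifs at hj with hjs
        · have := hg j i _ hj
          have h2 : s = (s - Finsupp.single j 1) + Finsupp.single j 1 := by
            rw [tsub_add_cancel_of_le]
            rw [Finsupp.single_le_iff]
            exact Nat.one_le_iff_ne_zero.2 (Finsupp.mem_support_iff.1 hjs)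
          have h3 : s.degree = (s - Finsupp.single j 1).degree + 1 := by
            conv_lhs => rw [h2, map_add, Finsupp.degree_single]
          omega
        · exact absurd rfl hj
      · exact aux2 _ c hc i s h1
    · have hs : comb l b (∑ j, (X j : MvPolynomial (Fin n) K) • g j) = ∑ j, l j * comb l b (g j) := by
        simp only [comb, Finset.sum_apply, Pi.smul_apply, map_sum, smul_eq_mul, map_mul, aeval_X,
          Finset.sum_mul, Finset.mul_sum]
        rw [Finset.sum_comm]
        simp only [mul_assoc]
      rw [comb_add, comb_C, hs]
      have := I.add_mem hfm (Ideal.sum_mem I (t := Finset.univ)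
        (f := fun j => l j * (f j - comb l b (g j))) fun j _ => I.mul_mem_left _ (hgm j))
      convert this using 1
      simp only [mul_sub, Finset.sum_sub_distrib]
      ring

end coords

/-- The basis `1, x₁, …, x₄, w`. -/
def bas {K : Type} [Field K] {r : ℕ} (x : Fin 4 → PS K r) (w : PS K r) : Fin 6 → PS K r :=
  ![1, x 0, x 1, x 2, x 3, w]

def dgs : Fin 6 → ℕ := ![0, 1, 1, 1, 1, 2]

section setup
variable {K : Type} [Field K] {r n : ℕ} {I : Ideal (PS K r)} {l : Fin n → PS K r}
variable {x : Fin 4 → PS K r} {w : PS K r}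

theorem bas_hom (h : Setup I l x w) : ∀ i, (bas x w i).IsHomogeneous (dgs i) := by
  intro i
  fin_cases i
  · exact isHomogeneous_one _ _
  · exact h.hx 0
  · exact h.hx 1
  · exact h.hx 2
  · exact h.hx 3
  · exact h.hw

theorem bas_span (h : Setup I l x w) (m : ℕ) (a : PS K r) (ha : a.IsHomogeneous m) :
    ∃ c : Fin 6 → K, (∀ i, c i ≠ 0 → dgs i = m) ∧
      a - ∑ i, C (c i) * bas x w i ∈ I ⊔ Ideal.span (Set.range l) := by
  match m, ha with
  | 0, ha =>
    refine ⟨![coeff 0 a, 0, 0, 0, 0, 0], ?_, ?_⟩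
    · intro i; fin_cases i <;> simp [dgs]
    · have := homogeneousComponent_eq_self ha
      rw [homogeneousComponent_zero] at this
      simp [Fin.sum_univ_succ, bas, this]
  | 1, ha =>
    obtain ⟨c, hc⟩ := h.span1 a ha
    refine ⟨![0, c 0, c 1, c 2, c 3, 0], ?_, ?_⟩
    · intro i; fin_cases i <;> simp [dgs]
    · simpa [Fin.sum_univ_succ, bas] using hc
  | 2, ha =>
    obtain ⟨c, hc⟩ := h.span2 a ha
    refine ⟨![0, 0, 0, 0, 0, c], ?_, ?_⟩
    · intro i; fin_cases i <;> simp [dgs]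
    · simpa [Fin.sum_univ_succ, bas] using hc
  | m+3, ha =>
    refine ⟨0, by simp, ?_⟩
    simpa using h.span3 a (m+3) (by omega) ha

theorem bas_ind (h : Setup I l x w) (c : Fin 6 → K)
    (hc : ∑ i, C (c i) * bas x w i ∈ I ⊔ Ideal.span (Set.range l)) : c = 0 := by
  have := h.ind (c 0) ![c 1, c 2, c 3, c 4] (c 5) (by
    convert hc using 1
    simp [Fin.sum_univ_succ, bas]
    ring)
  obtain ⟨h0, h1, h5⟩ := this
  funext i
  fin_cases i
  · exact h0
  · exact congrFun h1 0
  · exact congrFun h1 1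
  · exact congrFun h1 2
  · exact congrFun h1 3
  · exact h5

theorem setup_unique (h : Setup I l x w) (c : Fin 6 → MvPolynomial (Fin n) K)
    (hc : comb l (bas x w) c ∈ I) : c = 0 := by
  obtain ⟨M, hM⟩ : ∃ M, ∀ i s, coeff s (c i) ≠ 0 → ∀ j : Fin n, s j < M := by
    refine ⟨∑ i, (c i).totalDegree + 1, fun i s hs j => ?_⟩
    have h1 : s.degree ≤ (c i).totalDegree := le_totalDegree (mem_support_iff.2 hs)
    have h2 : s j ≤ s.degree := Finsupp.le_degree j s
    have h3 : (c i).totalDegree ≤ ∑ i, (c i).totalDegree :=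
      Finset.single_le_sum (f := fun i => (c i).totalDegree) (fun _ _ => Nat.zero_le _)
        (Finset.mem_univ i)
    omega
  exact comb_unique h.reg (bas_ind h) n 0 (by omega) M c
    (fun i s hs => ⟨fun j hj => absurd hj (by omega), fun j _ => hM i s hs j⟩)
    (Ideal.mem_sup_left hc)

theorem setup_exists (hI : HomI I) (h : Setup I l x w) (a : PS K r) :
    ∃ c : Fin 6 → MvPolynomial (Fin n) K, a - comb l (bas x w) c ∈ I := by
  choose g hg hgm using fun m => comb_exists hI h.hl dgs (bas_hom h) (bas_span h) m
    (homogeneousComponent m a) (homogeneousComponent_isHomogeneous _ _)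
  refine ⟨∑ m ∈ Finset.range (a.totalDegree + 1), g m, ?_⟩
  have hs : comb l (bas x w) (∑ m ∈ Finset.range (a.totalDegree + 1), g m) =
      ∑ m ∈ Finset.range (a.totalDegree + 1), comb l (bas x w) (g m) := by
    simp only [comb, Finset.sum_apply, map_sum, Finset.sum_mul]
    rw [Finset.sum_comm]
  have := Ideal.sum_mem I (t := Finset.range (a.totalDegree + 1)) fun m _ => hgm m
  rwa [Finset.sum_sub_distrib, sum_homogeneousComponent, ← hs] at this

/-- coordinates of `a` modulo `I` -/
def crd (hI : HomI I) (h : Setup I l x w) (a : PS K r) : Fin 6 → MvPolynomial (Fin n) K :=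
  (setup_exists hI h a).choose

theorem crd_spec (hI : HomI I) (h : Setup I l x w) (a : PS K r) :
    a - comb l (bas x w) (crd hI h a) ∈ I := (setup_exists hI h a).choose_spec

theorem crd_eq (hI : HomI I) (h : Setup I l x w) {a : PS K r}
    {c : Fin 6 → MvPolynomial (Fin n) K} (hc : a - comb l (bas x w) c ∈ I) : crd hI h a = c := by
  rw [← sub_eq_zero]
  apply setup_unique h
  rw [comb_sub]
  have := I.sub_mem hc (crd_spec hI h a)
  convert this using 1; ring

theorem crd_hom (hI : HomI I) (h : Setup I l x w) {a : PS K r} {m : ℕ} (ha : a.IsHomogeneous m)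
    (i : Fin 6) (s) (hs : coeff s (crd hI h a i) ≠ 0) : s.degree + dgs i = m := by
  obtain ⟨c, hc, hcm⟩ := comb_exists hI h.hl dgs (bas_hom h) (bas_span h) m a ha
  rw [crd_eq hI h hcm] at hs
  exact hc i s hs

end setup

/-- The `w`-coefficient functional, with values in `T`. -/
structure Tr {K : Type} [Field K] {r n : ℕ} (I : Ideal (PS K r)) (l : Fin n → PS K r)
    (E : PS K r → MvPolynomial (Fin n) K) : Prop where
  add : ∀ a b, E (a + b) = E a + E b
  smul : ∀ t a, E (aeval l t * a) = t * E a
  zero : ∀ a ∈ I, E a = 0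
  one : E 1 = 0
  hom : ∀ a m, a.IsHomogeneous (m + 2) → (E a).IsHomogeneous m
  hom1 : ∀ a, a.IsHomogeneous 1 → E a = 0

theorem exists_Tr {K : Type} [Field K] {r n : ℕ} {I : Ideal (PS K r)} {l : Fin n → PS K r}
    {x : Fin 4 → PS K r} {w : PS K r} (hI : HomI I) (h : Setup I l x w) :
    ∃ E, Tr I l E ∧ E w = 1 := by
  refine ⟨fun a => crd hI h a 5, ⟨?_, ?_, ?_, ?_, ?_, ?_⟩, ?_⟩
  · intro a b
    rw [crd_eq hI h (a := a + b) (c := crd hI h a + crd hI h b)]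
    · rfl
    · rw [comb_add]
      convert I.add_mem (crd_spec hI h a) (crd_spec hI h b) using 1; ring
  · intro t a
    rw [crd_eq hI h (a := aeval l t * a) (c := t • crd hI h a)]
    · rfl
    · rw [comb_smul]
      convert I.mul_mem_left (aeval l t) (crd_spec hI h a) using 1; ring
  · intro a ha
    rw [crd_eq hI h (a := a) (c := 0)]
    · rfl
    · simpa [comb] using ha
  · change crd hI h 1 5 = 0
    rw [crd_eq hI h (a := 1) (c := ![1,0,0,0,0,0])]
    · rfl
    · simp [comb, Fin.sum_univ_succ, bas]
  · intro a m ha s hs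
    have := crd_hom hI h ha 5 s hs
    simp only [dgs, Matrix.cons_val] at this
    have hw := congrArg (fun f => f s) (Finsupp.degree_eq_weight_one (σ := Fin n) (R := ℕ))
    change s.degree = Finsupp.weight 1 s at hw
    omega
  · intro a ha
    ext s
    by_contra hs
    have := crd_hom hI h ha 5 s (by simpa using hs)
    simp only [dgs, Matrix.cons_val] at this
    omega
  · change crd hI h w 5 = 1
    rw [crd_eq hI h (a := w) (c := ![0,0,0,0,0,1])]
    · rfl
    · simp [comb, Fin.sum_univ_succ, bas]

end SixFour

namespace SixFour
open scoped Matrix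
set_option linter.unusedSectionVars false

section tr
variable {K : Type} [Field K] {r n : ℕ} {I : Ideal (PS K r)} {l : Fin n → PS K r}
variable {E : PS K r → MvPolynomial (Fin n) K}

theorem Tr.map0 (h : Tr I l E) : E 0 = 0 := h.zero 0 I.zero_mem

theorem Tr.neg (h : Tr I l E) (a : PS K r) : E (-a) = -E a := by
  have := h.add a (-a)
  rw [add_neg_cancel, h.map0] at this
  exact (neg_eq_of_add_eq_zero_right this.symm).symm

theorem Tr.sub (h : Tr I l E) (a b : PS K r) : E (a - b) = E a - E b := by
  rw [sub_eq_add_neg, h.add, h.neg, sub_eq_add_neg]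

theorem Tr.sum (h : Tr I l E) {ι : Type} (s : Finset ι) (f : ι → PS K r) :
    E (∑ i ∈ s, f i) = ∑ i ∈ s, E (f i) := by
  classical
  induction s using Finset.induction_on with
  | empty => simpa using h.map0
  | insert a s ha ih => rw [Finset.sum_insert ha, Finset.sum_insert ha, h.add, ih]

theorem Tr.C_mul (h : Tr I l E) (c : K) (a : PS K r) : E (C c * a) = C c * E a := by
  rw [← h.smul, aeval_C]; rfl

theorem Tr.l_mul (h : Tr I l E) (j : Fin n) (a : PS K r) : E (l j * a) = X j * E a := by
  rw [← h.smul, aeval_X]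

theorem Tr.eq_of_sub_mem (h : Tr I l E) {a b : PS K r} (hab : a - b ∈ I) : E a = E b := by
  rw [← sub_eq_zero, ← h.sub]; exact h.zero _ hab

theorem Tr.aeval' (h : Tr I l E) (t : MvPolynomial (Fin n) K) : E (aeval l t) = 0 := by
  have := h.smul t 1
  rw [mul_one, h.one, mul_zero] at this
  exact this

theorem Tr.const (h : Tr I l E) {a : PS K r} (ha : a.IsHomogeneous 2) :
    E a = C (coeff 0 (E a)) := by
  have := homogeneousComponent_eq_self (h.hom a 0 ha)
  rw [homogeneousComponent_zero] at this
  exact this.symm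

/-- degree-two elements of `L` have zero trace -/
theorem Tr.memL (h : Tr I l E) (hI : HomI I) (hl : ∀ i, (l i).IsHomogeneous 1) {a : PS K r}
    (ha : a.IsHomogeneous 2) (hm : a ∈ I ⊔ Ideal.span (Set.range l)) : E a = 0 := by
  obtain ⟨f, hf, hfm⟩ := mem_L_succ hI hl (m := 1) ha hm
  rw [h.eq_of_sub_mem hfm, h.sum]
  refine Finset.sum_eq_zero fun j _ => ?_
  rw [h.l_mul, h.hom1 _ (hf j), mul_zero]

end tr

section setup
variable {K : Type} [Field K] {r n : ℕ} {I : Ideal (PS K r)} {l : Fin n → PS K r}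
variable {x : Fin 4 → PS K r} {w : PS K r}
variable {E : PS K r → MvPolynomial (Fin n) K}

/-- linear combination of the `x i` -/
def lin (x : Fin 4 → PS K r) (c : Fin 4 → K) : PS K r := ∑ i, C (c i) * x i

theorem lin_add (c c' : Fin 4 → K) : lin x (c + c') = lin x c + lin x c' := by
  simp [lin, add_mul, Finset.sum_add_distrib]

theorem lin_smul (t : K) (c : Fin 4 → K) : lin x (t • c) = C t * lin x c := by
  simp [lin, Finset.mul_sum, mul_assoc]

theorem lin_hom (h : Setup I l x w) (c : Fin 4 → K) : (lin x c).IsHomogeneous 1 :=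
  IsHomogeneous.sum _ _ _ fun i _ => (h.hx i).C_mul _

theorem lin_single (i : Fin 4) : lin x (Pi.single i 1) = x i := by
  unfold lin
  rw [Finset.sum_eq_single i]
  · simp
  · intro j _ hj; simp [hj]
  · simp

theorem Setup.change (h : Setup I l x w) {x' : Fin 4 → PS K r} {w' : PS K r}
    (M : Matrix (Fin 4) (Fin 4) K) (hM : M.det ≠ 0)
    (hx' : ∀ i, (x' i).IsHomogeneous 1) (hw' : w'.IsHomogeneous 2)
    (hxx : ∀ i, x' i - lin x (M i) ∈ I ⊔ Ideal.span (Set.range l))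
    (hww : w' - w ∈ I ⊔ Ideal.span (Set.range l)) : Setup I l x' w' := by
  set L := I ⊔ Ideal.span (Set.range l) with hL
  have key : ∀ c : Fin 4 → K, ∑ i, C (c i) * x' i - lin x (Matrix.vecMul c M) ∈ L := by
    intro c
    have e : ∑ i, C (c i) * x' i - lin x (Matrix.vecMul c M) =
        ∑ i, C (c i) * (x' i - lin x (M i)) := by
      have e2 : lin x (Matrix.vecMul c M) = ∑ i, C (c i) * lin x (M i) := by
        unfold lin Matrix.vecMul dotProduct
        simp only [map_sum, Finset.sum_mul, Finset.mul_sum, map_mul]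
        rw [Finset.sum_comm]
        simp only [mul_assoc]
      rw [e2, ← Finset.sum_sub_distrib]
      exact Finset.sum_congr rfl fun i _ => by ring
    rw [e]
    exact Ideal.sum_mem L fun i _ => L.mul_mem_left _ (hxx i)
  have hu : IsUnit M.det := isUnit_iff_ne_zero.2 hM
  refine ⟨h.hl, hx', hw', h.reg, ?_, ?_, ?_, h.span3⟩
  · intro c c' e hmem
    have h1 := h.ind c (Matrix.vecMul c' M) e (by
      have := L.sub_mem (L.sub_mem hmem (key c')) (L.mul_mem_left (C e) hww)
      convert this using 1
      unfold lin
      ring)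
    refine ⟨h1.1, ?_, h1.2.2⟩
    have h2 := congrArg (fun v => Matrix.vecMul v M⁻¹) h1.2.1
    simpa [Matrix.vecMul_vecMul, Matrix.mul_nonsing_inv M hu] using h2
  · intro a ha
    obtain ⟨c, hc⟩ := h.span1 a ha
    refine ⟨Matrix.vecMul c M⁻¹, ?_⟩
    have h3 := key (Matrix.vecMul c M⁻¹)
    rw [Matrix.vecMul_vecMul, Matrix.nonsing_inv_mul M hu, Matrix.vecMul_one] at h3
    have := L.sub_mem hc h3
    convert this using 1
    unfold lin
    ring
  · intro a ha
    obtain ⟨e, he⟩ := h.span2 a ha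
    refine ⟨e, ?_⟩
    have := L.sub_mem he (L.mul_mem_left (C e) hww)
    convert this using 1
    ring

theorem Tr.bas_zero (hI : HomI I) (h : Setup I l x w) (hE : Tr I l E) (y : PS K r)
    (h1 : E y = 0) (hx : ∀ i, E (y * x i) = 0) (hw : E (y * w) = 0) (a : PS K r) :
    E (y * a) = 0 := by
  have h2 : y * a - y * comb l (bas x w) (crd hI h a) ∈ I := by
    rw [← mul_sub]; exact I.mul_mem_left _ (crd_spec hI h a)
  rw [hE.eq_of_sub_mem h2, comb, Finset.mul_sum, hE.sum]
  refine Finset.sum_eq_zero fun i _ => ?_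
  have : y * (aeval l (crd hI h a i) * bas x w i) = aeval l (crd hI h a i) * (y * bas x w i) := by
    ring
  rw [this, hE.smul]
  have : E (y * bas x w i) = 0 := by
    fin_cases i
    · simpa [bas] using h1
    · exact hx 0
    · exact hx 1
    · exact hx 2
    · exact hx 3
    · exact hw
  rw [this, mul_zero]

theorem nondeg (hI : HomI I) (hp : I.IsPrime) (h : Setup I l x w) (hE : Tr I l E) (hw1 : E w = 1)
    (c : Fin 4 → K) (hc : ∀ i, E (lin x c * x i) = 0) : c = 0 := by
  by_contra hne
  set t := E (lin x c * w) with ht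
  set y := lin x c - aeval l t with hy
  have hyI : y ∉ I := by
    intro hyI
    apply hne
    have : C 0 + ∑ i, C (c i) * x i + C 0 * w ∈ I ⊔ Ideal.span (Set.range l) := by
      have h1 : lin x c = y + aeval l t := by rw [hy]; ring
      have h2 : C 0 + ∑ i, C (c i) * x i + C 0 * w = y + aeval l t := by
        rw [← h1]; simp [lin]
      rw [h2]
      refine Ideal.add_mem _ (Ideal.mem_sup_left hyI) (Ideal.mem_sup_right ?_)
      have hth : t.IsHomogeneous 1 := hE.hom _ 1 ((lin_hom h c).mul h.hw)
      rw [← t.support_sum_monomial_coeff, map_sum]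
      refine Ideal.sum_mem _ fun s hs => ?_
      have hs0 : s ≠ 0 := by
        rintro rfl
        have := hth.coeff_eq_zero (d := 0) (by simp)
        exact mem_support_iff.1 hs this
      obtain ⟨i, hi⟩ := Finsupp.ne_iff.1 hs0
      rw [aeval_monomial]
      refine Ideal.mul_mem_left _ _ ?_
      rw [Finsupp.prod]
      refine Ideal.mem_of_dvd _ (Finset.dvd_prod_of_mem _ (Finsupp.mem_support_iff.2 hi)) ?_
      exact Ideal.pow_mem_of_mem _ (Ideal.subset_span (Set.mem_range_self i)) _
        (Nat.pos_of_ne_zero hi)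
    exact (h.ind 0 c 0 this).2.1
  have hEy : ∀ a, E (y * a) = 0 := by
    refine hE.bas_zero hI h y ?_ ?_ ?_
    · rw [hy, hE.sub, hE.hom1 _ (lin_hom h c), hE.aeval', sub_zero]
    · intro i
      rw [hy, sub_mul, hE.sub, hc i, hE.smul, hE.hom1 _ (h.hx i), mul_zero, sub_zero]
    · rw [hy, sub_mul, hE.sub, hE.smul, hw1, mul_one, sub_self]
  have main : ∀ (m : ℕ) (s : Fin m → MvPolynomial (Fin n) K),
      ∑ k, aeval l (s k) * y ^ (k : ℕ) ∈ I → s = 0 := by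
    intro m
    induction m with
    | zero => intro s _; exact Subsingleton.elim _ _
    | succ m ih =>
      intro s hs
      have e1 : ∑ k, aeval l (s k) * y ^ (k : ℕ) =
          aeval l (s 0) + y * ∑ k : Fin m, aeval l (s k.succ) * y ^ (k : ℕ) := by
        rw [Fin.sum_univ_succ, Finset.mul_sum]
        simp only [Fin.val_zero, pow_zero, mul_one, Fin.val_succ, pow_succ]
        congr 1
        exact Finset.sum_congr rfl fun k _ => by ring
      rw [e1] at hs
      have h0 : s 0 = 0 := by
        have := hE.zero _ (I.mul_mem_right w hs)
        rw [add_mul, hE.add, hE.smul, hw1, mul_assoc, hEy, add_zero, mul_one] at this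
        exact this
      rw [h0, map_zero, zero_add] at hs
      have := ih (fun k => s k.succ) ((hp.mem_or_mem hs).resolve_left hyI)
      funext k
      refine Fin.cases h0 (fun k => congrFun this k) k
  have hdep : ¬ LinearIndependent (MvPolynomial (Fin n) K)
      (fun k : Fin 7 => crd hI h (y ^ (k : ℕ))) := by
    intro hli
    have := hli.fintype_card_le_finrank
    simp at this
  rw [Fintype.not_linearIndependent_iff] at hdep
  obtain ⟨g, hg, i, hi⟩ := hdep
  apply hi
  have := main 7 g (by
    have h1 := Ideal.sum_mem I (t := Finset.univ) (f := fun k : Fin 7 =>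
      aeval l (g k) * (y ^ (k:ℕ) - comb l (bas x w) (crd hI h (y ^ (k:ℕ)))))
      fun k _ => I.mul_mem_left _ (crd_spec hI h _)
    have h2 : ∑ k : Fin 7, aeval l (g k) * comb l (bas x w) (crd hI h (y ^ (k:ℕ))) = 0 := by
      simp_rw [← comb_smul]
      have : ∀ (f : Fin 7 → Fin 6 → MvPolynomial (Fin n) K),
          ∑ k, comb l (bas x w) (f k) = comb l (bas x w) (∑ k, f k) := by
        intro f
        simp only [comb, Finset.sum_apply, map_sum, Finset.sum_mul]
        rw [Finset.sum_comm]
      rw [this, hg]; simp [comb]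
    simp only [mul_sub, Finset.sum_sub_distrib] at h1
    rwa [h2, sub_zero] at h1)
  exact congrFun this i

end setup

/-! ### normal form of symmetric bilinear forms -/
section normal
variable {K : Type} [Field K] [IsAlgClosed K]

theorem exists_iso {V : Type} [AddCommGroup V] [Module K V] (B : LinearMap.BilinForm K V)
    (hs : ∀ u v, B u v = B v u) (u v : V) (huv : LinearIndependent K ![u, v]) :
    ∃ a b : K, a • u + b • v ≠ 0 ∧ B (a • u + b • v) (a • u + b • v) = 0 := by
  have hne : ∀ a b : K, a • u + b • v = 0 → a = 0 ∧ b = 0 := LinearIndependent.pair_iff.1 huv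
  by_cases hu : B u u = 0
  · refine ⟨1, 0, fun h => one_ne_zero (hne _ _ h).1, by simp [hu]⟩
  · obtain ⟨t, ht⟩ := IsAlgClosed.exists_root
      (Polynomial.C (B u u) * Polynomial.X ^ 2 + Polynomial.C (2 * B u v) * Polynomial.X +
        Polynomial.C (B v v)) (by rw [Polynomial.degree_quadratic hu]; decide)
    refine ⟨t, 1, fun h => one_ne_zero (hne _ _ h).2, ?_⟩
    simp only [Polynomial.IsRoot, Polynomial.eval_add, Polynomial.eval_mul, Polynomial.eval_C,
      Polynomial.eval_pow, Polynomial.eval_X] at ht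
    simp only [map_add, map_smul, LinearMap.add_apply, LinearMap.smul_apply, smul_eq_mul, hs v u]
    linear_combination ht

/-- the normal form -/
def G0 (κ : K) : Matrix (Fin 4) (Fin 4) K := !![0,0,0,1; 0,0,1,0; 0,1,0,0; 1,0,0,κ]

theorem normal_form (B : LinearMap.BilinForm K (Fin 4 → K))
    (hs : ∀ u v, B u v = B v u) (hnd : ∀ u, (∀ v, B u v = 0) → u = 0) :
    ∃ (e : Fin 4 → Fin 4 → K) (κ : K), ∀ i j, B (e i) (e j) = G0 κ i j := by
  have hdual : ∀ u, u ≠ 0 → ∃ v, B u v = 1 := by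
    intro u hu
    by_contra hcon
    push Not at hcon
    apply hu
    apply hnd
    intro v
    by_contra hv
    apply hcon ((B u v)⁻¹ • v)
    rw [map_smul, smul_eq_mul, inv_mul_cancel₀ hv]
  obtain ⟨e2, e2ne, h22⟩ : ∃ u : Fin 4 → K, u ≠ 0 ∧ B u u = 0 := by
    obtain ⟨a, b, h, h'⟩ := exists_iso B hs (Pi.single 0 1) (Pi.single 1 1) (by
      rw [LinearIndependent.pair_iff]
      intro s t h
      have h0 := congrFun h 0
      have h1 := congrFun h 1
      simp at h0 h1
      exact ⟨h0, h1⟩)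
    exact ⟨_, h, h'⟩
  obtain ⟨e3, h23⟩ := hdual e2 e2ne
  obtain ⟨e1, e1ne, h11, h12, h13⟩ : ∃ u : Fin 4 → K, u ≠ 0 ∧ B u u = 0 ∧ B u e2 = 0 ∧ B u e3 = 0 := by
    let f : (Fin 4 → K) →ₗ[K] K × K := (B e2).prod (B e3)
    have hr : 2 ≤ Module.finrank K (LinearMap.ker f) := by
      have h1 := LinearMap.finrank_range_add_finrank_ker f
      have h2 := Submodule.finrank_le (LinearMap.range f)
      simp at h1 h2
      omega
    have hr' : (Module.finrank K (LinearMap.ker f)) ≥ 2 := hr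
    obtain ⟨v, hv⟩ := exists_linearIndependent_of_le_finrank (R := K) (M := LinearMap.ker f) hr
    have hv2 : LinearIndependent K ![v 0, v 1] := by
      convert hv using 1
      ext i; fin_cases i <;> rfl
    have hv3 : LinearIndependent K ![(v 0 : Fin 4 → K), (v 1 : Fin 4 → K)] := by
      rw [LinearIndependent.pair_iff] at hv2 ⊢
      intro s t h
      exact hv2 s t (Subtype.ext h)
    obtain ⟨a, b, h, h'⟩ := exists_iso B hs _ _ hv3
    have hm : a • (v 0 : Fin 4 → K) + b • (v 1 : Fin 4 → K) ∈ LinearMap.ker f :=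
      (LinearMap.ker f).add_mem ((LinearMap.ker f).smul_mem _ (v 0).2)
        ((LinearMap.ker f).smul_mem _ (v 1).2)
    have hm' := LinearMap.mem_ker.1 hm
    refine ⟨_, h, h', ?_, ?_⟩
    · rw [hs]; exact congrArg Prod.fst hm'
    · rw [hs]; exact congrArg Prod.snd hm'
  obtain ⟨z, hz⟩ := hdual e1 e1ne
  set κ3 := B e3 e3 with h33
  obtain ⟨e4, h14, h24, h34⟩ : ∃ v, B e1 v = 1 ∧ B e2 v = 0 ∧ B e3 v = 0 := by
    refine ⟨z - (B z e3 - B z e2 * κ3) • e2 - (B z e2) • e3, ?_, ?_, ?_⟩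
    · simp [hz, h12, h13]
    · simp [h22, h23, hs e2 z]
    · simp only [map_sub, map_smul, smul_eq_mul, hs e3 z, hs e3 e2, h23, ← h33]; ring
  set κ4 := B e4 e4 with h44
  have h21 := hs e2 e1; rw [h12] at h21
  have h31 := hs e3 e1; rw [h13] at h31
  have h41 := hs e4 e1; rw [h14] at h41
  have h32 := hs e3 e2; rw [h23] at h32
  have h42 := hs e4 e2; rw [h24] at h42
  have h43 := hs e4 e3; rw [h34] at h43
  by_cases hk : κ4 = 0
  · refine ⟨![e2, e1, e4, e3], κ3, ?_⟩
    intro i j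
    fin_cases i <;> fin_cases j <;>
      simp [G0, h11, h12, h13, h14, h21, h22, h23, h24, h31, h32, h34, h41, h42, h43, ← h33, ← h44, hk]
  · obtain ⟨a, ha⟩ := IsAlgClosed.exists_pow_nat_eq (κ3 / κ4) (n := 2) (by norm_num)
    have ha' : a ^ 2 * κ4 = κ3 := by rw [ha, div_mul_cancel₀ _ hk]
    refine ⟨![e1 - a • e2, e2, e3 + a • e4 - (a * κ4) • e1, e4], κ4, ?_⟩
    intro i j
    fin_cases i <;> fin_cases j <;>
      simp [G0, h11, h12, h13, h14, h21, h22, h23, h24, h31, h32, h34, h41, h42, h43, ← h33, ← h44]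
    linear_combination -ha'

end normal
end SixFour

namespace SixFour
open scoped Matrix
set_option linter.unusedSectionVars false

structure Nice {K : Type} [Field K] {r n : ℕ} (I : Ideal (PS K r)) (l : Fin n → PS K r)
    (x : Fin 4 → PS K r) (w : PS K r) (E : PS K r → MvPolynomial (Fin n) K) (κ : K) : Prop where
  st : Setup I l x w
  tr : Tr I l E
  w1 : E w = 1
  q : ∀ i j, E (x i * x j) = C (G0 κ i j)
  wx : ∀ k, E (w * x k) = 0
  c012 : E (x 0 * x 1 * x 2) = 0
  c013 : E (x 0 * x 1 * x 3) = 0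
  c023 : E (x 0 * x 2 * x 3) = 0
  c123 : E (x 1 * x 2 * x 3) = 0
  b12 : E (x 1 * x 2 * w) = E (w * w)

section
variable {K : Type} [Field K] {r n : ℕ} {I : Ideal (PS K r)} {l : Fin n → PS K r}
variable {x : Fin 4 → PS K r} {w : PS K r}
variable {E : PS K r → MvPolynomial (Fin n) K}

/-- the bilinear form `q` -/
def qform (x : Fin 4 → PS K r) (hE : Tr I l E) : LinearMap.BilinForm K (Fin 4 → K) :=
  LinearMap.mk₂ K (fun c c' => coeff 0 (E (lin x c * lin x c')))
    (by intro a b c; rw [lin_add, add_mul, hE.add, coeff_add])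
    (by intro t a b; rw [lin_smul, mul_assoc, hE.C_mul, coeff_C_mul, smul_eq_mul])
    (by intro a b c; rw [lin_add, mul_add, hE.add, coeff_add])
    (by intro t a b; rw [lin_smul, mul_left_comm, hE.C_mul, coeff_C_mul, smul_eq_mul])

theorem aeval_mem_L (_hl : ∀ i, (l i).IsHomogeneous 1) {t : MvPolynomial (Fin n) K} {m : ℕ}
    (ht : t.IsHomogeneous (m+1)) :
    aeval l t ∈ I ⊔ Ideal.span (Set.range l) := by
  refine Ideal.mem_sup_right ?_
  rw [← t.support_sum_monomial_coeff, map_sum]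
  refine Ideal.sum_mem _ fun s hs => ?_
  have hs0 : s ≠ 0 := by
    rintro rfl
    have := ht.coeff_eq_zero (d := 0) (by simp)
    exact mem_support_iff.1 hs this
  obtain ⟨i, hi⟩ := Finsupp.ne_iff.1 hs0
  rw [aeval_monomial]
  refine Ideal.mul_mem_left _ _ ?_
  rw [Finsupp.prod]
  refine Ideal.mem_of_dvd _ (Finset.dvd_prod_of_mem _ (Finsupp.mem_support_iff.2 hi)) ?_
  exact Ideal.pow_mem_of_mem _ (Ideal.subset_span (Set.mem_range_self i)) _ (Nat.pos_of_ne_zero hi)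

theorem aeval_hom (hl : ∀ i, (l i).IsHomogeneous 1) {t : MvPolynomial (Fin n) K} {m : ℕ}
    (ht : t.IsHomogeneous m) : (aeval l t).IsHomogeneous m := by
  have := ht.aeval l (n := 1) hl
  simpa using this

theorem gauge (hI : HomI I) (h : Setup I l x w) (hE : Tr I l E) (hw1 : E w = 1) {κ : K}
    (hq : ∀ i j, E (x i * x j) = C (G0 κ i j)) : ∃ x w, Nice I l x w E κ := by
  have hq' : ∀ i j, E (x i * x j) = C (G0 κ i j) := hq
  have ex : ∀ i, E (x i) = 0 := fun i => hE.hom1 _ (h.hx i)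
  have gen2 : ∀ i j (s t : MvPolynomial (Fin n) K), E ((x i + aeval l s) * (x j + aeval l t)) = E (x i * x j) := by
    intro i j s t
    have : (x i + aeval l s) * (x j + aeval l t) = x i * x j + aeval l s * x j + aeval l t * x i
      + aeval l (s * t) := by rw [map_mul]; ring
    rw [this, hE.add, hE.add, hE.add, hE.smul, hE.smul, hE.aeval', ex, ex]; ring
  have gen3 : ∀ i j k (s t u : MvPolynomial (Fin n) K), E ((x i + aeval l s) * (x j + aeval l t) * (x k + aeval l u)) =
      E (x i * x j * x k) + s * C (G0 κ j k) + t * C (G0 κ i k) + u * C (G0 κ i j) := by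
    intro i j k s t u
    have : (x i + aeval l s) * (x j + aeval l t) * (x k + aeval l u) =
      x i * x j * x k + aeval l s * (x j * x k) + aeval l t * (x i * x k) + aeval l u * (x i * x j)
      + aeval l (s * t) * x k + aeval l (s * u) * x j + aeval l (t * u) * x i
      + aeval l (s * t * u) := by simp only [map_mul]; ring
    rw [this]
    simp only [hE.add, hE.smul, hE.aeval', ex, hq]; ring
  let τ : Fin 4 → MvPolynomial (Fin n) K := ![-E (x 0 * x 1 * x 2), -E (x 0 * x 1 * x 3),
    -E (x 0 * x 2 * x 3), -E (x 1 * x 2 * x 3)]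
  have hτ : ∀ i, (τ i).IsHomogeneous 1 := by
    have : ∀ i j k, (-E (x i * x j * x k)).IsHomogeneous 1 := fun i j k =>
      (hE.hom _ 1 (((h.hx i).mul (h.hx j)).mul (h.hx k))).neg
    intro i
    fin_cases i
    · exact this 0 1 2
    · exact this 0 1 3
    · exact this 0 2 3
    · exact this 1 2 3
  obtain ⟨y, hy⟩ : ∃ y : Fin 4 → PS K r, y = fun i => x i + aeval l (τ i) := ⟨_, rfl⟩
  have hy' : ∀ i, y i = x i + aeval l (τ i) := fun i => by rw [hy]
  have hyh : ∀ i, (y i).IsHomogeneous 1 := by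
    intro i; rw [hy']; exact (h.hx i).add (aeval_hom h.hl (hτ i))
  have ey : ∀ i, E (y i) = 0 := fun i => hE.hom1 _ (hyh i)
  have hqy : ∀ i j, E (y i * y j) = C (G0 κ i j) := by
    intro i j; rw [hy', hy', gen2, hq]
  have hc : E (y 0 * y 1 * y 2) = 0 ∧ E (y 0 * y 1 * y 3) = 0 ∧ E (y 0 * y 2 * y 3) = 0 ∧
      E (y 1 * y 2 * y 3) = 0 := by
    simp only [hy', gen3]
    simp [τ, G0]
  let ρ : Fin 4 → MvPolynomial (Fin n) K := ![-E (w * y 3) + C κ * E (w * y 0), -E (w * y 2),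
    -E (w * y 1), -E (w * y 0)]
  have hρ : ∀ i, (ρ i).IsHomogeneous 1 := by
    have : ∀ i, (-E (w * y i)).IsHomogeneous 1 := fun i => (hE.hom _ 1 (h.hw.mul (hyh i))).neg
    intro i
    fin_cases i
    · refine (this 3).add ?_
      exact (hE.hom _ 1 (h.hw.mul (hyh 0))).C_mul _
    · exact this 2
    · exact this 1
    · exact this 0
  obtain ⟨w0, hw0⟩ : ∃ w0 : PS K r, w0 = w + ∑ i, aeval l (ρ i) * y i := ⟨_, rfl⟩
  have hw0h : w0.IsHomogeneous 2 := by
    rw [hw0]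
    exact h.hw.add (IsHomogeneous.sum _ _ _ fun i _ => (aeval_hom h.hl (hρ i)).mul (hyh i))
  have hw01 : E w0 = 1 := by
    rw [hw0, hE.add, hE.sum, hw1]
    simp only [hE.smul, ey, mul_zero, Finset.sum_const_zero, add_zero]
  have hw0y : ∀ k, E (w0 * y k) = 0 := by
    have e : ∀ k, E (w0 * y k) = E (w * y k) + ∑ i, ρ i * C (G0 κ i k) := by
      intro k
      rw [hw0, add_mul, hE.add, Finset.sum_mul, hE.sum]
      simp only [mul_assoc, hE.smul, hqy]
    intro k
    rw [e]
    fin_cases k <;> simp [Fin.sum_univ_succ, ρ, G0] <;> ring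
  obtain ⟨σ, hσ⟩ : ∃ σ, σ = E (y 1 * y 2 * w0) - E (w0 * w0) := ⟨_, rfl⟩
  have hσh : σ.IsHomogeneous 2 := by
    rw [hσ]
    exact (hE.hom _ 2 (((hyh 1).mul (hyh 2)).mul hw0h)).sub (hE.hom _ 2 (hw0h.mul hw0h))
  refine ⟨y, w0 + aeval l σ, ⟨?_, hE, ?_, hqy, ?_, hc.1, hc.2.1, hc.2.2.1, hc.2.2.2, ?_⟩⟩
  · refine h.change 1 (by simp) hyh (hw0h.add (aeval_hom h.hl hσh)) (fun i => ?_) ?_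
    · have : lin x ((1 : Matrix (Fin 4) (Fin 4) K) i) = x i := by
        rw [← lin_single (x := x) i]; congr 1; ext j
        rw [Matrix.one_apply, Pi.single_apply]; simp [eq_comm]
      rw [this, hy', add_sub_cancel_left]
      exact aeval_mem_L h.hl (m := 0) (hτ i)
    · have : w0 + aeval l σ - w = ∑ i, aeval l (ρ i) * y i + aeval l σ := by rw [hw0]; ring
      rw [this]
      refine Ideal.add_mem _ (Ideal.sum_mem _ fun i _ => Ideal.mul_mem_right _ _
        (aeval_mem_L h.hl (m := 0) (hρ i))) (aeval_mem_L h.hl (m := 1) hσh)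
  · rw [hE.add, hE.aeval', hw01, add_zero]
  · intro k
    rw [add_mul, hE.add, hE.smul, ey, hw0y]; simp
  · have e1 : y 1 * y 2 * (w0 + aeval l σ) = y 1 * y 2 * w0 + aeval l σ * (y 1 * y 2) := by ring
    have e2 : (w0 + aeval l σ) * (w0 + aeval l σ) = w0 * w0 + aeval l σ * w0 + aeval l σ * w0
      + aeval l (σ * σ) := by rw [map_mul]; ring
    rw [e1, e2]
    simp only [hE.add, hE.smul, hE.aeval', hqy, hw01]
    have : G0 κ 1 2 = 1 := rfl
    rw [this, C_1, hσ]; ring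

theorem exists_nice [IsAlgClosed K] (hI : HomI I) (hp : I.IsPrime) (h : Setup I l x w) :
    ∃ x w E κ, Nice I l x w E κ := by
  obtain ⟨E, hE, hw1⟩ := exists_Tr hI h
  -- step 1
  obtain ⟨e, κ, he⟩ := normal_form (qform x hE)
    (fun u v => by
      change coeff 0 (E (lin x u * lin x v)) = coeff 0 (E (lin x v * lin x u)); rw [mul_comm])
    (fun u hu => by
      refine nondeg hI hp h hE hw1 u fun i => ?_
      have := hu (Pi.single i 1)
      change coeff 0 (E (lin x u * lin x (Pi.single i 1))) = 0 at this
      rw [lin_single] at this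
      rw [hE.const ((lin_hom h u).mul (h.hx i)), this, C_0])
  have hq : ∀ i j, E (lin x (e i) * lin x (e j)) = C (G0 κ i j) := by
    intro i j
    rw [hE.const ((lin_hom h _).mul (lin_hom h _)), ← he i j]; rfl
  have hdet : (Matrix.of e).det ≠ 0 := by
    intro h0
    obtain ⟨v, hv, hv0⟩ := Matrix.exists_vecMul_eq_zero_iff.2 h0
    apply hv
    have h1 : ∑ i, v i • e i = 0 := by
      rw [← hv0]; ext j; simp [Matrix.vecMul, dotProduct]
    have h2 : ∀ j, ∑ i, v i * G0 κ i j = 0 := by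
      intro j
      have h3 := congrArg (fun u => qform x hE u (e j)) h1
      simp only [map_sum, map_smul, LinearMap.sum_apply, LinearMap.smul_apply, he, smul_eq_mul,
        map_zero, LinearMap.zero_apply] at h3
      exact h3
    have a0 := h2 0
    have a1 := h2 1
    have a2 := h2 2
    have a3 := h2 3
    simp [Fin.sum_univ_succ, G0] at a0 a1 a2 a3
    rw [a0] at a3
    simp at a3
    ext i; fin_cases i
    · exact a3
    · exact a2
    · exact a1
    · exact a0
  have h1 : Setup I l (fun i => lin x (e i)) w :=
    h.change (Matrix.of e) hdet (fun i => lin_hom h _) h.hw (fun i => by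
      change lin x (e i) - lin x (e i) ∈ _; rw [sub_self]; exact Ideal.zero_mem _)
      (by rw [sub_self]; exact Ideal.zero_mem _)
  obtain ⟨x', w', h'⟩ := gauge hI h1 hE hw1 hq
  exact ⟨x', w', E, κ, h'⟩

end
end SixFour

namespace SixFour
open scoped Matrix
set_option linter.unusedSectionVars false

section
variable {K : Type} [Field K] {r n : ℕ} {I : Ideal (PS K r)} {l : Fin n → PS K r}
variable {x : Fin 4 → PS K r} {w : PS K r}
variable {E : PS K r → MvPolynomial (Fin n) K} {κ : K}

theorem Setup.decomp (h : Setup I l x w) (a : PS K r) : ∃ (c : K) (c' : Fin 4 → K) (e : K),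
    a - (C c + ∑ i, C (c' i) * x i + C e * w) ∈ I ⊔ Ideal.span (Set.range l) := by
  choose g hg hgm using fun m => bas_span h m
    (homogeneousComponent m a) (homogeneousComponent_isHomogeneous _ _)
  let g' : Fin 6 → K := fun i => ∑ m ∈ Finset.range (a.totalDegree + 1), g m i
  refine ⟨g' 0, ![g' 1, g' 2, g' 3, g' 4], g' 5, ?_⟩
  have := Ideal.sum_mem _ (t := Finset.range (a.totalDegree + 1)) fun m _ => hgm m
  rw [Finset.sum_sub_distrib, sum_homogeneousComponent, Finset.sum_comm] at this
  simp_rw [← Finset.sum_mul, ← map_sum] at this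
  convert this using 2
  rw [Fin.sum_univ_six, Fin.sum_univ_four]
  simp [bas, g']
  ring

theorem Nice.xx (hI : HomI I) (h : Nice I l x w E κ) (i j : Fin 4) :
    x i * x j - C (G0 κ i j) * w ∈ I ⊔ Ideal.span (Set.range l) := by
  have h2 : (x i * x j).IsHomogeneous 2 := (h.st.hx i).mul (h.st.hx j)
  obtain ⟨e, he⟩ := h.st.span2 _ h2
  have := h.tr.memL hI h.st.hl (h2.sub (h.st.hw.C_mul e)) he
  rw [h.tr.sub, h.q, h.tr.C_mul, h.w1, mul_one, ← C_sub, ← C_0] at this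
  have := C_injective _ _ this
  rwa [sub_eq_zero.1 this]

theorem Setup.irr_w (h : Setup I l x w) {p : PS K r} (hp : p.IsHomogeneous 1) :
    p * w ∈ I ⊔ Ideal.span (Set.range l) := h.span3 _ 3 le_rfl (hp.mul h.hw)

theorem lin_mem_span_X {p : PS K r} (hp : p.IsHomogeneous 1) :
    p ∈ Ideal.span (Set.range (X : Fin (r+1) → PS K r)) := by
  rw [← p.support_sum_monomial_coeff]
  refine Ideal.sum_mem _ fun s hs => ?_
  have hs0 : s ≠ 0 := by
    rintro rfl
    exact mem_support_iff.1 hs (hp.coeff_eq_zero (d := 0) (by simp))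
  obtain ⟨i, hi⟩ := Finsupp.ne_iff.1 hs0
  rw [monomial_eq]
  refine Ideal.mul_mem_left _ _ ?_
  rw [Finsupp.prod]
  refine Ideal.mem_of_dvd _ (Finset.dvd_prod_of_mem _ (Finsupp.mem_support_iff.2 hi)) ?_
  exact Ideal.pow_mem_of_mem _ (Ideal.subset_span (Set.mem_range_self i)) _ (Nat.pos_of_ne_zero hi)

theorem Nice.socle (hI : HomI I) (h : Nice I l x w E κ) (a : PS K r)
    (ha : ∀ p ∈ Ideal.span (Set.range (X : Fin (r+1) → PS K r)),
      p * a ∈ I ⊔ Ideal.span (Set.range l)) :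
    ∃ e : K, a - C e * w ∈ I ⊔ Ideal.span (Set.range l) := by
  set L := I ⊔ Ideal.span (Set.range l) with hL
  obtain ⟨c, c', e, hm⟩ := h.st.decomp a
  rw [← hL] at hm
  have key : ∀ j, C 0 + ∑ i, C ((Pi.single j c : Fin 4 → K) i) * x i + C (∑ i, c' i * G0 κ i j) * w ∈ L := by
    intro j
    have e0 : ∑ i, C ((Pi.single j c : Fin 4 → K) i) * x i = C c * x j := by
      rw [Finset.sum_eq_single j] <;> simp +contextual
    have h1 := ha (x j) (lin_mem_span_X (h.st.hx j))
    have h2 := L.mul_mem_left (x j) hm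
    have h3 := L.mul_mem_left (C e) (h.st.irr_w (h.st.hx j))
    have h4 := Ideal.sum_mem L (t := Finset.univ) (f := fun i => C (c' i) * (x i * x j - C (G0 κ i j) * w))
      fun i _ => L.mul_mem_left _ (h.xx hI i j)
    have := L.sub_mem (L.sub_mem (L.sub_mem h1 h2) h3) h4
    convert this using 1
    rw [e0]
    simp only [mul_sub, Finset.sum_sub_distrib, map_sum, map_mul, Finset.sum_mul, C_0, mul_add,
      Finset.mul_sum]
    have e1 : ∑ i, x j * (C (c' i) * x i) = ∑ i, C (c' i) * (x i * x j) :=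
      Finset.sum_congr rfl fun i _ => by ring
    have e2 : ∑ i, C (c' i) * (C (G0 κ i j) * w) = ∑ i, C (c' i) * C (G0 κ i j) * w :=
      Finset.sum_congr rfl fun i _ => by ring
    rw [e1, e2]; ring
  have k0 := h.st.ind _ _ _ (key 0)
  have k1 := h.st.ind _ _ _ (key 1)
  have k2 := h.st.ind _ _ _ (key 2)
  have k3 := h.st.ind _ _ _ (key 3)
  have hc : c = 0 := by simpa using congrFun k0.2.1 0
  have a0 := k0.2.2
  have a1 := k1.2.2
  have a2 := k2.2.2
  have a3 := k3.2.2
  simp [Fin.sum_univ_succ, G0] at a0 a1 a2 a3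
  rw [a0] at a3
  simp at a3
  have hc' : c' = 0 := by
    ext i; fin_cases i
    · exact a3
    · exact a2
    · exact a1
    · exact a0
  refine ⟨e, ?_⟩
  rw [hc, hc'] at hm
  simpa using hm

theorem take_ofFn {α : Type} {n : ℕ} (f : Fin n → α) (k : ℕ) :
    {y | y ∈ (List.ofFn f).take k} = f '' {j | j.1 < k} := by
  ext y
  simp only [Set.mem_ofPred_eq, Set.mem_image, List.mem_take_iff_getElem]
  constructor
  · rintro ⟨i, hi, rfl⟩
    simp at hi
    exact ⟨⟨i, by omega⟩, by simp; omega, by simp⟩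
  · rintro ⟨j, hj, rfl⟩
    exact ⟨j.1, by simp; omega, by simp⟩

theorem mk_mem_span (I : Ideal (PS K r)) (s : Set (PS K r)) (a : PS K r) :
    Ideal.Quotient.mk I a ∈ Ideal.span (Ideal.Quotient.mk I '' s) ↔ a ∈ I ⊔ Ideal.span s := by
  rw [← Ideal.map_span, ← Ideal.mem_comap, Ideal.comap_map_of_surjective _ Ideal.Quotient.mk_surjective,
    sup_comm, ← RingHom.ker_eq_comap_bot, Ideal.mk_ker]

theorem gorenstein (d : ℕ) {l : Fin (d+1) → PS K r} {E : PS K r → MvPolynomial (Fin (d+1)) K}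
    (hI : HomI I) (hdim : AMD.DimEq K r I d) (h : Nice I l x w E κ) :
    AMD.IsArithGorenstein K r I := by
  have hset : {y | y ∈ List.ofFn (fun j => Ideal.Quotient.mk I (l j))} =
      Ideal.Quotient.mk I '' Set.range l := by
    ext y; change y ∈ List.ofFn _ ↔ _; rw [List.mem_ofFn, ← Set.range_comp]; rfl
  refine ⟨d+1, List.ofFn (fun j => Ideal.Quotient.mk I (l j)), ?_, by simp, ?_, ?_, ?_⟩
  · rw [hdim]; push_cast; rfl
  · intro y hy
    rw [List.mem_ofFn] at hy
    obtain ⟨j, rfl⟩ := hy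
    exact Ideal.mem_map_of_mem _ (lin_mem_span_X (h.st.hl j))
  · intro i y hy
    obtain ⟨a, rfl⟩ := Ideal.Quotient.mk_surjective y
    have hi : i.1 < d + 1 := by have := i.2; simpa using this
    have e1 : (fun j => Ideal.Quotient.mk I (l j)) '' {j : Fin (d+1) | j.1 < i.1} =
        Ideal.Quotient.mk I '' (l '' {j : Fin (d+1) | j < ⟨i.1, hi⟩}) := by
      rw [Set.image_image]; rfl
    rw [take_ofFn, e1] at hy ⊢
    rw [List.get_eq_getElem, List.getElem_ofFn, ← map_mul, mk_mem_span] at hy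
    rw [mk_mem_span]
    exact h.st.reg _ _ hy
  · set L := I ⊔ Ideal.span (Set.range l) with hL
    have hJm : ∀ a, Ideal.Quotient.mk I a ∈
        Ideal.span {y | y ∈ List.ofFn (fun j => Ideal.Quotient.mk I (l j))} ↔ a ∈ L := by
      intro a; rw [hset, mk_mem_span]
    suffices H : ∀ J : Ideal (PS K r ⧸ I), (∀ a, Ideal.Quotient.mk I a ∈ J ↔ a ∈ L) →
        Module.finrank K (AMD.socle K ((PS K r ⧸ I) ⧸ J)
          (Ideal.map (Ideal.Quotient.mk J) (AMD.maxIdl K r I))) = 1 from H _ hJm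
    clear hJm
    intro J hJm
    have hmk : ∀ a : PS K r, Ideal.Quotient.mk J
        (Ideal.Quotient.mk I a) = 0 ↔ a ∈ L := by
      intro a
      rw [Ideal.Quotient.eq_zero_iff_mem, hJm]
    have hmax : ∀ z ∈ Ideal.map (Ideal.Quotient.mk J)
        (AMD.maxIdl K r I), ∃ p ∈ Ideal.span (Set.range (X : Fin (r+1) → PS K r)),
          Ideal.Quotient.mk J
            (Ideal.Quotient.mk I p) = z := by
      intro z hz
      obtain ⟨z', hz', rfl⟩ := (Ideal.mem_map_iff_of_surjective _ Ideal.Quotient.mk_surjective).1 hz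
      obtain ⟨p, hp, rfl⟩ := (Ideal.mem_map_iff_of_surjective _ Ideal.Quotient.mk_surjective).1 hz'
      exact ⟨p, hp, rfl⟩
    haveI : Module.Free K (AMD.socle K ((PS K r ⧸ I) ⧸ J)
          (Ideal.map (Ideal.Quotient.mk J) (AMD.maxIdl K r I))) := Module.Free.of_divisionRing K _
    refine finrank_eq_one_iff'.2 ?_
    refine ⟨⟨Ideal.Quotient.mk _ (Ideal.Quotient.mk I w), ?_⟩, ?_, ?_⟩
    · intro z hz
      obtain ⟨p, hp, rfl⟩ := hmax z hz
      rw [← map_mul, ← map_mul, hmk]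
      induction hp using Submodule.span_induction with
      | mem y hy => obtain ⟨i, rfl⟩ := hy; exact h.st.irr_w (isHomogeneous_X _ _)
      | zero => rw [zero_mul]; exact L.zero_mem
      | add a b _ _ ha hb =>
        rw [add_mul]
        exact L.add_mem (ha (Ideal.mem_map_of_mem _ (Ideal.mem_map_of_mem _ ‹_›)))
          (hb (Ideal.mem_map_of_mem _ (Ideal.mem_map_of_mem _ ‹_›)))
      | smul t a _ ha =>
        rw [smul_eq_mul, mul_assoc]
        exact L.mul_mem_left _ (ha (Ideal.mem_map_of_mem _ (Ideal.mem_map_of_mem _ ‹_›)))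
    · intro h0
      have h1 := (hmk w).1 (congrArg Subtype.val h0)
      have := h.st.ind 0 0 1 (by simpa using h1)
      exact one_ne_zero this.2.2
    · rintro ⟨y, hy⟩
      obtain ⟨y, rfl⟩ := Ideal.Quotient.mk_surjective y
      obtain ⟨a, rfl⟩ := Ideal.Quotient.mk_surjective y
      obtain ⟨e, he⟩ := h.socle hI a (fun p hp => by
        have := hy _ (Ideal.mem_map_of_mem _ (Ideal.mem_map_of_mem _ hp))
        rw [← map_mul, ← map_mul, hmk] at this
        exact this)
      rw [← hL, ← hmk, map_sub, map_sub, sub_eq_zero] at he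
      refine ⟨e, Subtype.ext (Eq.trans ?_ he.symm)⟩
      rw [map_mul, map_mul]
      change e • _ = _
      rw [Algebra.smul_def]
      rfl
end
end SixFour

namespace SixFour
open scoped Matrix
set_option linter.unusedSectionVars false
set_option linter.unnecessarySeqFocus false
set_option linter.unusedSimpArgs false
set_option linter.unusedVariables false

section
variable {R : Type} [CommRing R] (k a b c d : R)

def D1 {R : Type} [CommRing R] (k a b c d : R) : Matrix (Fin 1) (Fin 9) R :=
  !![a^2, b^2, a*b, a*c, b*d, c*d, c^2, d^2 - k*a*d, a*d - b*c]

theorem D1_mv (z : Fin 9 → R) : D1 k a b c d *ᵥ z =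
  ![a^2*z 0 + b^2*z 1 + a*b*z 2 + a*c*z 3 + b*d*z 4 + c*d*z 5 + c^2*z 6 + d^2*z 7 - k*a*d*z 7 + a*d*z 8 - b*c*z 8] := by
  ext i
  fin_cases i <;> simp [D1, Matrix.mulVec, dotProduct, Fin.sum_univ_succ] <;> try ring1

def D2 {R : Type} [CommRing R] (k a b c d : R) : Matrix (Fin 9) (Fin 16) R :=
  !![b, c, 0, d, 0, 0, 0, 0, 0, 0, 0, 0, 0, 0, 0, 0;
    0, 0, a, 0, 0, 0, c, 0, 0, 0, d, 0, 0, 0, 0, 0;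
    -a, 0, -b, 0, c, 0, 0, d, 0, 0, 0, 0, 0, 0, 0, 0;
    0, -a, 0, -b, -b, c, 0, 0, d, 0, 0, -k*b, -k*b, 0, 0, 0;
    0, 0, 0, 0, 0, 0, -a, -a, 0, 0, -b, c, 0, 0, d - k*a, 0;
    0, 0, 0, 0, 0, 0, 0, 0, 0, a, 0, 0, b, c, 0, d;
    0, 0, 0, 0, 0, -a, 0, 0, -b, -b, 0, 0, 0, -d, 0, -k*b;
    0, 0, 0, 0, 0, 0, 0, 0, 0, 0, 0, -a, -a, 0, -b, -c;
    0, 0, 0, -a, 0, 0, b, 0, -c, -c, 0, d - k*a, d - k*a, 0, 0, -k*c]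

theorem D2_mv (z : Fin 16 → R) : D2 k a b c d *ᵥ z =
  ![b*z 0 + c*z 1 + d*z 3,
    a*z 2 + c*z 6 + d*z 10,
    -a*z 0 - b*z 2 + c*z 4 + d*z 7,
    -a*z 1 - b*z 3 - b*z 4 + c*z 5 + d*z 8 - k*b*z 11 - k*b*z 12,
    -a*z 6 - a*z 7 - b*z 10 + c*z 11 + d*z 14 - k*a*z 14,
    a*z 9 + b*z 12 + c*z 13 + d*z 15,
    -a*z 5 - b*z 8 - b*z 9 - d*z 13 - k*b*z 15,
    -a*z 11 - a*z 12 - b*z 14 - c*z 15,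
    -a*z 3 + b*z 6 - c*z 8 - c*z 9 + d*z 11 - k*a*z 11 + d*z 12 - k*a*z 12 - k*c*z 15] := by
  ext i
  fin_cases i <;> simp [D2, Matrix.mulVec, dotProduct, Fin.sum_univ_succ] <;> try ring1

def D3 {R : Type} [CommRing R] (k a b c d : R) : Matrix (Fin 16) (Fin 9) R :=
  !![c, d, 0, 0, 0, 0, 0, 0, 0;
    -b, 0, d, 0, 0, 0, 0, 0, 0;
    0, c, 0, d, 0, 0, k*c, 0, 0;
    0, -b, -c, 0, 0, 0, 0, 0, 0;
    a, b, 0, 0, d, 0, k*b, 0, 0;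
    0, 0, -b, 0, 0, d, 0, k*b, 0;
    0, -a, 0, 0, 0, 0, d - k*a, 0, 0;
    0, a, 0, b, -c, 0, 0, 0, 0;
    0, 0, a, 0, b, -c, 0, 0, 0;
    0, 0, 0, 0, -b, c, 0, d, -k*b;
    0, 0, 0, -a, 0, 0, -c, 0, 0;
    0, 0, 0, 0, -a, 0, -b, 0, d - k*a;
    0, 0, 0, 0, a, 0, 0, c, -d + k*a;
    0, 0, 0, 0, 0, -a, 0, -b, 0;
    0, 0, 0, 0, 0, 0, a, 0, -c;
    0, 0, 0, 0, 0, 0, 0, -a, b]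

theorem D3_mv (z : Fin 9 → R) : D3 k a b c d *ᵥ z =
  ![c*z 0 + d*z 1,
    -b*z 0 + d*z 2,
    c*z 1 + d*z 3 + k*c*z 6,
    -b*z 1 - c*z 2,
    a*z 0 + b*z 1 + d*z 4 + k*b*z 6,
    -b*z 2 + d*z 5 + k*b*z 7,
    -a*z 1 + d*z 6 - k*a*z 6,
    a*z 1 + b*z 3 - c*z 4,
    a*z 2 + b*z 4 - c*z 5,
    -b*z 4 + c*z 5 + d*z 7 - k*b*z 8,
    -a*z 3 - c*z 6,
    -a*z 4 - b*z 6 + d*z 8 - k*a*z 8,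
    a*z 4 + c*z 7 - d*z 8 + k*a*z 8,
    -a*z 5 - b*z 7,
    a*z 6 - c*z 8,
    -a*z 7 + b*z 8] := by
  ext i
  fin_cases i <;> simp [D3, Matrix.mulVec, dotProduct, Fin.sum_univ_succ] <;> try ring1

def D4 {R : Type} [CommRing R] (k a b c d : R) : Matrix (Fin 9) (Fin 1) R :=
  !![d^2 - k*a*d;
    -c*d + k*a*c;
    b*d - k*a*b;
    c^2;
    -a*d + b*c + k*a^2;
    b^2;
    -a*c;
    -a*b;
    -a^2]

theorem D4_mv (z : Fin 1 → R) : D4 k a b c d *ᵥ z =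
  ![d^2*z 0 - k*a*d*z 0,
    -c*d*z 0 + k*a*c*z 0,
    b*d*z 0 - k*a*b*z 0,
    c^2*z 0,
    -a*d*z 0 + b*c*z 0 + k*a^2*z 0,
    b^2*z 0,
    -a*c*z 0,
    -a*b*z 0,
    -a^2*z 0] := by
  ext i
  fin_cases i <;> simp [D4, Matrix.mulVec, dotProduct, Fin.sum_univ_succ] <;> try ring1

def T1 {R : Type} [CommRing R] (k a b c d : R) : Matrix (Fin 9) (Fin 1) R :=
  !![1;
    0;
    0;
    0;
    0;
    0;
    0;
    0;
    0]

theorem T1_mv (z : Fin 1 → R) : T1 k a b c d *ᵥ z =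
  ![z 0,
    0,
    0,
    0,
    0,
    0,
    0,
    0,
    0] := by
  ext i
  fin_cases i <;> simp [T1, Matrix.mulVec, dotProduct, Fin.sum_univ_succ] <;> try ring1

def T2 {R : Type} [CommRing R] (k a b c d : R) : Matrix (Fin 16) (Fin 9) R :=
  !![b, 0, 0, 0, 0, 0, 0, 0, 0;
    0, 0, 0, 0, 0, 0, 0, 0, 0;
    -a, 0, -b, -c, 0, 0, 0, k*d, -d;
    0, 0, 0, 0, 0, 0, 0, 0, 0;
    0, 0, 0, -b, 0, 0, -d, 0, 0;
    0, 0, 0, 0, 0, 0, 0, 0, 0;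
    0, 0, 0, 0, 0, 0, -c, 0, b;
    0, 0, 0, 0, 0, 0, c, k*b, -b;
    0, 0, 0, 0, 0, 0, -b, 0, 0;
    0, 0, 0, 0, 0, 0, 0, 0, 0;
    0, 0, 0, 0, -b, -c, 0, -d, 0;
    0, 0, 0, 0, 0, -b, 0, 0, 0;
    0, 0, 0, 0, 0, b, 0, 0, 0;
    0, 0, 0, 0, 0, 0, 0, 0, 0;
    0, 0, 0, 0, 0, 0, 0, -b, 0;
    0, 0, 0, 0, 0, 0, 0, 0, 0]

theorem T2_mv (z : Fin 9 → R) : T2 k a b c d *ᵥ z =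
  ![b*z 0,
    0,
    -a*z 0 - b*z 2 - c*z 3 + k*d*z 7 - d*z 8,
    0,
    -b*z 3 - d*z 6,
    0,
    -c*z 6 + b*z 8,
    c*z 6 + k*b*z 7 - b*z 8,
    -b*z 6,
    0,
    -b*z 4 - c*z 5 - d*z 7,
    -b*z 5,
    b*z 5,
    0,
    -b*z 7,
    0] := by
  ext i
  fin_cases i <;> simp [T2, Matrix.mulVec, dotProduct, Fin.sum_univ_succ] <;> try ring1

def T3 {R : Type} [CommRing R] (k a b c d : R) : Matrix (Fin 9) (Fin 16) R :=
  !![c, 0, -d, 0, 0, 0, 0, 0, 0, 0, -k*d, 0, 0, 0, 0, 0;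
    0, 0, c, 0, 0, 0, 0, 0, 0, 0, k*c, 0, 0, 0, 0, 0;
    0, 0, -b, -c, 0, 0, 0, 0, 0, 0, -k*b, 0, 0, 0, 0, 0;
    0, 0, 0, 0, 0, 0, 0, 0, 0, 0, 0, 0, 0, 0, 0, 0;
    0, 0, 0, 0, 0, 0, -c, -c, 0, 0, -d + k*a, 0, 0, 0, 0, 0;
    0, 0, 0, 0, 0, 0, -b, -b, 0, c, 0, -d, -d, 0, -k*b, 0;
    0, 0, 0, 0, 0, 0, 0, 0, 0, 0, -c, 0, 0, 0, 0, 0;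
    0, 0, 0, 0, 0, 0, 0, 0, 0, 0, -b, c, c, 0, 0, 0;
    0, 0, 0, 0, 0, 0, 0, 0, 0, 0, -a, 0, 0, 0, -c, 0]

theorem T3_mv (z : Fin 16 → R) : T3 k a b c d *ᵥ z =
  ![c*z 0 - d*z 2 - k*d*z 10,
    c*z 2 + k*c*z 10,
    -b*z 2 - c*z 3 - k*b*z 10,
    0,
    -c*z 6 - c*z 7 - d*z 10 + k*a*z 10,
    -b*z 6 - b*z 7 + c*z 9 - d*z 11 - d*z 12 - k*b*z 14,
    -c*z 10,
    -b*z 10 + c*z 11 + c*z 12,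
    -a*z 10 - c*z 14] := by
  ext i
  fin_cases i <;> simp [T3, Matrix.mulVec, dotProduct, Fin.sum_univ_succ] <;> try ring1

theorem D1_comp (z : Fin 16 → R) : D1 k a b c d *ᵥ (D2 k a b c d *ᵥ z) = 0 := by
  rw [D2_mv, D1_mv]
  ext i
  fin_cases i <;> simp <;> try ring1

theorem D2_comp (z : Fin 9 → R) : D2 k a b c d *ᵥ (D3 k a b c d *ᵥ z) = 0 := by
  rw [D3_mv, D2_mv]
  ext i
  fin_cases i <;> simp <;> try ring1

theorem D3_comp (z : Fin 1 → R) : D3 k a b c d *ᵥ (D4 k a b c d *ᵥ z) = 0 := by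
  rw [D4_mv, D3_mv]
  ext i
  fin_cases i <;> simp <;> try ring1

def s1 {R : Type} [CommRing R] (k a b c d : R) (z : Fin 9 → R) : Fin 16 → R := ![-b*z 1 - a*z 2,
    -a*z 3 - c*z 6 + b*z 8,
    a*z 1 + c*z 4,
    -b*z 4 - c*z 5 + k*a*z 7 - d*z 7 - a*z 8,
    b*z 4,
    -b*z 5 - a*z 6,
    -a*z 4,
    0,
    -b*z 7,
    a*z 5 + b*z 7,
    0,
    0,
    -a*z 7,
    0,
    0,
    0]

theorem htpy1 (z : Fin 9 → R) : (a^2) • z = D2 k a b c d *ᵥ (s1 k a b c d z) + T1 k a b c d *ᵥ (D1 k a b c d *ᵥ z) := by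
  rw [D1_mv, T1_mv, D2_mv, s1]
  ext i
  fin_cases i <;> simp <;> try ring1

def s2 {R : Type} [CommRing R] (k a b c d : R) (z : Fin 16 → R) : Fin 9 → R := ![-b*z 1 - d*z 5 - k*d*z 13,
    -b*z 3 + c*z 5 + k*c*z 13,
    -b*z 5 - k*b*z 13,
    b*z 6 + b*z 7 - c*z 9 + d*z 11 + d*z 12 + k*b*z 14,
    -b*z 9 + k*a*z 13 - d*z 13 - k*b*z 15,
    0,
    -b*z 11 - b*z 12 - c*z 13,
    -b*z 13,
    -a*z 13 + b*z 15]

theorem htpy2 (z : Fin 16 → R) : (b^2) • z = D3 k a b c d *ᵥ (s2 k a b c d z) + T2 k a b c d *ᵥ (D2 k a b c d *ᵥ z) := by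
  rw [D2_mv, T2_mv, D3_mv, s2]
  ext i
  fin_cases i <;> simp <;> try ring1

def s3 {R : Type} [CommRing R] (k a b c d : R) (z : Fin 9 → R) : Fin 1 → R := ![z 3]

theorem htpy3 (z : Fin 9 → R) : (c^2) • z = D4 k a b c d *ᵥ (s3 k a b c d z) + T3 k a b c d *ᵥ (D3 k a b c d *ᵥ z) := by
  rw [D3_mv, T3_mv, D4_mv, s3]
  ext i
  fin_cases i <;> simp <;> try ring1

end
end SixFour

namespace SixFour
open scoped Matrix
set_option linter.unusedSectionVars false

section
variable {R : Type} [CommRing R]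

theorem mulVec_memJ {m n : ℕ} (M : Matrix (Fin m) (Fin n) R) (J : Ideal R) {z : Fin n → R}
    (hz : ∀ i, z i ∈ J) (i : Fin m) : (M *ᵥ z) i ∈ J := by
  rw [Matrix.mulVec, dotProduct]
  exact Ideal.sum_mem _ fun j _ => J.mul_mem_left _ (hz j)

/-- exactness modulo `J` -/
def ExJ {p m n : ℕ} (A : Matrix (Fin p) (Fin m) R) (B : Matrix (Fin m) (Fin n) R) (J : Ideal R) : Prop :=
  ∀ z : Fin m → R, (∀ i, (A *ᵥ z) i ∈ J) → ∃ y : Fin n → R, ∀ i, (z - B *ᵥ y) i ∈ J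

theorem ExJ.step {p m n q : ℕ} {A : Matrix (Fin p) (Fin m) R} {B : Matrix (Fin m) (Fin n) R}
    {D : Matrix (Fin n) (Fin q) R} {J : Ideal R} {f : R} (hf : Rg f J)
    (s : (Fin m → R) → (Fin n → R)) (T : Matrix (Fin m) (Fin p) R)
    (hs : ∀ z, f • z = B *ᵥ (s z) + T *ᵥ (A *ᵥ z)) (hBD : ∀ z, B *ᵥ (D *ᵥ z) = 0)
    (h : ExJ B D (J ⊔ Ideal.span {f})) : ExJ A B J := by
  intro z hz
  have h1 : ∀ i, (f • z - B *ᵥ (s z)) i ∈ J := by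
    intro i
    rw [hs, add_sub_cancel_left]
    exact mulVec_memJ T J hz i
  obtain ⟨y, hy⟩ := h (s z) (fun i => by
    have e : (B *ᵥ (s z)) i = f * z i - (f • z - B *ᵥ (s z)) i := by simp
    rw [e]
    exact Ideal.sub_mem _ (Ideal.mem_sup_right (Ideal.mul_mem_right _ _ (Ideal.mem_span_singleton_self f)))
      (Ideal.mem_sup_left (h1 i)))
  have h2 : ∀ i, ∃ u, (s z - D *ᵥ y) i - f * u ∈ J := by
    intro i
    obtain ⟨j, hj, v, hv, e⟩ := Submodule.mem_sup.1 (hy i)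
    obtain ⟨u, rfl⟩ := Ideal.mem_span_singleton'.1 hv
    refine ⟨u, ?_⟩
    rw [← e, mul_comm f, add_sub_cancel_right]; exact hj
  choose u hu using h2
  refine ⟨u, fun i => hf _ ?_⟩
  have h3 := mulVec_memJ B J (z := s z - D *ᵥ y - f • u) (fun i => by simpa using hu i) i
  rw [Matrix.mulVec_sub, Matrix.mulVec_sub, hBD, sub_zero, Matrix.mulVec_smul] at h3
  have := J.add_mem (h1 i) h3
  convert this using 1
  simp
  ring

end

section
variable {K : Type} [Field K]

/-- `(x_i² : i ∈ T)` -/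
def Jm (K : Type) [Field K] (T : Set (Fin 4)) : Ideal (MvPolynomial (Fin 4) K) :=
  Ideal.span ((fun i => (X i : MvPolynomial (Fin 4) K) ^ 2) '' T)

theorem Jm_insert (T : Set (Fin 4)) (i : Fin 4) :
    Jm K T ⊔ Ideal.span {(X i : MvPolynomial (Fin 4) K) ^ 2} = Jm K (insert i T) := by
  rw [Jm, Jm, Set.image_insert_eq, Ideal.span_insert, sup_comm]

theorem Jm_reg (T : Set (Fin 4)) (j : Fin 4) (hj : j ∉ T) :
    Rg (X j : MvPolynomial (Fin 4) K) (Jm K T) := by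
  intro y hy
  have e : (fun i => (X i : MvPolynomial (Fin 4) K) ^ 2) '' T =
      (fun s => monomial s (1:K)) '' ((fun i => Finsupp.single i 2) '' T) := by
    rw [Set.image_image]
    refine Set.image_congr fun i _ => ?_
    rw [X_pow_eq_monomial]
  rw [Jm, e, mem_ideal_span_monomial_image] at hy ⊢
  intro m hm
  obtain ⟨s, ⟨i, hi, rfl⟩, hs⟩ := hy (m + Finsupp.single j 1) (by
    rw [mem_support_iff, mul_comm, coeff_mul_X]; exact mem_support_iff.1 hm)
  refine ⟨_, ⟨i, hi, rfl⟩, ?_⟩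
  have hij : j ≠ i := fun h => hj (h ▸ hi)
  rw [Finsupp.single_le_iff] at hs ⊢
  simpa [Finsupp.single_apply, hij] using hs

theorem Rg.mul {R : Type} [CommRing R] {a b : R} {J : Ideal R} (ha : Rg a J) (hb : Rg b J) : Rg (a * b) J :=
  fun y hy => hb _ (ha _ (by rwa [mul_assoc] at hy))

theorem Jm_reg2 (T : Set (Fin 4)) (j : Fin 4) (hj : j ∉ T) :
    Rg ((X j : MvPolynomial (Fin 4) K)^2) (Jm K T) := by
  rw [pow_two]; exact (Jm_reg T j hj).mul (Jm_reg T j hj)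

abbrev D1' (κ : K) := D1 (C κ) (X 0 : MvPolynomial (Fin 4) K) (X 1) (X 2) (X 3)
abbrev D2' (κ : K) := D2 (C κ) (X 0 : MvPolynomial (Fin 4) K) (X 1) (X 2) (X 3)
abbrev D3' (κ : K) := D3 (C κ) (X 0 : MvPolynomial (Fin 4) K) (X 1) (X 2) (X 3)
abbrev D4' (κ : K) := D4 (C κ) (X 0 : MvPolynomial (Fin 4) K) (X 1) (X 2) (X 3)
abbrev D5' (K : Type) [Field K] : Matrix (Fin 1) (Fin 0) (MvPolynomial (Fin 4) K) := 0

theorem ex4 (κ : K) (T : Set (Fin 4)) (h0 : 0 ∉ T) : ExJ (D4' κ) (D5' K) (Jm K T) := by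
  intro z hz
  refine ⟨0, fun i => ?_⟩
  have := hz 8
  rw [D4_mv] at this
  have h2 : X 0 ^ 2 * z 0 ∈ Jm K T := by
    have := (Jm K T).neg_mem this
    convert this using 1
    simp
  have := Jm_reg2 T 0 h0 _ h2
  rw [Subsingleton.elim i 0]
  simpa using this

theorem ex4' (κ : K) (T : Set (Fin 4)) (h0 : 0 ∈ T) (h3 : 3 ∉ T) : ExJ (D4' κ) (D5' K) (Jm K T) := by
  intro z hz
  refine ⟨0, fun i => ?_⟩
  have := hz 0
  rw [D4_mv] at this
  have h2 : X 3 * ((X 3 - C κ * X 0) * z 0) ∈ Jm K T := by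
    convert this using 1
    simp; ring
  have h4 := (Jm K T).mul_mem_left (X 3 + C κ * X 0) (Jm_reg T 3 h3 _ h2)
  have h5 : (X 0 : MvPolynomial (Fin 4) K) ^ 2 ∈ Jm K T := Ideal.subset_span ⟨0, h0, rfl⟩
  have h6 := (Jm K T).add_mem h4 ((Jm K T).mul_mem_left (C κ ^ 2 * z 0) h5)
  have h7 : X 3 ^ 2 * z 0 ∈ Jm K T := by
    convert h6 using 1; ring
  have := Jm_reg2 T 3 h3 _ h7
  rw [Subsingleton.elim i 0]
  simpa using this

theorem ex3 (κ : K) (T : Set (Fin 4)) (h2 : 2 ∉ T)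
    (h : ExJ (D4' κ) (D5' K) (Jm K (insert 2 T))) : ExJ (D3' κ) (D4' κ) (Jm K T) := by
  rw [← Jm_insert] at h
  exact ExJ.step (Jm_reg2 T 2 h2) _ _ (htpy3 _ _ _ _ _) (fun z => by simp) h

theorem ex2 (κ : K) (T : Set (Fin 4)) (h2 : 1 ∉ T)
    (h : ExJ (D3' κ) (D4' κ) (Jm K (insert 1 T))) : ExJ (D2' κ) (D3' κ) (Jm K T) := by
  rw [← Jm_insert] at h
  exact ExJ.step (Jm_reg2 T 1 h2) _ _ (htpy2 _ _ _ _ _) (D3_comp _ _ _ _ _) h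

theorem ex1 (κ : K) (T : Set (Fin 4)) (h2 : 0 ∉ T)
    (h : ExJ (D2' κ) (D3' κ) (Jm K (insert 0 T))) : ExJ (D1' κ) (D2' κ) (Jm K T) := by
  rw [← Jm_insert] at h
  exact ExJ.step (Jm_reg2 T 0 h2) _ _ (htpy1 _ _ _ _ _) (D2_comp _ _ _ _ _) h

theorem ExJ.bot {p m n : ℕ} {R : Type} [CommRing R] {A : Matrix (Fin p) (Fin m) R} {B : Matrix (Fin m) (Fin n) R}
    (h : ExJ A B ⊥) (z : Fin m → R) (hz : A *ᵥ z = 0) : ∃ y, z = B *ᵥ y := by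
  obtain ⟨y, hy⟩ := h z (fun i => by rw [hz]; exact Ideal.zero_mem _)
  refine ⟨y, ?_⟩
  ext i
  have := hy i
  rw [Ideal.mem_bot] at this
  exact sub_eq_zero.1 this

theorem Jm_empty : Jm K ∅ = ⊥ := by simp [Jm]

theorem exact1 (κ : K) (z) (hz : D1' κ *ᵥ z = 0) : ∃ y, z = D2' κ *ᵥ y := by
  refine ExJ.bot ?_ z hz
  rw [← Jm_empty]
  exact ex1 κ _ (by simp) (ex2 κ _ (by simp) (ex3 κ _ (by simp) (ex4' κ _ (by simp) (by simp))))

theorem exact2 (κ : K) (z) (hz : D2' κ *ᵥ z = 0) : ∃ y, z = D3' κ *ᵥ y := by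
  refine ExJ.bot ?_ z hz
  rw [← Jm_empty]
  exact (ex2 κ _ (by simp) (ex3 κ _ (by simp) (ex4 κ _ (by simp))))

theorem exact3 (κ : K) (z) (hz : D3' κ *ᵥ z = 0) : ∃ y, z = D4' κ *ᵥ y := by
  refine ExJ.bot ?_ z hz
  rw [← Jm_empty]
  exact ((ex3 κ _ (by simp) (ex4 κ _ (by simp))))

theorem exact4 (κ : K) (z) (hz : D4' κ *ᵥ z = 0) : z = 0 := by
  obtain ⟨y, rfl⟩ := ExJ.bot (B := D5' K) (by rw [← Jm_empty]; exact ex4 κ _ (by simp)) z hz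
  simp
end
end SixFour

namespace SixFour
open scoped Matrix
set_option linter.unusedSectionVars false

section
variable {K : Type} [Field K]

theorem lin_expand {σ : Type} [Fintype σ] [DecidableEq σ] {p : MvPolynomial σ K} (hp : p.IsHomogeneous 1) :
    p = ∑ i, C (coeff (Finsupp.single i 1) p) * X i := by
  ext s
  rw [coeff_sum]
  simp only [coeff_C_mul, coeff_X]
  by_cases hs : s.degree = 1
  · obtain ⟨i, rfl⟩ : s ∈ Set.range (fun a : σ => Finsupp.single a 1) := by
      rw [Finsupp.range_single_one]; exact hs
    rw [Finset.sum_eq_single i]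
    · simp
    · intro j _ hj
      rw [if_neg, mul_zero]
      intro h
      exact hj ((Finsupp.single_left_inj one_ne_zero).1 h)
    · simp
  · rw [hp.coeff_eq_zero hs, Finset.sum_eq_zero]
    intro i _
    rw [if_neg, mul_zero]
    rintro rfl
    exact hs (by simp)

theorem lin_equiv {r : ℕ} {τ : Type} [Fintype τ] [DecidableEq τ] (e : τ ≃ Fin (r+1)) (y : τ → PS K r)
    (hy : ∀ t, (y t).IsHomogeneous 1)
    (B : Fin (r+1) → τ → K) (hB : ∀ j, (X j : PS K r) = ∑ t, C (B j t) * y t) :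
    ∃ Φ : MvPolynomial τ K ≃ₐ[K] PS K r, (∀ t, Φ (X t) = y t) ∧
      ∀ j, Φ.symm (X j) = ∑ t, C (B j t) * X t := by
  let A : Matrix τ (Fin (r+1)) K := Matrix.of fun t j => coeff (Finsupp.single j 1) (y t)
  have hBA : Matrix.of B * A = 1 := by
    ext j j'
    have := congrArg (coeff (Finsupp.single j' 1)) (hB j)
    rw [coeff_sum] at this
    simp only [coeff_C_mul, coeff_X] at this
    rw [Matrix.mul_apply]
    refine Eq.trans this.symm ?_
    rw [Matrix.one_apply]
    congr 1
    rw [Finsupp.single_left_inj one_ne_zero]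
  have hAB : A * Matrix.of B = 1 := by
    rwa [Matrix.mul_eq_one_comm_of_equiv e.symm] at hBA
  refine ⟨AlgEquiv.ofAlgHom (aeval y) (aeval fun j => ∑ t, C (B j t) * X t) ?_ ?_, ?_, ?_⟩
  · ext j
    simp only [AlgHom.comp_apply, aeval_X, AlgHom.id_apply, map_sum, map_mul, aeval_C]
    congr 1
    exact (hB j).symm
  · ext t : 1
    simp only [AlgHom.comp_apply, aeval_X, AlgHom.id_apply]
    rw [lin_expand (hy t)]
    simp only [map_sum, map_mul, aeval_C, aeval_X]
    simp only [Finset.mul_sum]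
    rw [Finset.sum_comm]
    have : ∀ t', ∑ j, algebraMap K (MvPolynomial τ K) (coeff (Finsupp.single j 1) (y t)) * (C (B j t') * X t') =
        C ((1 : Matrix τ τ K) t t') * X t' := by
      intro t'
      rw [← hAB, Matrix.mul_apply, map_sum, Finset.sum_mul]
      refine Finset.sum_congr rfl fun j _ => ?_
      rw [map_mul, mul_assoc]; rfl
    rw [Finset.sum_congr rfl fun t' _ => this t', Finset.sum_eq_single t]
    · simp
    · intro t' _ h; rw [Matrix.one_apply_ne h.symm]; simp
    · simp
  · intro t; simp
  · intro j; simp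

theorem hc_alg {σ τ : Type} (π : MvPolynomial σ K →ₐ[K] MvPolynomial τ K)
    (hπ : ∀ i, (π (X i)).IsHomogeneous 1) (m : ℕ) (p : MvPolynomial σ K) :
    homogeneousComponent m (π p) = π (homogeneousComponent m p) := by
  classical
  have hh : ∀ i, (π (homogeneousComponent i p)).IsHomogeneous i := by
    intro i
    have := (homogeneousComponent_isHomogeneous i p).aeval (fun j => π (X j)) (n := 1) hπ
    have e : (aeval fun j => π (X j)) = π := (aeval_unique π).symm
    rw [e, one_mul] at this
    exact this
  conv_lhs => rw [← sum_homogeneousComponent p, map_sum, map_sum]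
  simp only [homogeneousComponent_of_mem (hh _)]
  rw [Finset.sum_ite_eq]
  split_ifs with h
  · rfl
  · rw [homogeneousComponent_eq_zero, map_zero]
    simp at h; omega

/-- projection onto the polynomial ring in the `x_i` -/
structure Pr {r n : ℕ} (l : Fin n → PS K r) (x : Fin 4 → PS K r)
    (π : PS K r →ₐ[K] MvPolynomial (Fin 4) K) : Prop where
  hx : ∀ i, (x i).IsHomogeneous 1
  hl : ∀ i, (l i).IsHomogeneous 1
  px : ∀ i, π (x i) = X i
  pl : ∀ j, π (l j) = 0
  hc : ∀ m p, homogeneousComponent m (π p) = π (homogeneousComponent m p)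
  ker : ∀ p, p - aeval x (π p) ∈ Ideal.span (Set.range l)
  reg : ∀ k, Rg (l k) (Ideal.span (l '' {j | j < k}))

theorem X_reg {σ : Type} (T : Set σ) (s : σ) (hs : s ∉ T) :
    Rg (X s : MvPolynomial σ K) (Ideal.span (X '' T)) := by
  classical
  intro y hy
  rw [mem_ideal_span_X_image] at hy ⊢
  intro m hm
  obtain ⟨i, hi, h⟩ := hy (m + Finsupp.single s 1) (by
    rw [mem_support_iff, mul_comm, coeff_mul_X]; exact mem_support_iff.1 hm)
  refine ⟨i, hi, ?_⟩
  have hij : s ≠ i := fun h => hs (h ▸ hi)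
  simpa [Finsupp.single_apply, hij] using h

theorem exists_Phi {r n : ℕ} {I : Ideal (PS K r)} {l : Fin n → PS K r} {x : Fin 4 → PS K r}
    {w : PS K r} (hI : HomI I) (hnd : AMD.Nondeg K r I) (hn : 4 + n = r + 1) (h : Setup I l x w) :
    ∃ Φ : MvPolynomial (Fin 4 ⊕ Fin n) K ≃ₐ[K] PS K r, (∀ i, Φ (X (Sum.inl i)) = x i) ∧
      (∀ j, Φ (X (Sum.inr j)) = l j) ∧ ∀ j, (Φ.symm (X j)).IsHomogeneous 1 := by
  have key : ∀ j, ∃ B : Fin 4 ⊕ Fin n → K, (X j : PS K r) = ∑ t, C (B t) * Sum.elim x l t := by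
    intro j
    obtain ⟨c, hc⟩ := h.span1 (X j) (isHomogeneous_X _ _)
    have h1 : (X j - ∑ i, C (c i) * x i).IsHomogeneous 1 :=
      (isHomogeneous_X _ _).sub (lin_hom h c)
    obtain ⟨f, hf, hm⟩ := mem_L_succ hI h.hl h1 hc
    refine ⟨Sum.elim c (fun j => coeff 0 (f j)), ?_⟩
    have hf' : ∀ j, f j = C (coeff 0 (f j)) := by
      intro j
      have := homogeneousComponent_eq_self (hf j)
      rw [homogeneousComponent_zero] at this
      exact this.symm
    have := hnd _ hm (h1.sub (IsHomogeneous.sum _ _ _ fun j _ => by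
      have := (h.hl j).mul (hf j); exact this))
    rw [Fintype.sum_sum_type]
    simp only [Sum.elim_inl, Sum.elim_inr]
    rw [sub_sub, sub_eq_zero] at this
    rw [this]
    congr 1
    refine Finset.sum_congr rfl fun j _ => ?_
    rw [← hf' j, mul_comm]
  choose B hB using key
  obtain ⟨Φ, h1, h2⟩ := lin_equiv (finSumFinEquiv.trans (finCongr hn)) (Sum.elim x l)
    (by rintro (i | i); exacts [h.hx i, h.hl i]) B hB
  refine ⟨Φ, fun i => h1 _, fun j => h1 _, fun j => ?_⟩
  rw [h2]
  exact IsHomogeneous.sum _ _ _ fun t _ => (isHomogeneous_X _ _).C_mul _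

theorem exists_Pr {r n : ℕ} {l : Fin n → PS K r} {x : Fin 4 → PS K r}
    (hx : ∀ i, (x i).IsHomogeneous 1) (hl : ∀ i, (l i).IsHomogeneous 1)
    (Φ : MvPolynomial (Fin 4 ⊕ Fin n) K ≃ₐ[K] PS K r) (h1 : ∀ i, Φ (X (Sum.inl i)) = x i)
    (h2 : ∀ j, Φ (X (Sum.inr j)) = l j) (h3 : ∀ j, (Φ.symm (X j)).IsHomogeneous 1) :
    ∃ π, Pr l x π := by
  have s1 : ∀ i, Φ.symm (x i) = X (Sum.inl i) := fun i => by rw [← h1, Φ.symm_apply_apply]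
  have s2 : ∀ i, Φ.symm (l i) = X (Sum.inr i) := fun i => by rw [← h2, Φ.symm_apply_apply]
  let π0 : MvPolynomial (Fin 4 ⊕ Fin n) K →ₐ[K] MvPolynomial (Fin 4) K := aeval (Sum.elim X 0)
  refine ⟨π0.comp Φ.symm.toAlgHom, hx, hl, ?_, ?_, ?_, ?_, ?_⟩
  · intro i
    change π0 (Φ.symm (x i)) = _
    rw [s1]; simp [π0]
  · intro i
    change π0 (Φ.symm (l i)) = _
    rw [s2]; simp [π0]
  · apply hc_alg
    intro i
    change (π0 (Φ.symm (X i))).IsHomogeneous 1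
    have := (h3 i).aeval (Sum.elim X 0 : _ → MvPolynomial (Fin 4) K) (n := 1) (by
      rintro (i | i)
      · exact isHomogeneous_X _ _
      · exact isHomogeneous_zero _ _ _)
    rw [one_mul] at this
    exact this
  · intro p
    obtain ⟨p, rfl⟩ := Φ.surjective p
    change Φ p - aeval x (π0 (Φ.symm (Φ p))) ∈ _
    rw [Φ.symm_apply_apply]
    induction p using MvPolynomial.induction_on with
    | C a =>
      have : aeval x (π0 (C a)) = Φ (C a) := by
        rw [← algebraMap_eq, AlgHom.commutes, AlgHom.commutes, AlgEquiv.commutes]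
      rw [this, sub_self]; exact Ideal.zero_mem _
    | add p q hp hq =>
      have := Ideal.add_mem _ hp hq
      convert this using 1
      rw [map_add, map_add, map_add]; ring
    | mul_X p i hp =>
      rcases i with i | i
      · have := Ideal.mul_mem_right (x i) _ hp
        convert this using 1
        rw [map_mul, map_mul, map_mul, h1]
        have : aeval x (π0 (X (Sum.inl i))) = x i := by simp [π0]
        rw [this]; ring
      · rw [map_mul, map_mul, map_mul, h2]
        have : aeval x (π0 (X (Sum.inr i))) = 0 := by simp [π0]
        rw [this, mul_zero, sub_zero]
        exact Ideal.mul_mem_left _ _ (Ideal.subset_span ⟨i, rfl⟩)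
  · intro k y hy
    have a1 := Ideal.mem_map_of_mem Φ.symm hy
    have e : Φ.symm '' (l '' {j | j < k}) = X '' (Sum.inr '' {j : Fin n | j < k}) := by
      rw [Set.image_image, Set.image_image]
      exact Set.image_congr fun i _ => s2 i
    rw [Ideal.map_span, e, map_mul, s2] at a1
    have a2 := Ideal.mem_map_of_mem Φ (X_reg _ _ (by simp) _ a1)
    rw [Ideal.map_span, ← e, Set.image_image, Φ.apply_symm_apply] at a2
    simpa using a2
end
end SixFour

namespace SixFour
open scoped Matrix
set_option linter.unusedSectionVars false

section
variable {K : Type} [Field K] {r n : ℕ} {l : Fin n → PS K r} {x : Fin 4 → PS K r}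
  {π : PS K r →ₐ[K] MvPolynomial (Fin 4) K}

/-- the ideal `(l_j : j < k)` -/
def aId (l : Fin n → PS K r) (k : ℕ) : Ideal (PS K r) := Ideal.span (l '' {j | j.1 < k})

theorem aId_zero : aId l 0 = ⊥ := by simp [aId]

theorem aId_top : aId l n = Ideal.span (Set.range l) := by
  have : {j : Fin n | j.1 < n} = Set.univ := by ext j; simp
  rw [aId, this, Set.image_univ]

theorem aId_succ (k : Fin n) : aId l (k.1+1) = aId l k.1 ⊔ Ideal.span {l k} := by
  have : {j : Fin n | j.1 < k.1 + 1} = insert k {j : Fin n | j.1 < k.1} := by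
    ext j
    simp only [Set.mem_ofPred_eq, Set.mem_insert_iff, Fin.ext_iff]; omega
  rw [aId, this, Set.image_insert_eq, Ideal.span_insert, sup_comm]; rfl

theorem aId_fin (k : Fin n) : Ideal.span (l '' {j | j < k}) = aId l k.1 := rfl

theorem l_mem_aId {j : Fin n} {k : ℕ} (h : j.1 < k) : l j ∈ aId l k := Ideal.subset_span ⟨j, h, rfl⟩

/-- `l` is a regular sequence on `F/N` -/
def RegN (l : Fin n → PS K r) {p : ℕ} (N : Submodule (PS K r) (Fin p → PS K r)) : Prop :=
  ∀ (k : Fin n) (f : Fin p → PS K r), (∃ m ∈ N, ∀ i, l k * f i - m i ∈ aId l k.1) →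
    ∃ m ∈ N, ∀ i, f i - m i ∈ aId l k.1

/-- homogeneous submodule -/
def HomN {p : ℕ} (N : Submodule (PS K r) (Fin p → PS K r)) : Prop :=
  ∀ f ∈ N, ∀ m, (fun i => homogeneousComponent m (f i)) ∈ N

theorem claim1 {p : ℕ} {N : Submodule (PS K r) (Fin p → PS K r)} (hN : RegN l N) :
    ∀ k, k ≤ n → ∀ f ∈ N, (∀ i, f i ∈ aId l k) → ∃ g : Fin n → (Fin p → PS K r),
      (∀ j, g j ∈ N) ∧ (∀ j : Fin n, k ≤ j.1 → g j = 0) ∧ f = ∑ j, l j • g j := by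
  intro k
  induction k with
  | zero =>
    intro _ f _ h
    refine ⟨0, fun j => N.zero_mem, fun _ _ => rfl, ?_⟩
    ext i
    have := h i
    rw [aId_zero, Ideal.mem_bot] at this
    simp [this]
  | succ k ih =>
    intro hk f hf h
    set k' : Fin n := ⟨k, hk⟩ with hk'
    have h1 : ∀ i, ∃ u, f i - l k' * u ∈ aId l k := by
      intro i
      have := h i
      rw [aId_succ k'] at this
      exact mem_sup_span.1 this
    choose u hu using h1
    obtain ⟨m, hm, hmu⟩ := hN k' u ⟨f, hf, fun i => by
      have := (aId l k).neg_mem (hu i); convert this using 1; ring⟩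
    obtain ⟨g, hg, hg0, e⟩ := ih (by omega) (f - l k' • m) (N.sub_mem hf (N.smul_mem _ hm)) (by
      intro i
      have := Ideal.add_mem _ (hu i) (Ideal.mul_mem_left _ (l k') (hmu i))
      convert this using 1
      simp; ring)
    refine ⟨Function.update g k' m, ?_, ?_, ?_⟩
    · intro j
      by_cases hj : j = k'
      · subst hj; simpa using hm
      · rw [Function.update_of_ne hj]; exact hg j
    · intro j hj
      have : j ≠ k' := by rintro rfl; simp [hk'] at hj
      rw [Function.update_of_ne this]; exact hg0 j (by omega)
    · rw [← Finset.sum_erase_add _ _ (Finset.mem_univ k')] at e ⊢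
      rw [hg0 k' (by simp [hk']), smul_zero, add_zero] at e
      rw [Function.update_self]
      rw [← sub_eq_iff_eq_add, e]
      refine Finset.sum_congr rfl fun j hj => ?_
      rw [Function.update_of_ne (Finset.ne_of_mem_erase hj)]

theorem Pr.zero_mem (hπ : Pr l x π) {p : PS K r} (h : π p = 0) : p ∈ aId l n := by
  have := hπ.ker p
  rw [h, map_zero, sub_zero] at this
  rwa [aId_top]

theorem Pr.aId_zero (hπ : Pr l x π) {p : PS K r} (h : p ∈ aId l n) : π p = 0 := by
  rw [aId_top] at h
  have : Ideal.span (Set.range l) ≤ RingHom.ker π := by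
    rw [Ideal.span_le]
    rintro _ ⟨j, rfl⟩
    exact hπ.pl j
  exact this h

theorem Pr.pi_aeval (hπ : Pr l x π) (y : MvPolynomial (Fin 4) K) : π (aeval x y) = y := by
  have : π.comp (aeval x) = AlgHom.id K _ := by
    ext i; simp [hπ.px]
  exact DFunLike.congr_fun this y

theorem map_mulVec' {p q : ℕ} {G : Matrix (Fin p) (Fin q) (PS K r)}
    {D : Matrix (Fin p) (Fin q) (MvPolynomial (Fin 4) K)} (hGD : ∀ i j, π (G i j) = D i j)
    (y : Fin q → PS K r) (i : Fin p) : π ((G *ᵥ y) i) = (D *ᵥ fun j => π (y j)) i := by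
  simp only [Matrix.mulVec, dotProduct, map_sum, map_mul, hGD]

theorem hc_mulVec {p q : ℕ} {G : Matrix (Fin p) (Fin q) (PS K r)} {e : ℕ}
    (hG : ∀ i j, (G i j).IsHomogeneous e) (y : Fin q → PS K r) (m : ℕ) :
    ∃ y' : Fin q → PS K r, ∀ i, homogeneousComponent m ((G *ᵥ y) i) = (G *ᵥ y') i := by
  by_cases h : e ≤ m
  · obtain ⟨m, rfl⟩ := Nat.exists_eq_add_of_le' h
    refine ⟨fun j => homogeneousComponent m (y j), fun i => ?_⟩
    simp only [Matrix.mulVec, dotProduct, map_sum]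
    exact Finset.sum_congr rfl fun j _ => hc_mul (hG i j) _ _
  · refine ⟨0, fun i => ?_⟩
    rw [Matrix.mulVec_zero]
    simp only [Matrix.mulVec, dotProduct, map_sum]
    exact Finset.sum_eq_zero fun j _ => hc_mul_lt (hG i j) _ _ (by omega)

theorem claim2 (hπ : Pr l x π) {p q : ℕ} {N : Submodule (PS K r) (Fin p → PS K r)} (hN : RegN l N)
    (hH : HomN N) {G : Matrix (Fin p) (Fin q) (PS K r)} {e : ℕ} (hG : ∀ i j, (G i j).IsHomogeneous e)
    (hGN : ∀ y, G *ᵥ y ∈ N)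
    {D : Matrix (Fin p) (Fin q) (MvPolynomial (Fin 4) K)} (hGD : ∀ i j, π (G i j) = D i j)
    (hD : ∀ f ∈ N, ∃ y, ∀ i, π (f i) = (D *ᵥ y) i) (f : Fin p → PS K r) (hf : f ∈ N) :
    ∃ y, f = G *ᵥ y := by
  have key : ∀ m, ∀ f ∈ N, ∃ y, ∀ i, homogeneousComponent m (f i) = (G *ᵥ y) i := by
    intro m
    induction m with
    | zero =>
      intro f hf
      obtain ⟨y, hy⟩ := hD f hf
      obtain ⟨g, hg, -, e1⟩ := claim1 hN n le_rfl (f - G *ᵥ (fun j => aeval x (y j)))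
        (N.sub_mem hf (hGN _)) (fun i => hπ.zero_mem (by
          rw [Pi.sub_apply, map_sub, hy, map_mulVec' hGD]
          simp only [hπ.pi_aeval, sub_self]))
      obtain ⟨y1, hy1⟩ := hc_mulVec hG (fun j => aeval x (y j)) 0
      refine ⟨y1, fun i => ?_⟩
      rw [← hy1, ← sub_eq_zero, ← map_sub]
      have e2 := congrFun e1 i
      rw [Pi.sub_apply] at e2
      rw [e2, Finset.sum_apply, map_sum]
      exact Finset.sum_eq_zero fun j _ => hc_mul_lt (hπ.hl j) _ _ (by omega)
    | succ m ih =>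
      intro f hf
      obtain ⟨y, hy⟩ := hD f hf
      obtain ⟨g, hg, -, e1⟩ := claim1 hN n le_rfl (f - G *ᵥ (fun j => aeval x (y j)))
        (N.sub_mem hf (hGN _)) (fun i => hπ.zero_mem (by
          rw [Pi.sub_apply, map_sub, hy, map_mulVec' hGD]
          simp only [hπ.pi_aeval, sub_self]))
      obtain ⟨y1, hy1⟩ := hc_mulVec hG (fun j => aeval x (y j)) (m+1)
      choose z hz using fun j => ih (g j) (hg j)
      refine ⟨y1 + ∑ j, l j • z j, fun i => ?_⟩
      have e2 := congrFun e1 i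
      rw [Pi.sub_apply, sub_eq_iff_eq_add] at e2
      rw [e2, map_add, hy1, Matrix.mulVec_add, Pi.add_apply, add_comm ((G *ᵥ y1) i)]
      congr 1
      rw [Finset.sum_apply, map_sum, Matrix.mulVec_sum, Finset.sum_apply]
      refine Finset.sum_congr rfl fun j _ => ?_
      rw [Matrix.mulVec_smul, Pi.smul_apply, Pi.smul_apply, ← hz j i]
      exact hc_mul (hπ.hl j) _ _
  choose y hy using fun m => key m f hf
  let M := ∑ i, (f i).totalDegree
  refine ⟨∑ m ∈ Finset.range (M + 1), y m, ?_⟩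
  ext1 i
  rw [Matrix.mulVec_sum, Finset.sum_apply]
  rw [← Finset.sum_congr rfl fun m _ => hy m i]
  have hle : (f i).totalDegree ≤ M :=
    Finset.single_le_sum (f := fun i => (f i).totalDegree) (fun _ _ => Nat.zero_le _) (Finset.mem_univ i)
  conv_lhs => rw [← sum_homogeneousComponent (f i)]
  refine Finset.sum_subset (Finset.range_subset_range.2 (by omega)) fun m _ hm => ?_
  rw [homogeneousComponent_eq_zero]
  simp at hm; omega

theorem claim3 (hπ : Pr l x π) {p q : ℕ} {N : Submodule (PS K r) (Fin p → PS K r)} (hN : RegN l N)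
    {G : Matrix (Fin p) (Fin q) (PS K r)} {e : ℕ} (hG : ∀ i j, (G i j).IsHomogeneous e)
    (hGN : ∀ y, G *ᵥ y ∈ N) (hr : ∀ f ∈ N, ∃ y, f = G *ᵥ y)
    {D : Matrix (Fin p) (Fin q) (MvPolynomial (Fin 4) K)} (hGD : ∀ i j, π (G i j) = D i j) :
    RegN l (LinearMap.ker G.mulVecLin) ∧ HomN (LinearMap.ker G.mulVecLin) ∧
    (∀ f ∈ LinearMap.ker G.mulVecLin, D *ᵥ (fun i => π (f i)) = 0) ∧
    (∀ y, D *ᵥ y = 0 → ∃ f ∈ LinearMap.ker G.mulVecLin, ∀ i, π (f i) = y i) := by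
  refine ⟨?_, ?_, ?_, ?_⟩
  · rintro k z ⟨m, hm, hz⟩
    rw [LinearMap.mem_ker, Matrix.mulVecLin_apply] at hm
    have h1 : ∀ i, (G *ᵥ z) i ∈ aId l k.1 := by
      intro i
      refine hπ.reg k _ ?_
      rw [aId_fin]
      have := mulVec_memJ G (aId l k.1) (z := l k • z - m) hz i
      rw [Matrix.mulVec_sub, hm, sub_zero, Matrix.mulVec_smul] at this
      exact this
    obtain ⟨g, hg, hg0, e1⟩ := claim1 hN k.1 k.2.le _ (hGN z) h1
    choose y hy using fun j => hr (g j) (hg j)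
    refine ⟨z - ∑ j, (if j.1 < k.1 then l j else 0) • y j, ?_, ?_⟩
    · rw [LinearMap.mem_ker, Matrix.mulVecLin_apply, Matrix.mulVec_sub, Matrix.mulVec_sum, e1, sub_eq_zero]
      refine Finset.sum_congr rfl fun j _ => ?_
      rw [Matrix.mulVec_smul, ← hy]
      split_ifs with h
      · rfl
      · rw [hg0 j (by omega), smul_zero, smul_zero]
    · intro i
      rw [Pi.sub_apply, sub_sub_cancel, Finset.sum_apply]
      refine Ideal.sum_mem _ fun j _ => ?_
      split_ifs with h
      · exact Ideal.mul_mem_right _ _ (l_mem_aId h)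
      · simp
  · intro f hf m
    rw [LinearMap.mem_ker, Matrix.mulVecLin_apply] at hf ⊢
    ext1 i
    have := congrArg (homogeneousComponent (m + e)) (congrFun hf i)
    rw [Pi.zero_apply, map_zero] at this
    rw [Pi.zero_apply, ← this]
    simp only [Matrix.mulVec, dotProduct, map_sum]
    exact Finset.sum_congr rfl fun j _ => (hc_mul (hG i j) _ _).symm
  · intro f hf
    rw [LinearMap.mem_ker, Matrix.mulVecLin_apply] at hf
    ext1 i
    rw [← map_mulVec' hGD, hf]; simp
  · intro y hy
    obtain ⟨g, hg, hg0, e1⟩ := claim1 hN n le_rfl _ (hGN (fun j => aeval x (y j))) (fun i =>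
      hπ.zero_mem (by
        rw [map_mulVec' hGD]
        simp only [hπ.pi_aeval, hy, Pi.zero_apply]))
    choose z hz using fun j => hr (g j) (hg j)
    refine ⟨(fun j => aeval x (y j)) - ∑ j, l j • z j, ?_, ?_⟩
    · rw [LinearMap.mem_ker, Matrix.mulVecLin_apply, Matrix.mulVec_sub, Matrix.mulVec_sum, e1, sub_eq_zero]
      refine Finset.sum_congr rfl fun j _ => ?_
      rw [Matrix.mulVec_smul, ← hz]
    · intro i
      rw [Pi.sub_apply, map_sub, hπ.pi_aeval, sub_eq_self, Finset.sum_apply, map_sum]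
      refine Finset.sum_eq_zero fun j _ => ?_
      rw [Pi.smul_apply, smul_eq_mul, map_mul, hπ.pl, zero_mul]

theorem exists_lift (hπ : Pr l x π) {p q : ℕ} {N : Submodule (PS K r) (Fin p → PS K r)}
    (hH : HomN N) {e : ℕ} {D : Matrix (Fin p) (Fin q) (MvPolynomial (Fin 4) K)}
    (hD : ∀ i j, (D i j).IsHomogeneous e)
    (h : ∀ j, ∃ f ∈ N, ∀ i, π (f i) = D i j) :
    ∃ G : Matrix (Fin p) (Fin q) (PS K r), (∀ i j, (G i j).IsHomogeneous e) ∧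
      (∀ y, G *ᵥ y ∈ N) ∧ ∀ i j, π (G i j) = D i j := by
  choose f hf hfD using h
  refine ⟨Matrix.of fun i j => homogeneousComponent e (f j i), fun i j => homogeneousComponent_isHomogeneous _ _, ?_, ?_⟩
  · intro y
    have : Matrix.of (fun i j => homogeneousComponent e (f j i)) *ᵥ y =
      ∑ j, y j • (fun i => homogeneousComponent e (f j i)) := by
      ext1 i
      simp [Matrix.mulVec, dotProduct, mul_comm]
    rw [this]
    exact N.sum_mem fun j _ => N.smul_mem _ (hH _ (hf j) _)
  · intro i j
    change π (homogeneousComponent e (f j i)) = _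
    rw [← hπ.hc, hfD, homogeneousComponent_eq_self (hD i j)]

/-- one step of lifting a resolution -/
theorem lift_step (hπ : Pr l x π) {p q s : ℕ} {N : Submodule (PS K r) (Fin p → PS K r)} (hN : RegN l N)
    {G : Matrix (Fin p) (Fin q) (PS K r)} {e : ℕ} (hG : ∀ i j, (G i j).IsHomogeneous e)
    (hGN : ∀ y, G *ᵥ y ∈ N) (hr : ∀ f ∈ N, ∃ y, f = G *ᵥ y)
    {D : Matrix (Fin p) (Fin q) (MvPolynomial (Fin 4) K)} (hGD : ∀ i j, π (G i j) = D i j)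
    {e' : ℕ} {D' : Matrix (Fin q) (Fin s) (MvPolynomial (Fin 4) K)}
    (hD' : ∀ i j, (D' i j).IsHomogeneous e') (hDD : ∀ y, D *ᵥ (D' *ᵥ y) = 0)
    (hex : ∀ z, D *ᵥ z = 0 → ∃ y, z = D' *ᵥ y) :
    ∃ G' : Matrix (Fin q) (Fin s) (PS K r), (∀ i j, (G' i j).IsHomogeneous e') ∧
      RegN l (LinearMap.ker G.mulVecLin) ∧
      (∀ y, G' *ᵥ y ∈ LinearMap.ker G.mulVecLin) ∧
      (∀ f ∈ LinearMap.ker G.mulVecLin, ∃ y, f = G' *ᵥ y) ∧ ∀ i j, π (G' i j) = D' i j := by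
  obtain ⟨h1, h2, h3, h4⟩ := claim3 hπ hN hG hGN hr hGD
  obtain ⟨G', a1, a2, a3⟩ := exists_lift hπ h2 hD' (fun j => by
    obtain ⟨f, hf, hf'⟩ := h4 (D' *ᵥ Pi.single j 1) (hDD _)
    refine ⟨f, hf, fun i => ?_⟩
    rw [hf', Matrix.mulVec_single_one]; rfl)
  refine ⟨G', a1, h1, a2, ?_, a3⟩
  exact claim2 hπ h1 h2 a1 a2 a3 (fun f hf => by
    obtain ⟨y, hy⟩ := hex _ (h3 f hf)
    exact ⟨y, fun i => congrFun hy i⟩)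

end
end SixFour

namespace SixFour
open scoped Matrix
set_option linter.unusedSectionVars false

section
variable {K : Type} [Field K] {r n : ℕ} {I : Ideal (PS K r)} {l : Fin n → PS K r}
variable {x : Fin 4 → PS K r} {w : PS K r}
variable {E : PS K r → MvPolynomial (Fin n) K} {κ : K}

/-- the linear part of the product `x_i x_j` -/
def bb (x : Fin 4 → PS K r) (w : PS K r) (E : PS K r → MvPolynomial (Fin n) K) (κ : K) (i j : Fin 4) :
    MvPolynomial (Fin n) K := E (x i * x j * w) - C (G0 κ i j) * E (w * w)

def tail (l : Fin n → PS K r) (x : Fin 4 → PS K r) (w : PS K r)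
    (E : PS K r → MvPolynomial (Fin n) K) (κ : K) (i j : Fin 4) : PS K r :=
  aeval l (E (x i * x j * x 0)) * (x 3 - C κ * x 0) + aeval l (E (x i * x j * x 1)) * x 2 +
    aeval l (E (x i * x j * x 2)) * x 1 + aeval l (E (x i * x j * x 3)) * x 0 + aeval l (bb x w E κ i j)

theorem Nice.mulE (hI : HomI I) (h : Nice I l x w E κ) (i j : Fin 4) :
    x i * x j - tail l x w E κ i j - C (G0 κ i j) * w ∈ I := by
  obtain ⟨c, hc⟩ := setup_exists hI h.st (x i * x j)
  have ec : comb l (bas x w) c = aeval l (c 0) + aeval l (c 1) * x 0 + aeval l (c 2) * x 1 +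
      aeval l (c 3) * x 2 + aeval l (c 4) * x 3 + aeval l (c 5) * w := by
    rw [comb, Fin.sum_univ_six]
    simp only [bas, Matrix.cons_val]
    ring
  rw [ec] at hc
  have ex : ∀ i, E (x i) = 0 := fun i => h.tr.hom1 _ (h.st.hx i)
  have gen : ∀ y, E (x i * x j * y) = c 0 * E y + c 1 * E (x 0 * y) + c 2 * E (x 1 * y) + c 3 * E (x 2 * y) +
      c 4 * E (x 3 * y) + c 5 * E (w * y) := by
    intro y
    have h1 := I.mul_mem_right y hc
    rw [sub_mul] at h1
    rw [h.tr.eq_of_sub_mem h1]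
    simp only [add_mul, h.tr.add, mul_assoc, h.tr.smul]
  have g5 := gen 1
  simp only [mul_one, ex, h.w1, h.tr.one, h.q, mul_zero, zero_add] at g5
  have g0 := gen (x 0)
  have g1 := gen (x 1)
  have g2 := gen (x 2)
  have g3 := gen (x 3)
  have gw := gen w
  have wx' : ∀ k, E (x k * w) = 0 := fun k => by rw [mul_comm]; exact h.wx k
  simp only [h.q, h.wx, ex, mul_zero, zero_add, add_zero] at g0 g1 g2 g3
  simp only [wx', h.w1, mul_zero, add_zero, mul_one] at gw
  simp [G0] at g0 g1 g2 g3
  have hb : bb x w E κ i j = c 0 := by rw [bb, gw, g5]; ring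
  convert hc using 1
  rw [tail, hb, g0, g1, g2, g3, ← g5]
  simp only [map_add, map_mul, aeval_C, algebraMap_eq]
  ring

def Pp (l : Fin n → PS K r) (x : Fin 4 → PS K r) (w : PS K r)
    (E : PS K r → MvPolynomial (Fin n) K) (κ : K) (i j : Fin 4) : PS K r :=
  x i * x j - tail l x w E κ i j

theorem Nice.cf_hom (h : Nice I l x w E κ) (i j k : Fin 4) : (E (x i * x j * x k)).IsHomogeneous 1 :=
  h.tr.hom _ 1 (((h.st.hx i).mul (h.st.hx j)).mul (h.st.hx k))

theorem Nice.bb_hom (h : Nice I l x w E κ) (i j : Fin 4) : (bb x w E κ i j).IsHomogeneous 2 :=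
  (h.tr.hom _ 2 (((h.st.hx i).mul (h.st.hx j)).mul h.st.hw)).sub
    ((h.tr.hom _ 2 (h.st.hw.mul h.st.hw)).C_mul _)

theorem Nice.tail_hom (h : Nice I l x w E κ) (i j : Fin 4) : (tail l x w E κ i j).IsHomogeneous 2 := by
  have a : ∀ k y, y.IsHomogeneous 1 → (aeval l (E (x i * x j * x k)) * y).IsHomogeneous 2 :=
    fun k y hy => (aeval_hom h.st.hl (h.cf_hom i j k)).mul hy
  refine ((((a _ _ ?_).add (a _ _ ?_)).add (a _ _ ?_)).add (a _ _ ?_)).add (aeval_hom h.st.hl (h.bb_hom i j))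
  · exact (h.st.hx 3).sub ((h.st.hx 0).C_mul _)
  all_goals exact h.st.hx _

theorem Nice.tail_mem (h : Nice I l x w E κ) (i j : Fin 4) :
    tail l x w E κ i j ∈ Ideal.span (Set.range l) := by
  have a : ∀ {m : ℕ} {t : MvPolynomial (Fin n) K}, t.IsHomogeneous (m+1) → aeval l t ∈ Ideal.span (Set.range l) := by
    intro m t ht
    have := aeval_mem_L (I := ⊥) h.st.hl ht
    rwa [bot_sup_eq] at this
  refine Ideal.add_mem _ (Ideal.add_mem _ (Ideal.add_mem _ (Ideal.add_mem _ ?_ ?_) ?_) ?_) (a (h.bb_hom i j))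
  all_goals exact Ideal.mul_mem_right _ _ (a (h.cf_hom i j _))

/-- the nine quadric generators -/
def Gq (l : Fin n → PS K r) (x : Fin 4 → PS K r) (w : PS K r)
    (E : PS K r → MvPolynomial (Fin n) K) (κ : K) : Fin 9 → PS K r :=
  ![Pp l x w E κ 0 0, Pp l x w E κ 1 1, Pp l x w E κ 0 1, Pp l x w E κ 0 2, Pp l x w E κ 1 3,
    Pp l x w E κ 2 3, Pp l x w E κ 2 2, Pp l x w E κ 3 3 - C κ * Pp l x w E κ 0 3,
    Pp l x w E κ 0 3 - Pp l x w E κ 1 2]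

def G1 (l : Fin n → PS K r) (x : Fin 4 → PS K r) (w : PS K r)
    (E : PS K r → MvPolynomial (Fin n) K) (κ : K) : Matrix (Fin 1) (Fin 9) (PS K r) :=
  Matrix.of fun _ j => Gq l x w E κ j

theorem Nice.Gq_mem (hI : HomI I) (h : Nice I l x w E κ) (j : Fin 9) : Gq l x w E κ j ∈ I := by
  have a := h.mulE hI
  have z : ∀ i j, G0 κ i j = 0 → Pp l x w E κ i j ∈ I := by
    intro i j hij
    have := a i j
    rwa [hij, C_0, zero_mul, sub_zero] at this
  fin_cases j
  · exact z 0 0 (by simp [G0])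
  · exact z 1 1 (by simp [G0])
  · exact z 0 1 (by simp [G0])
  · exact z 0 2 (by simp [G0])
  · exact z 1 3 (by simp [G0])
  · exact z 2 3 (by simp [G0])
  · exact z 2 2 (by simp [G0])
  · change Pp l x w E κ 3 3 - C κ * Pp l x w E κ 0 3 ∈ I
    have := I.sub_mem (a 3 3) (I.mul_mem_left (C κ) (a 0 3))
    convert this using 1
    simp [G0, Pp]; ring
  · change Pp l x w E κ 0 3 - Pp l x w E κ 1 2 ∈ I
    have := I.sub_mem (a 0 3) (a 1 2)
    convert this using 1
    simp [G0, Pp]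

theorem Nice.Gq_hom (h : Nice I l x w E κ) (j : Fin 9) : (Gq l x w E κ j).IsHomogeneous 2 := by
  have a : ∀ i j, (Pp l x w E κ i j).IsHomogeneous 2 := fun i j =>
    ((h.st.hx i).mul (h.st.hx j)).sub (h.tail_hom i j)
  fin_cases j
  · exact a _ _
  · exact a _ _
  · exact a _ _
  · exact a _ _
  · exact a _ _
  · exact a _ _
  · exact a _ _
  · exact (a _ _).sub ((a _ _).C_mul _)
  · exact (a _ _).sub (a _ _)

variable {π : PS K r →ₐ[K] MvPolynomial (Fin 4) K}

theorem Nice.pi_Pp (h : Nice I l x w E κ) (hπ : Pr l x π) (i j : Fin 4) : π (Pp l x w E κ i j) = X i * X j := by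
  have : π (tail l x w E κ i j) = 0 := hπ.aId_zero (by rw [aId_top]; exact h.tail_mem i j)
  rw [Pp, map_sub, this, map_mul, hπ.px, hπ.px, sub_zero]

theorem Nice.pi_G1 (h : Nice I l x w E κ) (hπ : Pr l x π) (i : Fin 1) (j : Fin 9) :
    π (G1 l x w E κ i j) = D1' κ i j := by
  have hC : π (C κ) = C κ := by rw [← algebraMap_eq, ← algebraMap_eq, AlgHom.commutes]
  have p := h.pi_Pp hπ
  rw [Subsingleton.elim i 0]
  change π (Gq l x w E κ j) = _
  fin_cases j
  · exact (p _ _).trans (by simp [D1]; ring)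
  · exact (p _ _).trans (by simp [D1]; ring)
  · exact (p _ _).trans (by simp [D1])
  · exact (p _ _).trans (by simp [D1])
  · exact (p _ _).trans (by simp [D1])
  · exact (p _ _).trans (by simp [D1])
  · exact (p _ _).trans (by simp [D1]; ring)
  · change π (Pp l x w E κ 3 3 - C κ * Pp l x w E κ 0 3) = _
    rw [map_sub, map_mul, p, p, hC]; simp [D1]; ring
  · change π (Pp l x w E κ 0 3 - Pp l x w E κ 1 2) = _
    rw [map_sub, p, p]; simp [D1]

def J9 (κ : K) : Ideal (MvPolynomial (Fin 4) K) := Ideal.span (Set.range fun j => D1' κ 0 j)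

theorem J9_mem (κ : K) (j : Fin 9) : D1' κ 0 j ∈ J9 κ := Ideal.subset_span ⟨j, rfl⟩

theorem J9_of (κ : K) (j : Fin 9) {p : MvPolynomial (Fin 4) K} (h : p = D1' κ 0 j) : p ∈ J9 κ := by
  rw [h]; exact J9_mem κ j

theorem G0_symm (κ : K) (i j : Fin 4) : G0 κ i j = G0 κ j i := by
  fin_cases i <;> fin_cases j <;> simp [G0]

theorem J9_xx (κ : K) (i j : Fin 4) : (X i * X j - C (G0 κ i j) * (X 0 * X 3) : MvPolynomial (Fin 4) K) ∈ J9 κ := by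
  wlog hij : i ≤ j generalizing i j
  · have := this j i (le_of_not_ge hij)
    rwa [G0_symm κ j i, mul_comm (X j) (X i)] at this
  have e00 := J9_of κ 0 (p := X 0 * X 0) (by simp [D1]; ring)
  have e11 := J9_of κ 1 (p := X 1 * X 1) (by simp [D1]; ring)
  have e01 := J9_of κ 2 (p := X 0 * X 1) (by simp [D1])
  have e02 := J9_of κ 3 (p := X 0 * X 2) (by simp [D1])
  have e13 := J9_of κ 4 (p := X 1 * X 3) (by simp [D1])
  have e23 := J9_of κ 5 (p := X 2 * X 3) (by simp [D1])
  have e22 := J9_of κ 6 (p := X 2 * X 2) (by simp [D1]; ring)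
  have e33 := J9_of κ 7 (p := X 3 * X 3 - C κ * (X 0 * X 3)) (by simp [D1]; ring)
  have e12 := J9_of κ 8 (p := X 0 * X 3 - X 1 * X 2) (by simp [D1])
  have e12' := (J9 κ).neg_mem e12
  rw [neg_sub] at e12'
  have z : ∀ p : MvPolynomial (Fin 4) K, p ∈ J9 κ → ∀ c : K, c = 0 → p - C c * (X 0 * X 3) ∈ J9 κ := by
    intro p hp c hc; rw [hc, C_0, zero_mul, sub_zero]; exact hp
  have u : ∀ p : MvPolynomial (Fin 4) K, p - X 0 * X 3 ∈ J9 κ → ∀ c : K, c = 1 → p - C c * (X 0 * X 3) ∈ J9 κ := by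
    intro p hp c hc; rw [hc, C_1, one_mul]; exact hp
  have g33 : G0 κ 3 3 = κ := by simp [G0]
  match i, j, hij with
  | 0, 0, _ => exact z _ e00 _ (by simp [G0])
  | 0, 1, _ => exact z _ e01 _ (by simp [G0])
  | 0, 2, _ => exact z _ e02 _ (by simp [G0])
  | 0, 3, _ => exact u _ (by rw [sub_self]; exact (J9 κ).zero_mem) _ (by simp [G0])
  | 1, 1, _ => exact z _ e11 _ (by simp [G0])
  | 1, 2, _ => exact u _ e12' _ (by simp [G0])
  | 1, 3, _ => exact z _ e13 _ (by simp [G0])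
  | 2, 2, _ => exact z _ e22 _ (by simp [G0])
  | 2, 3, _ => exact z _ e23 _ (by simp [G0])
  | 3, 3, _ => rw [g33]; exact e33

theorem J9_xxx (κ : K) (j : Fin 4) : (X j * (X 0 * X 3) : MvPolynomial (Fin 4) K) ∈ J9 κ := by
  have a := J9_xx κ
  have a0 := (J9 κ).mul_mem_left (X 3) (a j 0)
  by_cases hj : j = 3
  · subst hj
    have a1 := (J9 κ).mul_mem_left (X 0) (a 3 3)
    have a2 := (J9 κ).mul_mem_left (C κ * X 3) (a 0 0)
    have := (J9 κ).add_mem a1 a2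
    convert this using 1
    simp [G0]; ring
  · convert a0 using 1
    have : G0 κ j 0 = 0 := by fin_cases j <;> simp [G0] at hj ⊢
    rw [this]; simp; ring

theorem J9_red (κ : K) (p : MvPolynomial (Fin 4) K) : ∃ (c : K) (c' : Fin 4 → K) (e : K),
    p - (C c + ∑ i, C (c' i) * X i + C e * (X 0 * X 3)) ∈ J9 κ := by
  induction p using MvPolynomial.induction_on with
  | C a => exact ⟨a, 0, 0, by simp⟩
  | add p q hp hq =>
    obtain ⟨c, c', e, h⟩ := hp
    obtain ⟨d, d', f, h'⟩ := hq
    refine ⟨c + d, c' + d', e + f, ?_⟩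
    have := (J9 κ).add_mem h h'
    convert this using 1
    simp only [map_add, Pi.add_apply, add_mul, Finset.sum_add_distrib]; ring
  | mul_X p j hp =>
    obtain ⟨c, c', e, h⟩ := hp
    refine ⟨0, Pi.single j c, ∑ i, c' i * G0 κ i j, ?_⟩
    have h1 := (J9 κ).mul_mem_right (X j) h
    have h2 := (J9 κ).mul_mem_left (C e) (J9_xxx κ j)
    have h3 := Ideal.sum_mem (J9 κ) (t := Finset.univ)
      (f := fun i => C (c' i) * (X i * X j - C (G0 κ i j) * (X 0 * X 3)))
      fun i _ => (J9 κ).mul_mem_left _ (J9_xx κ i j)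
    have := (J9 κ).add_mem ((J9 κ).add_mem h1 h2) h3
    convert this using 1
    have e0 : ∑ i, C ((Pi.single j c : Fin 4 → K) i) * (X i : MvPolynomial (Fin 4) K) = C c * X j := by
      rw [Finset.sum_eq_single j] <;> simp +contextual
    rw [e0]
    simp only [mul_sub, Finset.sum_sub_distrib, map_sum, map_mul, Finset.sum_mul, C_0, add_mul, sub_mul, mul_assoc]
    ring

theorem J9_iff (κ : K) (p : MvPolynomial (Fin 4) K) (h : p ∈ J9 κ) : ∃ y, p = (D1' κ *ᵥ y) 0 := by
  obtain ⟨y, hy⟩ := Ideal.mem_span_range_iff_exists_fun.1 h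
  refine ⟨y, ?_⟩
  rw [← hy, Matrix.mulVec, dotProduct]
  exact Finset.sum_congr rfl fun j _ => mul_comm _ _

def N0 (I : Ideal (PS K r)) : Submodule (PS K r) (Fin 1 → PS K r) :=
  Submodule.comap (LinearMap.proj 0) I

theorem mem_N0 {f : Fin 1 → PS K r} : f ∈ N0 I ↔ f 0 ∈ I := Iff.rfl

theorem Nice.regN0 (h : Nice I l x w E κ) : RegN l (N0 I) := by
  rintro k f ⟨m, hm, hf⟩
  have h1 : l k * f 0 ∈ I ⊔ Ideal.span (l '' {j | j < k}) := by
    have := Ideal.add_mem _ (Submodule.mem_sup_left (mem_N0.1 hm)) (Ideal.mem_sup_right (hf 0))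
    rwa [add_sub_cancel] at this
  obtain ⟨a, ha, b, hb, e⟩ := Submodule.mem_sup.1 (h.st.reg k _ h1)
  refine ⟨fun _ => a, ha, fun i => ?_⟩
  rw [Subsingleton.elim i 0, ← e, add_sub_cancel_left]
  exact hb

theorem homN0 (hI : HomI I) : HomN (N0 I) := fun _ hf m => hI _ hf m

theorem Nice.G1_mem (hI : HomI I) (h : Nice I l x w E κ) (y : Fin 9 → PS K r) : G1 l x w E κ *ᵥ y ∈ N0 I := by
  rw [mem_N0, Matrix.mulVec, dotProduct]
  exact Ideal.sum_mem _ fun j _ => Ideal.mul_mem_right _ _ (h.Gq_mem hI j)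

theorem Nice.pi_I1 (h : Nice I l x w E κ) (hπ : Pr l x π) (f q : PS K r) (y : Fin 9 → MvPolynomial (Fin 4) K)
    (hy : π f - π q = (D1' κ *ᵥ y) 0) :
    f - (G1 l x w E κ *ᵥ fun j => aeval x (y j)) 0 - q ∈ Ideal.span (Set.range l) := by
  rw [← aId_top]
  apply hπ.zero_mem
  rw [map_sub, map_sub, map_mulVec' (h.pi_G1 hπ)]
  simp only [hπ.pi_aeval]
  rw [← hy]; ring

theorem Nice.pi_I2 (hI : HomI I) (h : Nice I l x w E κ) (f z : PS K r) (hf : f ∈ I) (hz : z ∈ I)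
    (c : K) (c' : Fin 4 → K) (e : K)
    (h1 : f - z - (C c + ∑ i, C (c' i) * x i + C e * (x 0 * x 3)) ∈ Ideal.span (Set.range l)) :
    c = 0 ∧ (∀ i, c' i = 0) ∧ e = 0 := by
  have h2 := h.xx hI 0 3
  have e3 : G0 κ 0 3 = 1 := by simp [G0]
  rw [e3, C_1, one_mul] at h2
  have h3 : (f - z) - (f - z - (C c + ∑ i, C (c' i) * x i + C e * (x 0 * x 3))) ∈
      I ⊔ Ideal.span (Set.range l) :=
    Ideal.sub_mem _ (Submodule.mem_sup_left (I.sub_mem hf hz)) (Submodule.mem_sup_right h1)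
  rw [sub_sub_cancel] at h3
  have h4 := Ideal.sub_mem _ h3 (Ideal.mul_mem_left _ (C e) h2)
  have h5 : C c + ∑ i, C (c' i) * x i + C e * (x 0 * x 3) - C e * (x 0 * x 3 - w) =
    C c + ∑ i, C (c' i) * x i + C e * w := by ring
  rw [h5] at h4
  obtain ⟨i1, i2, i3⟩ := h.st.ind c c' e h4
  exact ⟨i1, fun i => congrFun i2 i, i3⟩

theorem Nice.pi_I (hI : HomI I) (h : Nice I l x w E κ) (hπ : Pr l x π) (f : PS K r) (hf : f ∈ I) :
    π f ∈ J9 κ := by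
  obtain ⟨c, c', e, hm⟩ := J9_red κ (π f)
  obtain ⟨y, hy⟩ := J9_iff κ _ hm
  have hC : ∀ t : K, π (C t) = C t := fun t => by rw [← algebraMap_eq, ← algebraMap_eq, AlgHom.commutes]
  have e1 : π (C c + ∑ i, C (c' i) * x i + C e * (x 0 * x 3)) =
      C c + ∑ i, C (c' i) * X i + C e * (X 0 * X 3) := by
    simp only [map_add, map_sum, map_mul, hC, hπ.px]
  rw [← e1] at hy
  have h3 := h.pi_I1 hπ f _ y hy
  have h4 := mem_N0.1 (h.G1_mem hI fun j => aeval x (y j))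
  obtain ⟨h0, h1, h2⟩ := h.pi_I2 hI f _ hf h4 c c' e h3
  rw [h0, h2] at hm
  simp only [h1, C_0, zero_mul, Finset.sum_const_zero, add_zero, sub_zero] at hm
  exact hm

theorem Nice.gen (hI : HomI I) (h : Nice I l x w E κ) (hπ : Pr l x π) (f : Fin 1 → PS K r) (hf : f ∈ N0 I) :
    ∃ y, f = G1 l x w E κ *ᵥ y := by
  refine claim2 hπ h.regN0 (homN0 hI) (fun i j => h.Gq_hom j) (h.G1_mem hI) (h.pi_G1 hπ) ?_ f hf
  intro f hf
  obtain ⟨y, hy⟩ := J9_iff κ _ (h.pi_I hI hπ _ (mem_N0.1 hf))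
  exact ⟨y, fun i => by rw [Subsingleton.elim i 0, hy]⟩

theorem Nice.span_Gq (hI : HomI I) (h : Nice I l x w E κ) (hπ : Pr l x π) :
    I = Ideal.span (Set.range (Gq l x w E κ)) := by
  apply le_antisymm
  · intro f hf
    obtain ⟨y, hy⟩ := h.gen hI hπ (fun _ => f) hf
    have := congrFun hy 0
    rw [this, Matrix.mulVec, dotProduct]
    exact Ideal.sum_mem _ fun j _ => Ideal.mul_mem_right _ _ (Ideal.subset_span ⟨j, rfl⟩)
  · rw [Ideal.span_le]
    rintro _ ⟨j, rfl⟩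
    exact h.Gq_mem hI j

end
end SixFour

namespace SixFour
open scoped Matrix
set_option linter.unusedSectionVars false

section
variable {K : Type} [Field K] {r n : ℕ} {I : Ideal (PS K r)} {l : Fin n → PS K r}
variable {x : Fin 4 → PS K r} {w : PS K r}
variable {E : PS K r → MvPolynomial (Fin n) K} {κ : K}
variable {π : PS K r →ₐ[K] MvPolynomial (Fin 4) K}

/-- index set of a graded free module concentrated in one row -/
def rowEquiv (β : ℕ → ℕ) (j0 q : ℕ) (h : β j0 = q) (h0 : ∀ j, j ≠ j0 → β j = 0) :
    ((j : ℕ) × Fin (β j)) ≃ Fin q :=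
  ((finCongr h.symm).trans (Equiv.ofBijective (fun t => (⟨j0, t⟩ : (j : ℕ) × Fin (β j))) (by
    constructor
    · intro a b hab
      simpa using hab
    · rintro ⟨j, t⟩
      by_cases hj : j = j0
      · subst hj; exact ⟨t, rfl⟩
      · have h1 := t.2
        have h2 := h0 j hj
        omega))).symm

def Th (K : Type) [Field K] (r : ℕ) {β : ℕ → ℕ} {q : ℕ} (e : ((j : ℕ) × Fin (β j)) ≃ Fin q) :
    AMD.FreeGr K r β ≃ₗ[PS K r] (Fin q → PS K r) :=
  (Finsupp.domLCongr e).trans (Finsupp.linearEquivFunOnFinite (PS K r) (PS K r) (Fin q))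

theorem Th_single {β : ℕ → ℕ} {q : ℕ} (e : ((j : ℕ) × Fin (β j)) ≃ Fin q) (s) :
    Th K r e (Finsupp.single s 1) = Pi.single (e s) 1 := by
  simp [Th]

theorem Th_symm {β : ℕ → ℕ} {q : ℕ} (e : ((j : ℕ) × Fin (β j)) ≃ Fin q) (v) (s) :
    (Th K r e).symm v s = v (e s) := by
  obtain ⟨u, rfl⟩ := (Th K r e).surjective v
  rw [LinearEquiv.symm_apply_apply]
  simp [Th]

/-- map of graded free modules given by a matrix -/
def Mt {β β' : ℕ → ℕ} {q q' : ℕ} (e : ((j : ℕ) × Fin (β j)) ≃ Fin q) (e' : ((j : ℕ) × Fin (β' j)) ≃ Fin q')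
    (G : Matrix (Fin q') (Fin q) (PS K r)) : AMD.FreeGr K r β →ₗ[PS K r] AMD.FreeGr K r β' :=
  (Th K r e').symm.toLinearMap ∘ₗ G.mulVecLin ∘ₗ (Th K r e).toLinearMap

theorem Mt_single {β β' : ℕ → ℕ} {q q' : ℕ} (e : ((j : ℕ) × Fin (β j)) ≃ Fin q)
    (e' : ((j : ℕ) × Fin (β' j)) ≃ Fin q') (G : Matrix (Fin q') (Fin q) (PS K r)) (s s') :
    Mt e e' G (Finsupp.single s 1) s' = G (e' s') (e s) := by
  simp only [Mt, LinearMap.comp_apply, LinearEquiv.coe_coe]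
  rw [Th_single, Th_symm, Matrix.mulVecLin_apply, Matrix.mulVec_single_one]; rfl

theorem Mt_min {β β' : ℕ → ℕ} {q q' j0 j0' : ℕ} (e : ((j : ℕ) × Fin (β j)) ≃ Fin q)
    (e' : ((j : ℕ) × Fin (β' j)) ≃ Fin q') (h0 : ∀ j, j ≠ j0 → β j = 0) (h0' : ∀ j, j ≠ j0' → β' j = 0)
    (G : Matrix (Fin q') (Fin q) (PS K r)) (m m' dd : ℕ) (h1 : 1 ≤ dd) (hd : dd + (m' + j0') = m + j0)
    (hG : ∀ i j, (G i j).IsHomogeneous dd) : AMD.IsMinGrMap K r β β' m m' (Mt e e' G) := by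
  intro j t j' t'
  have hj : j = j0 := by
    by_contra hj
    have h1 := t.2
    have h2 := h0 j hj
    omega
  have hj' : j' = j0' := by
    by_contra hj
    have h1 := t'.2
    have h2 := h0' j' hj
    omega
  right
  refine ⟨dd, h1, by rw [hj, hj']; exact hd, ?_⟩
  rw [Mt_single]
  exact hG _ _

theorem Mt_exact {β β' β'' : ℕ → ℕ} {q q' q'' : ℕ} (e : ((j : ℕ) × Fin (β j)) ≃ Fin q)
    (e' : ((j : ℕ) × Fin (β' j)) ≃ Fin q') (e'' : ((j : ℕ) × Fin (β'' j)) ≃ Fin q'')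
    (G : Matrix (Fin q') (Fin q) (PS K r)) (G' : Matrix (Fin q) (Fin q'') (PS K r))
    (h1 : ∀ y, G' *ᵥ y ∈ LinearMap.ker G.mulVecLin)
    (h2 : ∀ f ∈ LinearMap.ker G.mulVecLin, ∃ y, f = G' *ᵥ y) :
    LinearMap.ker (Mt e e' G) = LinearMap.range (Mt e'' e G') := by
  ext f
  rw [LinearMap.mem_ker, LinearMap.mem_range]
  simp only [Mt, LinearMap.comp_apply, LinearEquiv.coe_coe, LinearEquiv.map_eq_zero_iff]
  constructor
  · intro h
    obtain ⟨y, hy⟩ := h2 _ h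
    refine ⟨(Th K r e'').symm y, ?_⟩
    rw [LinearEquiv.apply_symm_apply, Matrix.mulVecLin_apply, ← hy, LinearEquiv.symm_apply_apply]
  · rintro ⟨y, rfl⟩
    rw [LinearEquiv.apply_symm_apply]
    exact h1 _

theorem D2_hom (κ : K) (i j) : (D2' κ i j).IsHomogeneous 1 := by
  have hX : ∀ i : Fin 4, (X i : MvPolynomial (Fin 4) K).IsHomogeneous 1 := isHomogeneous_X K
  have hN : ∀ i : Fin 4, (-X i : MvPolynomial (Fin 4) K).IsHomogeneous 1 := fun i => (hX i).neg
  fin_cases i <;> fin_cases j <;> simp [D2, hX, hN, isHomogeneous_zero, IsHomogeneous.sub, IsHomogeneous.add, IsHomogeneous.C_mul, IsHomogeneous.neg]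

theorem D3_hom (κ : K) (i j) : (D3' κ i j).IsHomogeneous 1 := by
  have hX : ∀ i : Fin 4, (X i : MvPolynomial (Fin 4) K).IsHomogeneous 1 := isHomogeneous_X K
  have hN : ∀ i : Fin 4, (-X i : MvPolynomial (Fin 4) K).IsHomogeneous 1 := fun i => (hX i).neg
  fin_cases i <;> fin_cases j <;> simp [D3, hX, hN, isHomogeneous_zero, IsHomogeneous.sub, IsHomogeneous.add, IsHomogeneous.C_mul, IsHomogeneous.neg]

theorem D4_hom (κ : K) (i j) : (D4' κ i j).IsHomogeneous 2 := by
  have hX : ∀ i : Fin 4, (X i : MvPolynomial (Fin 4) K).IsHomogeneous 1 := isHomogeneous_X K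
  have hX2 : ∀ i j : Fin 4, (X i * X j: MvPolynomial (Fin 4) K).IsHomogeneous 2 := fun i j => (hX i).mul (hX j)
  have hX3 : ∀ i : Fin 4, (X i ^2: MvPolynomial (Fin 4) K).IsHomogeneous 2 := fun i => (hX i).pow 2
  fin_cases i <;> fin_cases j <;> simp [D4, hX, hX2, hX3, isHomogeneous_zero, IsHomogeneous.sub, IsHomogeneous.add, IsHomogeneous.C_mul, IsHomogeneous.neg, mul_assoc]
  exact (((hX2 0 3).neg).add (hX2 1 2)).add ((hX3 0).C_mul _)

/-- the Betti diagram -/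
abbrev bd : ℕ → ℕ → ℕ := fun i j => match j, i with
  | 1, 1 => 9 | 1, 2 => 16 | 1, 3 => 9 | 2, 4 => 1 | _, _ => 0

theorem bd1 (j : ℕ) (h : j ≠ 1) : bd 1 j = 0 := by
  simp only [bd]; split <;> simp_all
theorem bd2 (j : ℕ) (h : j ≠ 1) : bd 2 j = 0 := by
  simp only [bd]; split <;> simp_all
theorem bd3 (j : ℕ) (h : j ≠ 1) : bd 3 j = 0 := by
  simp only [bd]; split <;> simp_all
theorem bd4 (j : ℕ) (h : j ≠ 2) : bd 4 j = 0 := by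
  simp only [bd]; split <;> simp_all
theorem bd5 (i j : ℕ) : bd (i + 5) j = 0 := by
  rcases j with _ | _ | _ | j <;> rfl

theorem ss5 (i : ℕ) : Subsingleton (AMD.FreeGr K r (bd (i + 5))) := by
  have : IsEmpty ((j : ℕ) × Fin (bd (i + 5) j)) := by
    constructor
    rintro ⟨j, t⟩
    have h1 := t.2
    have h2 := bd5 i j
    omega
  infer_instance

theorem betti_pack {G1 : Matrix (Fin 1) (Fin 9) (PS K r)} {G2 : Matrix (Fin 9) (Fin 16) (PS K r)}
    {G3 : Matrix (Fin 16) (Fin 9) (PS K r)} {G4 : Matrix (Fin 9) (Fin 1) (PS K r)}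
    (h1 : ∀ i j, (G1 i j).IsHomogeneous 2) (h2 : ∀ i j, (G2 i j).IsHomogeneous 1)
    (h3 : ∀ i j, (G3 i j).IsHomogeneous 1) (h4 : ∀ i j, (G4 i j).IsHomogeneous 2)
    (a1 : ∀ y, G1 *ᵥ y ∈ N0 I) (b1 : ∀ f ∈ N0 I, ∃ y, f = G1 *ᵥ y)
    (a2 : ∀ y, G2 *ᵥ y ∈ LinearMap.ker G1.mulVecLin) (b2 : ∀ f ∈ LinearMap.ker G1.mulVecLin, ∃ y, f = G2 *ᵥ y)
    (a3 : ∀ y, G3 *ᵥ y ∈ LinearMap.ker G2.mulVecLin) (b3 : ∀ f ∈ LinearMap.ker G2.mulVecLin, ∃ y, f = G3 *ᵥ y)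
    (a4 : ∀ y, G4 *ᵥ y ∈ LinearMap.ker G3.mulVecLin) (b4 : ∀ f ∈ LinearMap.ker G3.mulVecLin, ∃ y, f = G4 *ᵥ y)
    (b5 : ∀ f ∈ LinearMap.ker G4.mulVecLin, f = 0) : AMD.HasBettiDiagram K r I bd := by
  let e1 := rowEquiv (bd 1) 1 9 rfl bd1
  let e2 := rowEquiv (bd 2) 1 16 rfl bd2
  let e3 := rowEquiv (bd 3) 1 9 rfl bd3
  let e4 := rowEquiv (bd 4) 2 1 rfl bd4
  let φ : (i : ℕ) → (AMD.FreeGr K r (bd (i + 2)) →ₗ[PS K r] AMD.FreeGr K r (bd (i + 1))) := fun i =>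
    match i with
    | 0 => Mt e2 e1 G2
    | 1 => Mt e3 e2 G3
    | 2 => Mt e4 e3 G4
    | (i + 3) => 0
  let ε : AMD.FreeGr K r (bd 1) →ₗ[PS K r] PS K r :=
    LinearMap.proj 0 ∘ₗ G1.mulVecLin ∘ₗ (Th K r e1).toLinearMap
  have hε : ∀ y, ε y = (G1 *ᵥ (Th K r e1 y)) 0 := fun y => rfl
  refine ⟨φ, ε, ?_, ?_, ?_, ?_, ?_⟩
  · intro j t
    have hj : j = 1 := by
      by_contra hj
      have h1 := t.2
      have h2 := bd1 j hj
      omega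
    subst hj
    rw [hε, Th_single, Matrix.mulVec_single_one]
    exact h1 _ _
  · intro i
    match i with
    | 0 => exact Mt_min e2 e1 bd2 bd1 G2 _ _ 1 le_rfl rfl h2
    | 1 => exact Mt_min e3 e2 bd3 bd2 G3 _ _ 1 le_rfl rfl h3
    | 2 => exact Mt_min e4 e3 bd4 bd3 G4 _ _ 2 one_le_two rfl h4
    | (i + 3) =>
      intro j t j' t'
      left
      rfl
  · ext f
    rw [LinearMap.mem_range]
    constructor
    · rintro ⟨y, rfl⟩
      rw [hε]
      exact mem_N0.1 (a1 _)
    · intro hf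
      obtain ⟨y, hy⟩ := b1 (fun _ => f) hf
      refine ⟨(Th K r e1).symm y, ?_⟩
      rw [hε, LinearEquiv.apply_symm_apply, ← hy]
  · rw [show φ 0 = Mt e2 e1 G2 from rfl]
    ext f
    rw [LinearMap.mem_ker, LinearMap.mem_range, hε]
    simp only [Mt, LinearMap.comp_apply, LinearEquiv.coe_coe]
    constructor
    · intro h
      obtain ⟨y, hy⟩ := b2 (Th K r e1 f) (by
        rw [LinearMap.mem_ker, Matrix.mulVecLin_apply]
        ext1 i
        rw [Subsingleton.elim i 0]
        exact h)
      refine ⟨(Th K r e2).symm y, ?_⟩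
      rw [LinearEquiv.apply_symm_apply, Matrix.mulVecLin_apply, ← hy, LinearEquiv.symm_apply_apply]
    · rintro ⟨y, rfl⟩
      rw [LinearEquiv.apply_symm_apply]
      have := a2 (Th K r e2 y)
      rw [LinearMap.mem_ker, Matrix.mulVecLin_apply] at this
      exact congrFun this 0
  · intro i
    match i with
    | 0 => exact Mt_exact e2 e1 e3 G2 G3 a3 b3
    | 1 => exact Mt_exact e3 e2 e4 G3 G4 a4 b4
    | 2 =>
      rw [show φ (2 + 1) = 0 from rfl, LinearMap.range_zero, show φ 2 = Mt e4 e3 G4 from rfl, LinearMap.ker_eq_bot']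
      intro y hy
      simp only [Mt, LinearMap.comp_apply, LinearEquiv.coe_coe, LinearEquiv.map_eq_zero_iff] at hy
      have := b5 _ hy
      rwa [LinearEquiv.map_eq_zero_iff] at this
    | (i + 3) =>
      have := ss5 (K := K) (r := r) i
      ext f
      have e0 : f = 0 := Subsingleton.elim (α := AMD.FreeGr K r (bd (i + 5))) _ _
      rw [e0]
      exact ⟨fun _ => Submodule.zero_mem _, fun _ => Submodule.zero_mem _⟩

theorem Nice.betti (hI : HomI I) (h : Nice I l x w E κ) (hπ : Pr l x π) :
    AMD.HasBettiDiagram K r I bd := by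
  have h1 : ∀ i j, (G1 l x w E κ i j).IsHomogeneous 2 := fun i j => h.Gq_hom j
  obtain ⟨G2, h2, r2, a2, b2, p2⟩ := lift_step hπ h.regN0 h1 (h.G1_mem hI) (h.gen hI hπ)
    (h.pi_G1 hπ) (D2_hom κ) (fun y => D1_comp _ _ _ _ _ y) (exact1 κ)
  obtain ⟨G3, h3, r3, a3, b3, p3⟩ := lift_step hπ r2 h2 a2 b2 p2 (D3_hom κ) (fun y => D2_comp _ _ _ _ _ y) (exact2 κ)
  obtain ⟨G4, h4, r4, a4, b4, p4⟩ := lift_step hπ r3 h3 a3 b3 p3 (D4_hom κ) (fun y => D3_comp _ _ _ _ _ y) (exact3 κ)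
  obtain ⟨G5, h5, r5, a5, b5, p5⟩ := lift_step hπ r4 h4 a4 b4 p4 (e' := 1) (D' := D5' K) (fun i j => j.elim0)
    (fun y => by simp) (fun z hz => ⟨0, by rw [exact4 κ z hz]; simp⟩)
  refine betti_pack h1 h2 h3 h4 (h.G1_mem hI) (h.gen hI hπ) a2 b2 a3 b3 a4 b4 ?_
  intro f hf
  obtain ⟨y, rfl⟩ := b5 f hf
  ext1 i
  simp [Matrix.mulVec]

end
end SixFour

namespace SixFour
open scoped Matrix
set_option linter.unusedSectionVars false

section
variable {K : Type} [Field K] {V : Type} [AddCommGroup V] [Module K V] [FiniteDimensional K V]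

/-- six functionals with trivial common kernel on a space of dimension at least six are surjective -/
theorem six_surj (hV : 6 ≤ Module.finrank K V) (g : Fin 6 → V →ₗ[K] K)
    (hg : ∀ v, (∀ i, g i v = 0) → v = 0) (c : Fin 6 → K) : ∃ v, ∀ i, g i v = c i := by
  have hinj : Function.Injective (LinearMap.pi g) := by
    rw [← LinearMap.ker_eq_bot, LinearMap.ker_eq_bot']
    intro v hv
    exact hg v fun i => congrFun hv i
  have hle := LinearMap.finrank_le_finrank_of_injective hinj
  rw [Module.finrank_fin_fun] at hle
  have hs := (LinearMap.injective_iff_surjective_of_finrank_eq_finrank (f := LinearMap.pi g)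
    (by rw [Module.finrank_fin_fun]; omega)).1 hinj
  obtain ⟨v, hv⟩ := hs c
  exact ⟨v, fun i => congrFun hv i⟩

theorem six_pick (hV : 6 ≤ Module.finrank K V) (g : Fin 6 → V →ₗ[K] K)
    (hg : ∀ v, (∀ i, g i v = 0) → v = 0) (h : ∀ v, g 0 v = 0 → g 1 v = 0 → g 2 v = 0 → g 3 v * g 4 v = 0) :
    False := by
  obtain ⟨v, hv⟩ := six_surj hV g hg ![0, 0, 0, 1, 1, 0]
  have := h v (hv 0) (hv 1) (hv 2)
  rw [hv 3, hv 4] at this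
  simp at this

theorem linA1 (hV : 6 ≤ Module.finrank K V) (z1 z2 : V →ₗ[K] K) (a b : Fin 3 → V →ₗ[K] K)
    (hi : ∀ v, z1 v = 0 → z2 v = 0 → (∀ j, a j v = 0) → (∀ j, b j v = 0) → v = 0)
    (hm : ∀ v, z1 v = 0 → z2 v = 0 → ∀ i j, a i v * b j v = a j v * b i v)
    (p : V) (h1 : z1 p = 0) (h2 : z2 p = 0) (i : Fin 3) (hp : a i p ≠ 0) : False := by
  refine six_pick hV ![z1, z2, a i, b i, a (i+1), a (i+2)] ?_ ?_
  · intro v hv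
    have e1 : z1 v = 0 := hv 0
    have e2 : z2 v = 0 := hv 1
    have e3 : a i v = 0 := hv 2
    have e4 : b i v = 0 := hv 3
    have e5 : a (i+1) v = 0 := hv 4
    have e6 : a (i+2) v = 0 := hv 5
    have ha : ∀ j, a j v = 0 := by
      intro j
      have hd : ∀ i j : Fin 3, j = i ∨ j = i + 1 ∨ j = i + 2 := by decide
      rcases hd i j with rfl | rfl | rfl <;> assumption
    refine hi v e1 e2 ha ?_
    intro j
    have k1 := hm (p + v) (by rw [map_add, h1, e1, add_zero]) (by rw [map_add, h2, e2, add_zero]) i j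
    have k2 := hm p h1 h2 i j
    simp only [map_add, ha, e4, add_zero] at k1
    have : a i p * b j v = 0 := by linear_combination k1 - k2
    exact (mul_eq_zero.1 this).resolve_left hp
  · intro v e1 e2 e3
    have := hm v e1 e2 i (i+1)
    change a i v = 0 at e3
    rw [e3, zero_mul] at this
    change b i v * a (i+1) v = 0
    rw [mul_comm]; exact this.symm

theorem linA (hV : 6 ≤ Module.finrank K V) (z1 z2 : V →ₗ[K] K) (a b : Fin 3 → V →ₗ[K] K)
    (hi : ∀ v, z1 v = 0 → z2 v = 0 → (∀ j, a j v = 0) → (∀ j, b j v = 0) → v = 0)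
    (hm : ∀ v, z1 v = 0 → z2 v = 0 → ∀ i j, a i v * b j v = a j v * b i v) : False := by
  by_cases h : ∃ p, z1 p = 0 ∧ z2 p = 0 ∧ ∃ i, a i p ≠ 0
  · obtain ⟨p, h1, h2, i, hp⟩ := h
    exact linA1 hV z1 z2 a b hi hm p h1 h2 i hp
  by_cases h' : ∃ p, z1 p = 0 ∧ z2 p = 0 ∧ ∃ i, b i p ≠ 0
  · obtain ⟨p, h1, h2, i, hp⟩ := h'
    exact linA1 hV z1 z2 b a (fun v e1 e2 e3 e4 => hi v e1 e2 e4 e3) (fun v e1 e2 i j => by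
      have := hm v e1 e2 j i
      linear_combination this) p h1 h2 i hp
  push Not at h h'
  refine six_pick hV ![z1, z2, 0, 0, 0, 0] ?_ ?_
  · intro v hv
    exact hi v (hv 0) (hv 1) (h v (hv 0) (hv 1)) (h' v (hv 0) (hv 1))
  · intro v _ _ _
    simp

theorem others (i j : Fin 5) (h : i ≠ j) : ∃ c : Fin 3 → Fin 5, ∀ k, k = i ∨ k = j ∨ ∃ t, k = c t := by
  have : ∀ i j : Fin 5, i ≠ j → ∃ a b c : Fin 5, ∀ k, k = i ∨ k = j ∨ k = a ∨ k = b ∨ k = c := by decide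
  obtain ⟨a, b, c, h⟩ := this i j h
  refine ⟨![a, b, c], fun k => ?_⟩
  rcases h k with h | h | h | h | h
  · exact Or.inl h
  · exact Or.inr (Or.inl h)
  · exact Or.inr (Or.inr ⟨0, h⟩)
  · exact Or.inr (Or.inr ⟨1, h⟩)
  · exact Or.inr (Or.inr ⟨2, h⟩)

theorem linB (hV : 6 ≤ Module.finrank K V) (z1 : V →ₗ[K] K) (P : Fin 5 → Fin 5 → V →ₗ[K] K)
    (hs : ∀ i j, P i j = - P j i) (h0 : ∀ i, P i i = 0)
    (hi : ∀ v, z1 v = 0 → (∀ i j, P i j v = 0) → v = 0)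
    (hP : ∀ v, z1 v = 0 → ∀ i j k l, P i j v * P k l v - P i k v * P j l v + P i l v * P j k v = 0) : False := by
  by_cases h : ∃ p, z1 p = 0 ∧ ∃ i j, P i j p ≠ 0
  · obtain ⟨p, h1, i, j, hp⟩ := h
    have hij : i ≠ j := by
      rintro rfl
      rw [h0] at hp; simp at hp
    obtain ⟨c, hc⟩ := others i j hij
    refine linA hV z1 (P i j) (fun t => P i (c t)) (fun t => P j (c t)) ?_ ?_
    · intro v e1 e2 ha hb
      refine hi v e1 ?_
      have hI : ∀ k, P i k v = 0 := by
        intro k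
        rcases hc k with rfl | rfl | ⟨t, rfl⟩
        · rw [h0]; rfl
        · exact e2
        · exact ha t
      have hJ : ∀ k, P j k v = 0 := by
        intro k
        rcases hc k with rfl | rfl | ⟨t, rfl⟩
        · rw [hs, LinearMap.neg_apply, e2, neg_zero]
        · rw [h0]; rfl
        · exact hb t
      intro k l
      have k1 := hP (p + v) (by rw [map_add, h1, e1, add_zero]) i j k l
      have k2 := hP p h1 i j k l
      simp only [map_add, hI, hJ, add_zero] at k1
      have : P i j p * P k l v = 0 := by linear_combination k1 - k2
      exact (mul_eq_zero.1 this).resolve_left hp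
    · intro v e1 e2 s t
      have := hP v e1 i j (c s) (c t)
      rw [e2] at this
      linear_combination -this
  · push Not at h
    refine six_pick hV ![z1, 0, 0, 0, 0, 0] ?_ ?_
    · intro v hv
      exact hi v (hv 0) (h v (hv 0))
    · intro v _ _ _
      simp

theorem pluck (M : Fin 5 → Fin 5 → K) (hs : ∀ i j, M i j = - M j i) (h0 : ∀ i, M i i = 0)
    (h : ∀ i j k l : Fin 5, i < j → j < k → k < l → M i j * M k l - M i k * M j l + M i l * M j k = 0)
    (i j k l : Fin 5) : M i j * M k l - M i k * M j l + M i l * M j k = 0 := by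
  let T : Fin 5 → Fin 5 → Fin 5 → Fin 5 → K := fun i j k l => M i j * M k l - M i k * M j l + M i l * M j k
  have t1 : ∀ i j k l, T j i k l = 0 → T i j k l = 0 := by
    intro i j k l h
    simp only [T] at h ⊢
    rw [hs i j]; linear_combination -h
  have t2 : ∀ i j k l, T i k j l = 0 → T i j k l = 0 := by
    intro i j k l h
    simp only [T] at h ⊢
    rw [hs j k]; linear_combination -h
  have t3 : ∀ i j k l, T i j l k = 0 → T i j k l = 0 := by
    intro i j k l h
    simp only [T] at h ⊢
    rw [hs k l]; linear_combination -h
  have u1 : ∀ i k l, T i i k l = 0 := by intro i k l; simp only [T, h0]; ring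
  have u2 : ∀ i k l, T i k k l = 0 := by intro i k l; simp only [T, h0]; ring
  have u3 : ∀ i k l, T i k l l = 0 := by intro i k l; simp only [T, h0]; ring
  have s1 : ∀ i j k l, i < j → j < k → T i j k l = 0 := by
    intro i j k l hij hjk
    rcases lt_trichotomy k l with hl | rfl | hl
    · exact h i j k l hij hjk hl
    · exact u3 _ _ _
    apply t3
    rcases lt_trichotomy j l with hl' | rfl | hl'
    · exact h i j l k hij hl' hl
    · exact u2 _ _ _
    apply t2
    rcases lt_trichotomy i l with hl'' | rfl | hl''
    · exact h i l j k hl'' hl' hjk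
    · exact u1 _ _ _
    apply t1
    exact h l i j k hl'' hij hjk
  have s2 : ∀ i j k l, i < j → T i j k l = 0 := by
    intro i j k l hij
    rcases lt_trichotomy j k with hl | rfl | hl
    · exact s1 i j k l hij hl
    · exact u2 _ _ _
    apply t2
    rcases lt_trichotomy i k with hl' | rfl | hl'
    · exact s1 i k j l hl' hl
    · exact u1 _ _ _
    apply t1
    exact s1 k i j l hl' hij
  rcases lt_trichotomy i j with hl | rfl | hl
  · exact s2 i j k l hl
  · exact u1 _ _ _
  · exact t1 _ _ _ _ (s2 j i k l hl)

def skew (p : Fin 10 → V →ₗ[K] K) : Fin 5 → Fin 5 → V →ₗ[K] K :=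
  ![![0, p 0, p 1, p 2, p 3], ![-p 0, 0, p 4, p 5, p 6], ![-p 1, -p 4, 0, p 7, p 8],
    ![-p 2, -p 5, -p 7, 0, p 9], ![-p 3, -p 6, -p 8, -p 9, 0]]

theorem linC (hV : 6 ≤ Module.finrank K V) (s : V →ₗ[K] K) (η : Fin 5 → V →ₗ[K] K) (p : Fin 10 → V →ₗ[K] K)
    (hi : ∀ v, s v = 0 → (∀ i, η i v = 0) → (∀ i, p i v = 0) → v = 0)
    (q0 : ∀ v, s v * η 0 v = p 4 v * p 9 v - p 5 v * p 8 v + p 6 v * p 7 v)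
    (q1 : ∀ v, s v * η 1 v = p 1 v * p 9 v - p 2 v * p 8 v + p 3 v * p 7 v)
    (q2 : ∀ v, s v * η 2 v = p 0 v * p 9 v - p 2 v * p 6 v + p 3 v * p 5 v)
    (q3 : ∀ v, s v * η 3 v = p 0 v * p 8 v - p 1 v * p 6 v + p 3 v * p 4 v)
    (q4 : ∀ v, s v * η 4 v = p 0 v * p 7 v - p 1 v * p 5 v + p 2 v * p 4 v)
    (u : V) (hu : s u ≠ 0) : False := by
  have hs : ∀ i j, skew p i j = - skew p j i := by
    intro i j
    fin_cases i <;> fin_cases j <;> simp [skew]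
  have h0 : ∀ i, skew p i i = 0 := by
    intro i
    fin_cases i <;> simp [skew]
  refine linB hV s (skew p) hs h0 ?_ ?_
  · intro v e1 e2
    have e3 : ∀ i, p i v = 0 := by
      intro i
      fin_cases i
      · exact e2 0 1
      · exact e2 0 2
      · exact e2 0 3
      · exact e2 0 4
      · exact e2 1 2
      · exact e2 1 3
      · exact e2 1 4
      · exact e2 2 3
      · exact e2 2 4
      · exact e2 3 4
    refine hi v e1 ?_ e3
    have key : ∀ i, s (u + v) * η i (u + v) = s u * η i u → η i v = 0 := by
      intro i hh
      rw [map_add, map_add, e1, add_zero] at hh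
      have : s u * η i v = 0 := by linear_combination hh
      exact (mul_eq_zero.1 this).resolve_left hu
    intro i
    apply key
    fin_cases i
    · exact (q0 (u + v)).trans (by simp only [map_add, e3, add_zero]; exact (q0 u).symm)
    · exact (q1 (u + v)).trans (by simp only [map_add, e3, add_zero]; exact (q1 u).symm)
    · exact (q2 (u + v)).trans (by simp only [map_add, e3, add_zero]; exact (q2 u).symm)
    · exact (q3 (u + v)).trans (by simp only [map_add, e3, add_zero]; exact (q3 u).symm)
    · exact (q4 (u + v)).trans (by simp only [map_add, e3, add_zero]; exact (q4 u).symm)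
  · intro v e1
    refine pluck (fun i j => skew p i j v) (fun i j => by rw [hs]; rfl) (fun i => by rw [h0]; rfl) ?_
    have : ∀ i j k l : Fin 5, i < j → j < k → k < l →
      (i = 1 ∧ j = 2 ∧ k = 3 ∧ l = 4) ∨ (i = 0 ∧ j = 2 ∧ k = 3 ∧ l = 4) ∨ (i = 0 ∧ j = 1 ∧ k = 3 ∧ l = 4) ∨
      (i = 0 ∧ j = 1 ∧ k = 2 ∧ l = 4) ∨ (i = 0 ∧ j = 1 ∧ k = 2 ∧ l = 3) := by decide
    intro i j k l a b c
    have z : s v * η 0 v = 0 ∧ s v * η 1 v = 0 ∧ s v * η 2 v = 0 ∧ s v * η 3 v = 0 ∧ s v * η 4 v = 0 := by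
      simp [e1]
    obtain ⟨z0, z1, z2, z3, z4⟩ := z
    rcases this i j k l a b c with ⟨rfl, rfl, rfl, rfl⟩ | ⟨rfl, rfl, rfl, rfl⟩ | ⟨rfl, rfl, rfl, rfl⟩ |
      ⟨rfl, rfl, rfl, rfl⟩ | ⟨rfl, rfl, rfl, rfl⟩
    · exact (q0 v).symm.trans z0
    · exact (q1 v).symm.trans z1
    · exact (q2 v).symm.trans z2
    · exact (q3 v).symm.trans z3
    · exact (q4 v).symm.trans z4

end
end SixFour

namespace SixFour
open scoped Matrix
set_option linter.unusedSectionVars false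

section
variable {K : Type} [Field K] {V : Type} [AddCommGroup V] [Module K V] [FiniteDimensional K V]

/-- the ten quadrics of the spinor variety -/
structure Spin (m : Fin 4 → Fin 4 → V →ₗ[K] K) : Prop where
  q1 : ∀ v, m 0 0 v * m 1 3 v + m 0 1 v * m 1 2 v + m 0 2 v * m 1 1 v + m 0 3 v * m 1 0 v = 0
  q2 : ∀ v, m 0 0 v * m 2 3 v + m 0 1 v * m 2 2 v + m 0 2 v * m 2 1 v + m 0 3 v * m 2 0 v = 0
  q3 : ∀ v, m 0 0 v * m 3 1 v - m 0 1 v * m 3 0 v + m 1 0 v * m 2 1 v - m 1 1 v * m 2 0 v = 0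
  q4 : ∀ v, - m 0 0 v * m 3 2 v + m 0 2 v * m 3 0 v + m 1 0 v * m 2 2 v - m 1 2 v * m 2 0 v = 0
  q5 : ∀ v, m 0 1 v * m 3 2 v - m 0 2 v * m 3 1 v + m 1 0 v * m 2 3 v - m 1 3 v * m 2 0 v = 0
  q6 : ∀ v, m 0 1 v * m 3 3 v - m 0 3 v * m 3 1 v - m 1 1 v * m 2 3 v + m 1 3 v * m 2 1 v = 0
  q7 : ∀ v, m 0 2 v * m 3 3 v - m 0 3 v * m 3 2 v + m 1 2 v * m 2 3 v - m 1 3 v * m 2 2 v = 0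
  q8 : ∀ v, m 1 0 v * m 3 3 v + m 1 1 v * m 3 2 v + m 1 2 v * m 3 1 v + m 1 3 v * m 3 0 v = 0
  q9 : ∀ v, m 2 0 v * m 3 3 v + m 2 1 v * m 3 2 v + m 2 2 v * m 3 1 v + m 2 3 v * m 3 0 v = 0
  q10 : ∀ v, m 0 0 v * m 3 3 v - m 0 3 v * m 3 0 v + m 1 1 v * m 2 2 v - m 1 2 v * m 2 1 v = 0
  inj : ∀ v, (∀ i j, m i j v = 0) → v = 0

theorem Spin.z11 (hV : 6 ≤ Module.finrank K V) {m : Fin 4 → Fin 4 → V →ₗ[K] K} (h : Spin m) (u : V) : m 0 0 u = 0 := by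
  by_contra hu
  refine linC hV (m 0 0) ![-m 1 3, -m 2 3, m 3 1, -m 3 2, m 3 3]
    ![m 3 0, m 2 2, m 2 1, m 2 0, m 1 2, m 1 1, m 1 0, m 0 3, -m 0 2, m 0 1] ?_ ?_ ?_ ?_ ?_ ?_ u hu
  · intro v e1 e2 e3
    refine h.inj v fun i j => ?_
    simp only [Fin.forall_fin_succ, Matrix.cons_val, LinearMap.neg_apply, neg_eq_zero, Fin.reduceSucc, Fin.isValue, Fin.succ_zero_eq_one, Fin.forall_fin_zero_pi, IsEmpty.forall_iff, and_true] at e2 e3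
    fin_cases i <;> fin_cases j <;> first | exact e1 | simp [e2, e3]
  · intro v
    simp only [Matrix.cons_val, LinearMap.neg_apply]
    linear_combination - h.q1 v
  · intro v
    simp only [Matrix.cons_val, LinearMap.neg_apply]
    linear_combination - h.q2 v
  · intro v
    simp only [Matrix.cons_val, LinearMap.neg_apply]
    linear_combination  h.q3 v
  · intro v
    simp only [Matrix.cons_val, LinearMap.neg_apply]
    linear_combination  h.q4 v
  · intro v
    simp only [Matrix.cons_val, LinearMap.neg_apply]
    linear_combination  h.q10 v

theorem Spin.z12 (hV : 6 ≤ Module.finrank K V) {m : Fin 4 → Fin 4 → V →ₗ[K] K} (h : Spin m) (u : V) : m 0 1 u = 0 := by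
  by_contra hu
  refine linC hV (m 0 1) ![m 1 2, m 2 2, -m 3 0, m 3 2, -m 3 3]
    ![m 3 1, m 2 3, m 2 1, m 2 0, m 1 3, m 1 1, m 1 0, -m 0 3, m 0 2, -m 0 0] ?_ ?_ ?_ ?_ ?_ ?_ u hu
  · intro v e1 e2 e3
    refine h.inj v fun i j => ?_
    simp only [Fin.forall_fin_succ, Matrix.cons_val, LinearMap.neg_apply, neg_eq_zero, Fin.reduceSucc, Fin.isValue, Fin.succ_zero_eq_one, Fin.forall_fin_zero_pi, IsEmpty.forall_iff, and_true] at e2 e3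
    fin_cases i <;> fin_cases j <;> first | exact e1 | simp [e2, e3]
  · intro v
    simp only [Matrix.cons_val, LinearMap.neg_apply]
    linear_combination  h.q1 v
  · intro v
    simp only [Matrix.cons_val, LinearMap.neg_apply]
    linear_combination  h.q2 v
  · intro v
    simp only [Matrix.cons_val, LinearMap.neg_apply]
    linear_combination  h.q3 v
  · intro v
    simp only [Matrix.cons_val, LinearMap.neg_apply]
    linear_combination  h.q5 v
  · intro v
    simp only [Matrix.cons_val, LinearMap.neg_apply]
    linear_combination - h.q6 v

theorem Spin.z13 (hV : 6 ≤ Module.finrank K V) {m : Fin 4 → Fin 4 → V →ₗ[K] K} (h : Spin m) (u : V) : m 0 2 u = 0 := by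
  by_contra hu
  refine linC hV (m 0 2) ![-m 1 1, -m 2 1, m 3 0, -m 3 1, m 3 3]
    ![m 3 2, m 2 3, m 2 2, m 2 0, m 1 3, m 1 2, m 1 0, m 0 3, -m 0 1, m 0 0] ?_ ?_ ?_ ?_ ?_ ?_ u hu
  · intro v e1 e2 e3
    refine h.inj v fun i j => ?_
    simp only [Fin.forall_fin_succ, Matrix.cons_val, LinearMap.neg_apply, neg_eq_zero, Fin.reduceSucc, Fin.isValue, Fin.succ_zero_eq_one, Fin.forall_fin_zero_pi, IsEmpty.forall_iff, and_true] at e2 e3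
    fin_cases i <;> fin_cases j <;> first | exact e1 | simp [e2, e3]
  · intro v
    simp only [Matrix.cons_val, LinearMap.neg_apply]
    linear_combination - h.q1 v
  · intro v
    simp only [Matrix.cons_val, LinearMap.neg_apply]
    linear_combination - h.q2 v
  · intro v
    simp only [Matrix.cons_val, LinearMap.neg_apply]
    linear_combination  h.q4 v
  · intro v
    simp only [Matrix.cons_val, LinearMap.neg_apply]
    linear_combination  h.q5 v
  · intro v
    simp only [Matrix.cons_val, LinearMap.neg_apply]
    linear_combination  h.q7 v

theorem Spin.z14 (hV : 6 ≤ Module.finrank K V) {m : Fin 4 → Fin 4 → V →ₗ[K] K} (h : Spin m) (u : V) : m 0 3 u = 0 := by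
  by_contra hu
  refine linC hV (m 0 3) ![m 1 0, m 2 0, -m 3 1, m 3 2, -m 3 0]
    ![m 3 3, m 2 2, m 2 1, m 2 3, m 1 2, m 1 1, m 1 3, -m 0 0, m 0 2, -m 0 1] ?_ ?_ ?_ ?_ ?_ ?_ u hu
  · intro v e1 e2 e3
    refine h.inj v fun i j => ?_
    simp only [Fin.forall_fin_succ, Matrix.cons_val, LinearMap.neg_apply, neg_eq_zero, Fin.reduceSucc, Fin.isValue, Fin.succ_zero_eq_one, Fin.forall_fin_zero_pi, IsEmpty.forall_iff, and_true] at e2 e3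
    fin_cases i <;> fin_cases j <;> first | exact e1 | simp [e2, e3]
  · intro v
    simp only [Matrix.cons_val, LinearMap.neg_apply]
    linear_combination  h.q1 v
  · intro v
    simp only [Matrix.cons_val, LinearMap.neg_apply]
    linear_combination  h.q2 v
  · intro v
    simp only [Matrix.cons_val, LinearMap.neg_apply]
    linear_combination  h.q6 v
  · intro v
    simp only [Matrix.cons_val, LinearMap.neg_apply]
    linear_combination - h.q7 v
  · intro v
    simp only [Matrix.cons_val, LinearMap.neg_apply]
    linear_combination  h.q10 v

theorem Spin.z21 (hV : 6 ≤ Module.finrank K V) {m : Fin 4 → Fin 4 → V →ₗ[K] K} (h : Spin m) (u : V) : m 1 0 u = 0 := by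
  by_contra hu
  refine linC hV (m 1 0) ![m 0 3, m 2 1, -m 2 2, m 2 3, -m 3 3]
    ![m 3 2, m 3 1, m 3 0, m 2 0, m 1 3, -m 1 2, -m 0 2, m 1 1, -m 0 1, -m 0 0] ?_ ?_ ?_ ?_ ?_ ?_ u hu
  · intro v e1 e2 e3
    refine h.inj v fun i j => ?_
    simp only [Fin.forall_fin_succ, Matrix.cons_val, LinearMap.neg_apply, neg_eq_zero, Fin.reduceSucc, Fin.isValue, Fin.succ_zero_eq_one, Fin.forall_fin_zero_pi, IsEmpty.forall_iff, and_true] at e2 e3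
    fin_cases i <;> fin_cases j <;> first | exact e1 | simp [e2, e3]
  · intro v
    simp only [Matrix.cons_val, LinearMap.neg_apply]
    linear_combination  h.q1 v
  · intro v
    simp only [Matrix.cons_val, LinearMap.neg_apply]
    linear_combination  h.q3 v
  · intro v
    simp only [Matrix.cons_val, LinearMap.neg_apply]
    linear_combination - h.q4 v
  · intro v
    simp only [Matrix.cons_val, LinearMap.neg_apply]
    linear_combination  h.q5 v
  · intro v
    simp only [Matrix.cons_val, LinearMap.neg_apply]
    linear_combination - h.q8 v

theorem Spin.z22 (hV : 6 ≤ Module.finrank K V) {m : Fin 4 → Fin 4 → V →ₗ[K] K} (h : Spin m) (u : V) : m 1 1 u = 0 := by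
  by_contra hu
  refine linC hV (m 1 1) ![-m 0 2, -m 2 0, m 2 3, -m 3 2, m 2 2]
    ![m 3 3, m 3 0, m 2 1, m 3 1, m 1 2, -m 0 3, -m 1 3, -m 0 0, m 1 0, m 0 1] ?_ ?_ ?_ ?_ ?_ ?_ u hu
  · intro v e1 e2 e3
    refine h.inj v fun i j => ?_
    simp only [Fin.forall_fin_succ, Matrix.cons_val, LinearMap.neg_apply, neg_eq_zero, Fin.reduceSucc, Fin.isValue, Fin.succ_zero_eq_one, Fin.forall_fin_zero_pi, IsEmpty.forall_iff, and_true] at e2 e3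
    fin_cases i <;> fin_cases j <;> first | exact e1 | simp [e2, e3]
  · intro v
    simp only [Matrix.cons_val, LinearMap.neg_apply]
    linear_combination - h.q1 v
  · intro v
    simp only [Matrix.cons_val, LinearMap.neg_apply]
    linear_combination  h.q3 v
  · intro v
    simp only [Matrix.cons_val, LinearMap.neg_apply]
    linear_combination - h.q6 v
  · intro v
    simp only [Matrix.cons_val, LinearMap.neg_apply]
    linear_combination - h.q8 v
  · intro v
    simp only [Matrix.cons_val, LinearMap.neg_apply]
    linear_combination  h.q10 v

theorem Spin.z23 (hV : 6 ≤ Module.finrank K V) {m : Fin 4 → Fin 4 → V →ₗ[K] K} (h : Spin m) (u : V) : m 1 2 u = 0 := by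
  by_contra hu
  refine linC hV (m 1 2) ![m 0 1, -m 2 0, m 2 3, -m 3 1, m 2 1]
    ![m 3 3, m 3 0, m 2 2, m 3 2, m 1 1, m 0 3, -m 1 3, m 0 0, m 1 0, -m 0 2] ?_ ?_ ?_ ?_ ?_ ?_ u hu
  · intro v e1 e2 e3
    refine h.inj v fun i j => ?_
    simp only [Fin.forall_fin_succ, Matrix.cons_val, LinearMap.neg_apply, neg_eq_zero, Fin.reduceSucc, Fin.isValue, Fin.succ_zero_eq_one, Fin.forall_fin_zero_pi, IsEmpty.forall_iff, and_true] at e2 e3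
    fin_cases i <;> fin_cases j <;> first | exact e1 | simp [e2, e3]
  · intro v
    simp only [Matrix.cons_val, LinearMap.neg_apply]
    linear_combination  h.q1 v
  · intro v
    simp only [Matrix.cons_val, LinearMap.neg_apply]
    linear_combination  h.q4 v
  · intro v
    simp only [Matrix.cons_val, LinearMap.neg_apply]
    linear_combination  h.q7 v
  · intro v
    simp only [Matrix.cons_val, LinearMap.neg_apply]
    linear_combination - h.q8 v
  · intro v
    simp only [Matrix.cons_val, LinearMap.neg_apply]
    linear_combination - h.q10 v

theorem Spin.z24 (hV : 6 ≤ Module.finrank K V) {m : Fin 4 → Fin 4 → V →ₗ[K] K} (h : Spin m) (u : V) : m 1 3 u = 0 := by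
  by_contra hu
  refine linC hV (m 1 3) ![-m 0 0, m 2 0, -m 2 1, m 2 2, -m 3 0]
    ![m 3 3, m 3 2, m 3 1, m 2 3, m 1 2, -m 1 1, m 0 3, m 1 0, m 0 2, m 0 1] ?_ ?_ ?_ ?_ ?_ ?_ u hu
  · intro v e1 e2 e3
    refine h.inj v fun i j => ?_
    simp only [Fin.forall_fin_succ, Matrix.cons_val, LinearMap.neg_apply, neg_eq_zero, Fin.reduceSucc, Fin.isValue, Fin.succ_zero_eq_one, Fin.forall_fin_zero_pi, IsEmpty.forall_iff, and_true] at e2 e3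
    fin_cases i <;> fin_cases j <;> first | exact e1 | simp [e2, e3]
  · intro v
    simp only [Matrix.cons_val, LinearMap.neg_apply]
    linear_combination - h.q1 v
  · intro v
    simp only [Matrix.cons_val, LinearMap.neg_apply]
    linear_combination - h.q5 v
  · intro v
    simp only [Matrix.cons_val, LinearMap.neg_apply]
    linear_combination - h.q6 v
  · intro v
    simp only [Matrix.cons_val, LinearMap.neg_apply]
    linear_combination - h.q7 v
  · intro v
    simp only [Matrix.cons_val, LinearMap.neg_apply]
    linear_combination - h.q8 v

theorem Spin.z31 (hV : 6 ≤ Module.finrank K V) {m : Fin 4 → Fin 4 → V →ₗ[K] K} (h : Spin m) (u : V) : m 2 0 u = 0 := by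
  by_contra hu
  refine linC hV (m 2 0) ![-m 0 3, m 1 1, -m 1 2, m 1 3, -m 3 3]
    ![m 3 2, m 3 1, m 3 0, m 1 0, m 2 3, -m 2 2, m 0 2, m 2 1, m 0 1, m 0 0] ?_ ?_ ?_ ?_ ?_ ?_ u hu
  · intro v e1 e2 e3
    refine h.inj v fun i j => ?_
    simp only [Fin.forall_fin_succ, Matrix.cons_val, LinearMap.neg_apply, neg_eq_zero, Fin.reduceSucc, Fin.isValue, Fin.succ_zero_eq_one, Fin.forall_fin_zero_pi, IsEmpty.forall_iff, and_true] at e2 e3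
    fin_cases i <;> fin_cases j <;> first | exact e1 | simp [e2, e3]
  · intro v
    simp only [Matrix.cons_val, LinearMap.neg_apply]
    linear_combination - h.q2 v
  · intro v
    simp only [Matrix.cons_val, LinearMap.neg_apply]
    linear_combination - h.q3 v
  · intro v
    simp only [Matrix.cons_val, LinearMap.neg_apply]
    linear_combination  h.q4 v
  · intro v
    simp only [Matrix.cons_val, LinearMap.neg_apply]
    linear_combination - h.q5 v
  · intro v
    simp only [Matrix.cons_val, LinearMap.neg_apply]
    linear_combination - h.q9 v

theorem Spin.z32 (hV : 6 ≤ Module.finrank K V) {m : Fin 4 → Fin 4 → V →ₗ[K] K} (h : Spin m) (u : V) : m 2 1 u = 0 := by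
  by_contra hu
  refine linC hV (m 2 1) ![m 0 2, -m 1 0, m 1 3, -m 3 2, m 1 2]
    ![m 3 3, m 3 0, m 1 1, m 3 1, m 2 2, m 0 3, -m 2 3, m 0 0, m 2 0, -m 0 1] ?_ ?_ ?_ ?_ ?_ ?_ u hu
  · intro v e1 e2 e3
    refine h.inj v fun i j => ?_
    simp only [Fin.forall_fin_succ, Matrix.cons_val, LinearMap.neg_apply, neg_eq_zero, Fin.reduceSucc, Fin.isValue, Fin.succ_zero_eq_one, Fin.forall_fin_zero_pi, IsEmpty.forall_iff, and_true] at e2 e3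
    fin_cases i <;> fin_cases j <;> first | exact e1 | simp [e2, e3]
  · intro v
    simp only [Matrix.cons_val, LinearMap.neg_apply]
    linear_combination  h.q2 v
  · intro v
    simp only [Matrix.cons_val, LinearMap.neg_apply]
    linear_combination - h.q3 v
  · intro v
    simp only [Matrix.cons_val, LinearMap.neg_apply]
    linear_combination  h.q6 v
  · intro v
    simp only [Matrix.cons_val, LinearMap.neg_apply]
    linear_combination - h.q9 v
  · intro v
    simp only [Matrix.cons_val, LinearMap.neg_apply]
    linear_combination - h.q10 v

theorem Spin.z33 (hV : 6 ≤ Module.finrank K V) {m : Fin 4 → Fin 4 → V →ₗ[K] K} (h : Spin m) (u : V) : m 2 2 u = 0 := by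
  by_contra hu
  refine linC hV (m 2 2) ![-m 0 1, -m 1 0, m 1 3, -m 3 1, m 1 1]
    ![m 3 3, m 3 0, m 1 2, m 3 2, m 2 1, -m 0 3, -m 2 3, -m 0 0, m 2 0, m 0 2] ?_ ?_ ?_ ?_ ?_ ?_ u hu
  · intro v e1 e2 e3
    refine h.inj v fun i j => ?_
    simp only [Fin.forall_fin_succ, Matrix.cons_val, LinearMap.neg_apply, neg_eq_zero, Fin.reduceSucc, Fin.isValue, Fin.succ_zero_eq_one, Fin.forall_fin_zero_pi, IsEmpty.forall_iff, and_true] at e2 e3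
    fin_cases i <;> fin_cases j <;> first | exact e1 | simp [e2, e3]
  · intro v
    simp only [Matrix.cons_val, LinearMap.neg_apply]
    linear_combination - h.q2 v
  · intro v
    simp only [Matrix.cons_val, LinearMap.neg_apply]
    linear_combination - h.q4 v
  · intro v
    simp only [Matrix.cons_val, LinearMap.neg_apply]
    linear_combination - h.q7 v
  · intro v
    simp only [Matrix.cons_val, LinearMap.neg_apply]
    linear_combination - h.q9 v
  · intro v
    simp only [Matrix.cons_val, LinearMap.neg_apply]
    linear_combination  h.q10 v

theorem Spin.z34 (hV : 6 ≤ Module.finrank K V) {m : Fin 4 → Fin 4 → V →ₗ[K] K} (h : Spin m) (u : V) : m 2 3 u = 0 := by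
  by_contra hu
  refine linC hV (m 2 3) ![m 0 0, m 1 0, -m 1 1, m 1 2, -m 3 0]
    ![m 3 3, m 3 2, m 3 1, m 1 3, m 2 2, -m 2 1, -m 0 3, m 2 0, -m 0 2, -m 0 1] ?_ ?_ ?_ ?_ ?_ ?_ u hu
  · intro v e1 e2 e3
    refine h.inj v fun i j => ?_
    simp only [Fin.forall_fin_succ, Matrix.cons_val, LinearMap.neg_apply, neg_eq_zero, Fin.reduceSucc, Fin.isValue, Fin.succ_zero_eq_one, Fin.forall_fin_zero_pi, IsEmpty.forall_iff, and_true] at e2 e3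
    fin_cases i <;> fin_cases j <;> first | exact e1 | simp [e2, e3]
  · intro v
    simp only [Matrix.cons_val, LinearMap.neg_apply]
    linear_combination  h.q2 v
  · intro v
    simp only [Matrix.cons_val, LinearMap.neg_apply]
    linear_combination  h.q5 v
  · intro v
    simp only [Matrix.cons_val, LinearMap.neg_apply]
    linear_combination  h.q6 v
  · intro v
    simp only [Matrix.cons_val, LinearMap.neg_apply]
    linear_combination  h.q7 v
  · intro v
    simp only [Matrix.cons_val, LinearMap.neg_apply]
    linear_combination - h.q9 v

theorem Spin.z41 (hV : 6 ≤ Module.finrank K V) {m : Fin 4 → Fin 4 → V →ₗ[K] K} (h : Spin m) (u : V) : m 3 0 u = 0 := by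
  by_contra hu
  refine linC hV (m 3 0) ![m 0 1, -m 0 2, -m 1 3, -m 2 3, -m 0 3]
    ![m 3 3, m 2 2, m 1 2, m 3 2, m 2 1, m 1 1, -m 3 1, -m 0 0, m 2 0, m 1 0] ?_ ?_ ?_ ?_ ?_ ?_ u hu
  · intro v e1 e2 e3
    refine h.inj v fun i j => ?_
    simp only [Fin.forall_fin_succ, Matrix.cons_val, LinearMap.neg_apply, neg_eq_zero, Fin.reduceSucc, Fin.isValue, Fin.succ_zero_eq_one, Fin.forall_fin_zero_pi, IsEmpty.forall_iff, and_true] at e2 e3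
    fin_cases i <;> fin_cases j <;> first | exact e1 | simp [e2, e3]
  · intro v
    simp only [Matrix.cons_val, LinearMap.neg_apply]
    linear_combination - h.q3 v
  · intro v
    simp only [Matrix.cons_val, LinearMap.neg_apply]
    linear_combination - h.q4 v
  · intro v
    simp only [Matrix.cons_val, LinearMap.neg_apply]
    linear_combination - h.q8 v
  · intro v
    simp only [Matrix.cons_val, LinearMap.neg_apply]
    linear_combination - h.q9 v
  · intro v
    simp only [Matrix.cons_val, LinearMap.neg_apply]
    linear_combination  h.q10 v

theorem Spin.z42 (hV : 6 ≤ Module.finrank K V) {m : Fin 4 → Fin 4 → V →ₗ[K] K} (h : Spin m) (u : V) : m 3 1 u = 0 := by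
  by_contra hu
  refine linC hV (m 3 1) ![-m 0 0, -m 0 2, -m 0 3, -m 1 2, -m 2 2]
    ![m 3 3, m 3 2, m 2 3, m 1 3, m 3 0, -m 2 1, -m 1 1, m 2 0, m 1 0, -m 0 1] ?_ ?_ ?_ ?_ ?_ ?_ u hu
  · intro v e1 e2 e3
    refine h.inj v fun i j => ?_
    simp only [Fin.forall_fin_succ, Matrix.cons_val, LinearMap.neg_apply, neg_eq_zero, Fin.reduceSucc, Fin.isValue, Fin.succ_zero_eq_one, Fin.forall_fin_zero_pi, IsEmpty.forall_iff, and_true] at e2 e3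
    fin_cases i <;> fin_cases j <;> first | exact e1 | simp [e2, e3]
  · intro v
    simp only [Matrix.cons_val, LinearMap.neg_apply]
    linear_combination - h.q3 v
  · intro v
    simp only [Matrix.cons_val, LinearMap.neg_apply]
    linear_combination  h.q5 v
  · intro v
    simp only [Matrix.cons_val, LinearMap.neg_apply]
    linear_combination  h.q6 v
  · intro v
    simp only [Matrix.cons_val, LinearMap.neg_apply]
    linear_combination - h.q8 v
  · intro v
    simp only [Matrix.cons_val, LinearMap.neg_apply]
    linear_combination - h.q9 v

theorem Spin.z43 (hV : 6 ≤ Module.finrank K V) {m : Fin 4 → Fin 4 → V →ₗ[K] K} (h : Spin m) (u : V) : m 3 2 u = 0 := by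
  by_contra hu
  refine linC hV (m 3 2) ![m 0 0, m 0 1, m 0 3, -m 1 1, -m 2 1]
    ![m 3 3, m 3 1, m 2 3, m 1 3, m 3 0, -m 2 2, -m 1 2, m 2 0, m 1 0, m 0 2] ?_ ?_ ?_ ?_ ?_ ?_ u hu
  · intro v e1 e2 e3
    refine h.inj v fun i j => ?_
    simp only [Fin.forall_fin_succ, Matrix.cons_val, LinearMap.neg_apply, neg_eq_zero, Fin.reduceSucc, Fin.isValue, Fin.succ_zero_eq_one, Fin.forall_fin_zero_pi, IsEmpty.forall_iff, and_true] at e2 e3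
    fin_cases i <;> fin_cases j <;> first | exact e1 | simp [e2, e3]
  · intro v
    simp only [Matrix.cons_val, LinearMap.neg_apply]
    linear_combination - h.q4 v
  · intro v
    simp only [Matrix.cons_val, LinearMap.neg_apply]
    linear_combination  h.q5 v
  · intro v
    simp only [Matrix.cons_val, LinearMap.neg_apply]
    linear_combination - h.q7 v
  · intro v
    simp only [Matrix.cons_val, LinearMap.neg_apply]
    linear_combination - h.q8 v
  · intro v
    simp only [Matrix.cons_val, LinearMap.neg_apply]
    linear_combination - h.q9 v

theorem Spin.z44 (hV : 6 ≤ Module.finrank K V) {m : Fin 4 → Fin 4 → V →ₗ[K] K} (h : Spin m) (u : V) : m 3 3 u = 0 := by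
  by_contra hu
  refine linC hV (m 3 3) ![-m 0 1, m 0 2, -m 1 0, -m 2 0, m 0 0]
    ![m 3 0, m 2 2, m 1 2, m 3 2, m 2 1, m 1 1, -m 3 1, m 0 3, m 2 3, m 1 3] ?_ ?_ ?_ ?_ ?_ ?_ u hu
  · intro v e1 e2 e3
    refine h.inj v fun i j => ?_
    simp only [Fin.forall_fin_succ, Matrix.cons_val, LinearMap.neg_apply, neg_eq_zero, Fin.reduceSucc, Fin.isValue, Fin.succ_zero_eq_one, Fin.forall_fin_zero_pi, IsEmpty.forall_iff, and_true] at e2 e3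
    fin_cases i <;> fin_cases j <;> first | exact e1 | simp [e2, e3]
  · intro v
    simp only [Matrix.cons_val, LinearMap.neg_apply]
    linear_combination - h.q6 v
  · intro v
    simp only [Matrix.cons_val, LinearMap.neg_apply]
    linear_combination  h.q7 v
  · intro v
    simp only [Matrix.cons_val, LinearMap.neg_apply]
    linear_combination - h.q8 v
  · intro v
    simp only [Matrix.cons_val, LinearMap.neg_apply]
    linear_combination - h.q9 v
  · intro v
    simp only [Matrix.cons_val, LinearMap.neg_apply]
    linear_combination  h.q10 v

theorem Spin.false (hV : 6 ≤ Module.finrank K V) {m : Fin 4 → Fin 4 → V →ₗ[K] K} (h : Spin m) : False := by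
  have : ∀ u : V, u = 0 := by
    intro u
    refine h.inj u fun i j => ?_
    match i, j with
    | 0, 0 => exact h.z11 hV u
    | 0, 1 => exact h.z12 hV u
    | 0, 2 => exact h.z13 hV u
    | 0, 3 => exact h.z14 hV u
    | 1, 0 => exact h.z21 hV u
    | 1, 1 => exact h.z22 hV u
    | 1, 2 => exact h.z23 hV u
    | 1, 3 => exact h.z24 hV u
    | 2, 0 => exact h.z31 hV u
    | 2, 1 => exact h.z32 hV u
    | 2, 2 => exact h.z33 hV u
    | 2, 3 => exact h.z34 hV u
    | 3, 0 => exact h.z41 hV u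
    | 3, 1 => exact h.z42 hV u
    | 3, 2 => exact h.z43 hV u
    | 3, 3 => exact h.z44 hV u
  have hs : Subsingleton V := ⟨fun a b => by rw [this a, this b]⟩
  rw [Module.finrank_zero_of_subsingleton] at hV
  omega

end
end SixFour

namespace SixFour
open scoped Matrix
set_option linter.unusedSectionVars false
set_option linter.unusedSimpArgs false

section
variable {K : Type} [Field K] {r n : ℕ} {I : Ideal (PS K r)} {l : Fin n → PS K r}
variable {x : Fin 4 → PS K r} {w : PS K r}
variable {E : PS K r → MvPolynomial (Fin n) K} {κ : K}

/-- the quadratic part of the structure constants of degree four -/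
def PQ {R : Type} [CommRing R] (k : R) (c : Fin 4 → Fin 4 → Fin 4 → R) (i j a b : Fin 4) : R :=
  c i j 0 * (c a b 3 - k * c a b 0) + c i j 1 * c a b 2 + c i j 2 * c a b 1 + c i j 3 * c a b 0

theorem Nice.assoc (hI : HomI I) (h : Nice I l x w E κ) (i j a b : Fin 4) :
    E (x i * x j * (x a * x b)) = PQ (C κ) (fun i j k => E (x i * x j * x k)) i j a b +
      bb x w E κ i j * C (G0 κ a b) + C (G0 κ i j) * bb x w E κ a b +
      C (G0 κ i j) * C (G0 κ a b) * E (w * w) := by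
  have h1 := I.mul_mem_right (x a * x b) (h.mulE hI i j)
  have h2 : x i * x j * (x a * x b) -
      (tail l x w E κ i j * (x a * x b) + C (G0 κ i j) * (x a * x b * w)) ∈ I := by
    convert h1 using 1; ring
  rw [h.tr.eq_of_sub_mem h2, h.tr.add, h.tr.C_mul]
  have e : tail l x w E κ i j * (x a * x b) =
      aeval l (E (x i * x j * x 0)) * (x a * x b * x 3 - C κ * (x a * x b * x 0)) +
      aeval l (E (x i * x j * x 1)) * (x a * x b * x 2) +
      aeval l (E (x i * x j * x 2)) * (x a * x b * x 1) +
      aeval l (E (x i * x j * x 3)) * (x a * x b * x 0) + aeval l (bb x w E κ i j) * (x a * x b) := by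
    rw [tail]; ring
  rw [e]
  simp only [h.tr.add, h.tr.smul, h.tr.sub, h.tr.C_mul, h.q]
  have e2 : E (x a * x b * w) = bb x w E κ a b + C (G0 κ a b) * E (w * w) := by rw [bb]; ring
  rw [e2]; simp only [PQ]; ring

/-- abstract form of the associativity relations -/
structure Asc {R : Type} [CommRing R] (k om : R) (c : Fin 4 → Fin 4 → Fin 4 → R)
    (b : Fin 4 → Fin 4 → R) (f : Fin 4 → Fin 4 → Fin 4 → Fin 4 → R) : Prop where
  s1 : ∀ i j a, c i j a = c j i a
  s2 : ∀ i j a, c i j a = c i a j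
  c012 : c 0 1 2 = 0
  c013 : c 0 1 3 = 0
  c023 : c 0 2 3 = 0
  c123 : c 1 2 3 = 0
  bs : ∀ i j, b i j = b j i
  f1 : ∀ i j a d, f i j a d = f i a j d
  f2 : ∀ i j a d, f i j a d = f i d a j
  f3 : ∀ i j a d, f i j a d = f j i a d
  hf : ∀ i j a d, f i j a d = PQ k c i j a d + b i j * !![0,0,0,1; 0,0,1,0; 0,1,0,0; 1,0,0,k] a d +
    !![0,0,0,1; 0,0,1,0; 0,1,0,0; 1,0,0,k] i j * b a d +
    !![0,0,0,1; 0,0,1,0; 0,1,0,0; 1,0,0,k] i j * !![0,0,0,1; 0,0,1,0; 0,1,0,0; 1,0,0,k] a d * om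

theorem C_G0 (κ : K) (i j : Fin 4) : (C (G0 κ i j) : MvPolynomial (Fin n) K) =
    !![0,0,0,1; 0,0,1,0; 0,1,0,0; 1,0,0,C κ] i j := by
  fin_cases i <;> fin_cases j <;> simp [G0]

theorem Nice.asc (hI : HomI I) (h : Nice I l x w E κ) :
    Asc (C κ) (E (w * w)) (fun i j k => E (x i * x j * x k)) (bb x w E κ)
      (fun i j a b => E (x i * x j * (x a * x b))) where
  s1 i j a := by rw [mul_comm (x i)]
  s2 i j a := by rw [mul_right_comm]
  c012 := h.c012
  c013 := h.c013
  c023 := h.c023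
  c123 := h.c123
  bs i j := by rw [bb, bb, G0_symm κ i j, mul_comm (x i)]
  f1 i j a d := by congr 1; ring
  f2 i j a d := by congr 1; ring
  f3 i j a d := by congr 1; ring
  hf i j a d := by rw [h.assoc hI, C_G0, C_G0]

theorem Asc.mem {R : Type} [CommRing R] [Algebra K R] {k om : R} {c : Fin 4 → Fin 4 → Fin 4 → R}
    {b : Fin 4 → Fin 4 → R} {f : Fin 4 → Fin 4 → Fin 4 → Fin 4 → R} (h : Asc k om c b f)
    (A : Subalgebra K R) (hk : k ∈ A) (hc : ∀ i j a, c i j a ∈ A) :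
    b 0 0 ∈ A ∧ b 1 1 ∈ A ∧ b 0 1 ∈ A ∧ b 0 2 ∈ A ∧ b 1 3 ∈ A ∧ b 2 3 ∈ A ∧ b 2 2 ∈ A ∧
      b 3 3 - k * b 0 3 ∈ A ∧ b 0 3 - b 1 2 ∈ A := by
  have hP : ∀ i j a d, PQ k c i j a d ∈ A := fun i j a d =>
    A.add_mem (A.add_mem (A.add_mem (A.mul_mem (hc _ _ _) (A.sub_mem (hc _ _ _) (A.mul_mem hk (hc _ _ _))))
      (A.mul_mem (hc _ _ _) (hc _ _ _))) (A.mul_mem (hc _ _ _) (hc _ _ _))) (A.mul_mem (hc _ _ _) (hc _ _ _))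
  have D : ∀ i j a d i' j' a' d', PQ k c i j a d - PQ k c i' j' a' d' ∈ A := fun i j a d i' j' a' d' =>
    A.sub_mem (hP _ _ _ _) (hP _ _ _ _)
  have e00 := h.f1 0 0 1 2
  have e01 := h.f1 0 0 1 3
  have e02 := h.f1 0 0 2 3
  have e11 := h.f1 0 3 1 1
  have e13 := h.f1 1 1 2 3
  have e23 := (h.f3 1 2 2 3).trans (h.f1 2 1 2 3)
  have e22 := h.f2 0 2 2 3
  have eA := h.f1 0 0 3 3
  have eB := h.f2 0 3 1 2
  have eC := h.f1 1 2 3 3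
  simp only [h.hf] at e00 e01 e02 e11 e13 e23 e22 eA eB eC
  simp [-mul_eq_mul_right_iff, -mul_eq_mul_left_iff] at e00 e01 e02 e11 e13 e23 e22 eA eB eC
  have h00 : b 0 0 ∈ A := by
    have := D 0 1 0 2 0 0 1 2
    rwa [← e00, add_sub_cancel_left] at this
  have hA : b 0 3 + b 0 3 + om ∈ A := by
    have : b 0 3 + b 0 3 + om = PQ k c 0 0 3 3 - PQ k c 0 3 0 3 + b 0 0 * k := by linear_combination -eA
    rw [this]; exact A.add_mem (D _ _ _ _ _ _ _ _) (A.mul_mem h00 hk)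
  have hB : b 0 3 + b 1 2 + om ∈ A := by
    have : b 0 3 + b 1 2 + om = PQ k c 0 2 1 3 - PQ k c 0 3 1 2 := by linear_combination eB
    rw [this]; exact D _ _ _ _ _ _ _ _
  have hC : b 3 3 + k * (b 1 2 + om) ∈ A := by
    have : b 3 3 + k * (b 1 2 + om) = PQ k c 1 3 2 3 - PQ k c 1 2 3 3 := by linear_combination eC
    rw [this]; exact D _ _ _ _ _ _ _ _
  refine ⟨h00, ?_, ?_, ?_, ?_, ?_, ?_, ?_, ?_⟩
  · have : b 1 1 = PQ k c 0 1 3 1 - PQ k c 0 3 1 1 := by linear_combination e11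
    rw [this]; exact D _ _ _ _ _ _ _ _
  · have : b 0 1 = PQ k c 0 0 1 3 - PQ k c 0 1 0 3 := by linear_combination -e01
    rw [this]; exact D _ _ _ _ _ _ _ _
  · have : b 0 2 = PQ k c 0 0 2 3 - PQ k c 0 2 0 3 := by linear_combination -e02
    rw [this]; exact D _ _ _ _ _ _ _ _
  · have : b 1 3 = PQ k c 1 1 2 3 - PQ k c 1 2 1 3 := by linear_combination -e13
    rw [this]; exact D _ _ _ _ _ _ _ _
  · have : b 2 3 = PQ k c 2 2 1 3 - PQ k c 1 2 2 3 := by linear_combination e23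
    rw [this]; exact D _ _ _ _ _ _ _ _
  · have : b 2 2 = PQ k c 0 2 2 3 - PQ k c 0 3 2 2 := by linear_combination -e22
    rw [this]; exact D _ _ _ _ _ _ _ _
  · have : b 3 3 - k * b 0 3 = b 3 3 + k * (b 1 2 + om) - k * (b 0 3 + b 1 2 + om) := by ring
    rw [this]; exact A.sub_mem hC (A.mul_mem hk hB)
  · have : b 0 3 - b 1 2 = b 0 3 + b 0 3 + om - (b 0 3 + b 1 2 + om) := by ring
    rw [this]; exact A.sub_mem hA hB

/-- the coordinates in which the relations become the spinor quadrics -/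
def mm {R : Type} [CommRing R] (k : R) (c : Fin 4 → Fin 4 → Fin 4 → R) : Fin 4 → Fin 4 → R :=
  ![![c 0 0 0, c 0 0 1, c 0 0 2, c 0 0 3],
    ![c 0 1 1, c 1 1 1, (c 1 1 2 + k * c 0 0 1), (c 1 1 3 - k * c 0 1 1)],
    ![c 0 2 2, (c 1 2 2 + k * c 0 0 2), c 2 2 2, (c 2 2 3 - k * c 0 2 2)],
    ![(c 0 3 3 - k * c 0 0 3), c 1 3 3, c 2 3 3, (c 3 3 3 - k * c 0 3 3)]]

set_option maxHeartbeats 1000000 in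
theorem Asc.spin {R : Type} [CommRing R] {k om : R} {c : Fin 4 → Fin 4 → Fin 4 → R}
    {b : Fin 4 → Fin 4 → R} {f : Fin 4 → Fin 4 → Fin 4 → Fin 4 → R} (h : Asc k om c b f) :
    (mm k c 0 0 * mm k c 1 3 + mm k c 0 1 * mm k c 1 2 + mm k c 0 2 * mm k c 1 1 + mm k c 0 3 * mm k c 1 0 = 0) ∧
    (mm k c 0 0 * mm k c 2 3 + mm k c 0 1 * mm k c 2 2 + mm k c 0 2 * mm k c 2 1 + mm k c 0 3 * mm k c 2 0 = 0) ∧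
    (mm k c 0 0 * mm k c 3 1 - mm k c 0 1 * mm k c 3 0 + mm k c 1 0 * mm k c 2 1 - mm k c 1 1 * mm k c 2 0 = 0) ∧
    (- mm k c 0 0 * mm k c 3 2 + mm k c 0 2 * mm k c 3 0 + mm k c 1 0 * mm k c 2 2 - mm k c 1 2 * mm k c 2 0 = 0) ∧
    (mm k c 0 1 * mm k c 3 2 - mm k c 0 2 * mm k c 3 1 + mm k c 1 0 * mm k c 2 3 - mm k c 1 3 * mm k c 2 0 = 0) ∧
    (mm k c 0 1 * mm k c 3 3 - mm k c 0 3 * mm k c 3 1 - mm k c 1 1 * mm k c 2 3 + mm k c 1 3 * mm k c 2 1 = 0) ∧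
    (mm k c 0 2 * mm k c 3 3 - mm k c 0 3 * mm k c 3 2 + mm k c 1 2 * mm k c 2 3 - mm k c 1 3 * mm k c 2 2 = 0) ∧
    (mm k c 1 0 * mm k c 3 3 + mm k c 1 1 * mm k c 3 2 + mm k c 1 2 * mm k c 3 1 + mm k c 1 3 * mm k c 3 0 = 0) ∧
    (mm k c 2 0 * mm k c 3 3 + mm k c 2 1 * mm k c 3 2 + mm k c 2 2 * mm k c 3 1 + mm k c 2 3 * mm k c 3 0 = 0) ∧
    (mm k c 0 0 * mm k c 3 3 - mm k c 0 3 * mm k c 3 0 + mm k c 1 1 * mm k c 2 2 - mm k c 1 2 * mm k c 2 1 = 0) := by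
  have t010 : c 0 1 0 = c 0 0 1 := by rw [h.s2 0 1 0]
  have t012 : c 0 1 2 = 0 := h.c012
  have t013 : c 0 1 3 = 0 := h.c013
  have t020 : c 0 2 0 = c 0 0 2 := by rw [h.s2 0 2 0]
  have t021 : c 0 2 1 = 0 := by rw [h.s2 0 2 1, h.c012]
  have t023 : c 0 2 3 = 0 := h.c023
  have t030 : c 0 3 0 = c 0 0 3 := by rw [h.s2 0 3 0]
  have t031 : c 0 3 1 = 0 := by rw [h.s2 0 3 1, h.c013]
  have t032 : c 0 3 2 = 0 := by rw [h.s2 0 3 2, h.c023]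
  have t100 : c 1 0 0 = c 0 0 1 := by rw [h.s1 1 0 0, h.s2 0 1 0]
  have t101 : c 1 0 1 = c 0 1 1 := by rw [h.s1 1 0 1]
  have t102 : c 1 0 2 = 0 := by rw [h.s1 1 0 2, h.c012]
  have t103 : c 1 0 3 = 0 := by rw [h.s1 1 0 3, h.c013]
  have t110 : c 1 1 0 = c 0 1 1 := by rw [h.s2 1 1 0, h.s1 1 0 1]
  have t120 : c 1 2 0 = 0 := by rw [h.s2 1 2 0, h.s1 1 0 2, h.c012]
  have t121 : c 1 2 1 = c 1 1 2 := by rw [h.s2 1 2 1]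
  have t123 : c 1 2 3 = 0 := h.c123
  have t130 : c 1 3 0 = 0 := by rw [h.s2 1 3 0, h.s1 1 0 3, h.c013]
  have t131 : c 1 3 1 = c 1 1 3 := by rw [h.s2 1 3 1]
  have t132 : c 1 3 2 = 0 := by rw [h.s2 1 3 2, h.c123]
  have t200 : c 2 0 0 = c 0 0 2 := by rw [h.s1 2 0 0, h.s2 0 2 0]
  have t201 : c 2 0 1 = 0 := by rw [h.s1 2 0 1, h.s2 0 2 1, h.c012]
  have t202 : c 2 0 2 = c 0 2 2 := by rw [h.s1 2 0 2]
  have t203 : c 2 0 3 = 0 := by rw [h.s1 2 0 3, h.c023]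
  have t210 : c 2 1 0 = 0 := by rw [h.s1 2 1 0, h.s2 1 2 0, h.s1 1 0 2, h.c012]
  have t211 : c 2 1 1 = c 1 1 2 := by rw [h.s1 2 1 1, h.s2 1 2 1]
  have t212 : c 2 1 2 = c 1 2 2 := by rw [h.s1 2 1 2]
  have t213 : c 2 1 3 = 0 := by rw [h.s1 2 1 3, h.c123]
  have t220 : c 2 2 0 = c 0 2 2 := by rw [h.s2 2 2 0, h.s1 2 0 2]
  have t221 : c 2 2 1 = c 1 2 2 := by rw [h.s2 2 2 1, h.s1 2 1 2]
  have t230 : c 2 3 0 = 0 := by rw [h.s2 2 3 0, h.s1 2 0 3, h.c023]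
  have t231 : c 2 3 1 = 0 := by rw [h.s2 2 3 1, h.s1 2 1 3, h.c123]
  have t232 : c 2 3 2 = c 2 2 3 := by rw [h.s2 2 3 2]
  have t300 : c 3 0 0 = c 0 0 3 := by rw [h.s1 3 0 0, h.s2 0 3 0]
  have t301 : c 3 0 1 = 0 := by rw [h.s1 3 0 1, h.s2 0 3 1, h.c013]
  have t302 : c 3 0 2 = 0 := by rw [h.s1 3 0 2, h.s2 0 3 2, h.c023]
  have t303 : c 3 0 3 = c 0 3 3 := by rw [h.s1 3 0 3]
  have t310 : c 3 1 0 = 0 := by rw [h.s1 3 1 0, h.s2 1 3 0, h.s1 1 0 3, h.c013]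
  have t311 : c 3 1 1 = c 1 1 3 := by rw [h.s1 3 1 1, h.s2 1 3 1]
  have t312 : c 3 1 2 = 0 := by rw [h.s1 3 1 2, h.s2 1 3 2, h.c123]
  have t313 : c 3 1 3 = c 1 3 3 := by rw [h.s1 3 1 3]
  have t320 : c 3 2 0 = 0 := by rw [h.s1 3 2 0, h.s2 2 3 0, h.s1 2 0 3, h.c023]
  have t321 : c 3 2 1 = 0 := by rw [h.s1 3 2 1, h.s2 2 3 1, h.s1 2 1 3, h.c123]
  have t322 : c 3 2 2 = c 2 2 3 := by rw [h.s1 3 2 2, h.s2 2 3 2]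
  have t323 : c 3 2 3 = c 2 3 3 := by rw [h.s1 3 2 3]
  have t330 : c 3 3 0 = c 0 3 3 := by rw [h.s2 3 3 0, h.s1 3 0 3]
  have t331 : c 3 3 1 = c 1 3 3 := by rw [h.s2 3 3 1, h.s1 3 1 3]
  have t332 : c 3 3 2 = c 2 3 3 := by rw [h.s2 3 3 2, h.s1 3 2 3]
  have e1122 := h.f1 0 0 1 1
  have e1133 := h.f1 0 0 2 2
  have e1124 := h.f1 0 0 1 3
  have e1233 := h.f1 0 1 2 2
  have e1134 := h.f1 0 0 2 3
  have e1244 := h.f1 0 1 3 3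
  have e2234 := h.f1 1 1 2 3
  have e1344 := h.f1 0 2 3 3
  have e2244 := h.f1 1 1 3 3
  have e3344 := h.f1 2 2 3 3
  have e1144 := h.f1 0 0 3 3
  have e2233 := h.f1 1 1 2 2
  have e1123 := h.f1 0 0 1 2
  have e1234 := h.f1 0 1 2 3
  have g1223 : f 0 1 1 2 = f 0 2 1 1 := (h.f1 0 1 1 2).trans (h.f2 0 1 1 2)
  have g1224 : f 0 1 1 3 = f 0 3 1 1 := (h.f1 0 1 1 3).trans (h.f2 0 1 1 3)
  have g1334 : f 0 2 2 3 = f 0 3 2 2 := (h.f1 0 2 2 3).trans (h.f2 0 2 2 3)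
  have g2334 : f 1 2 2 3 = f 1 3 2 2 := (h.f1 1 2 2 3).trans (h.f2 1 2 2 3)
  have g1234 : f 0 1 2 3 = f 0 3 1 2 := (h.f1 0 1 2 3).trans (h.f2 0 2 1 3)
  have bs10 := h.bs 1 0
  have bs20 := h.bs 2 0
  have bs30 := h.bs 3 0
  have bs21 := h.bs 2 1
  have bs31 := h.bs 3 1
  have bs32 := h.bs 3 2
  simp only [h.hf, PQ, t010, t012, t013, t020, t021, t023, t030, t031, t032, t100, t101, t102, t103, t110, t120, t121, t123, t130, t131, t132, t200, t201, t202, t203, t210, t211, t212, t213, t220, t221, t230, t231, t232, t300, t301, t302, t303, t310, t311, t312, t313, t320, t321, t322, t323, t330, t331, t332, bs10, bs20, bs30, bs21, bs31, bs32] at e1122 e1133 e1124 e1233 e1134 e1244 e2234 e1344 e2244 e3344 e1144 e2233 e1123 e1234 g1223 g1224 g1334 g2334 g1234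
  simp [-mul_eq_mul_right_iff, -mul_eq_mul_left_iff, -add_left_inj, -add_right_inj] at e1122 e1133 e1124 e1233 e1134 e1244 e2234 e1344 e2244 e3344 e1144 e2233 e1123 e1234 g1223 g1224 g1334 g2334 g1234
  refine ⟨?_, ?_, ?_, ?_, ?_, ?_, ?_, ?_, ?_, ?_⟩ <;> simp only [mm, Matrix.cons_val]
  · linear_combination e1122
  · linear_combination e1133
  · linear_combination e1124 + g1223
  · linear_combination e1233 - e1134
  · linear_combination e1234
  · linear_combination e1244 - e2234 + k * e1124 - k * (e1124 + g1223)
  · linear_combination e1344 + g2334 + k * e1134 + k * (e1233 - e1134)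
  · linear_combination e2244 + k * g1224
  · linear_combination e3344 + k * g1334
  · linear_combination e1144 + e2233 - k * e1123 - 2 * g1234 + e1234
end
end SixFour

namespace SixFour
open scoped Matrix
set_option linter.unusedSectionVars false

section
variable {K : Type} [Field K] {r n : ℕ} {I : Ideal (PS K r)} {l : Fin n → PS K r}
variable {x : Fin 4 → PS K r} {w : PS K r}
variable {E : PS K r → MvPolynomial (Fin n) K} {κ : K}

/-- the shear fixing `X i0` and moving the other variables by multiples of it -/
def shear (i0 : Fin n) (t : Fin n → K) : MvPolynomial (Fin 4 ⊕ Fin n) K →ₐ[K] MvPolynomial (Fin 4 ⊕ Fin n) K :=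
  aeval (Sum.elim (fun i => X (Sum.inl i))
    (fun i => X (Sum.inr i) + C (if i = i0 then 0 else t i) * X (Sum.inr i0)))

theorem shear_comp (i0 : Fin n) (t : Fin n → K) :
    (shear i0 t).comp (shear i0 (-t)) = AlgHom.id K _ := by
  apply MvPolynomial.algHom_ext
  rintro (i | i)
  · simp only [shear, AlgHom.comp_apply, aeval_X, Sum.elim_inl, AlgHom.id_apply]
  · simp only [shear, AlgHom.comp_apply, aeval_X, Sum.elim_inr, AlgHom.id_apply, map_add, map_mul, aeval_C,
      algebraMap_eq]
    by_cases h : i = i0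
    · simp [h]
    · simp [h]

def shearE (i0 : Fin n) (t : Fin n → K) : MvPolynomial (Fin 4 ⊕ Fin n) K ≃ₐ[K] MvPolynomial (Fin 4 ⊕ Fin n) K :=
  AlgEquiv.ofAlgHom (shear i0 t) (shear i0 (-t)) (shear_comp i0 t)
    (by have := shear_comp i0 (-t); rwa [neg_neg] at this)

theorem cone_of (hn : 4 + n = r + 1) (Φ : MvPolynomial (Fin 4 ⊕ Fin n) K ≃ₐ[K] PS K r)
    (h1 : ∀ i, Φ (X (Sum.inl i)) = x i)
    (h2 : ∀ j, Φ (X (Sum.inr j)) = l j) (h3 : ∀ j, (Φ.symm (X j)).IsHomogeneous 1)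
    (p : Fin n → K) (hp : p ≠ 0) :
    ∃ φ : PS K r ≃ₐ[K] PS K r, AMD.IsGrAut K r φ ∧
      (∀ i, φ (x i) ∈ (rename (Fin.castSucc : Fin r → Fin (r+1)) : _ →ₐ[K] PS K r).range) ∧
      ∀ c : MvPolynomial (Fin n) K, c.IsHomogeneous 1 → eval p c = 0 →
        φ (aeval l c) ∈ (rename (Fin.castSucc : Fin r → Fin (r+1)) : _ →ₐ[K] PS K r).range := by
  obtain ⟨i0, hi0⟩ : ∃ i0, p i0 ≠ 0 := by
    by_contra hh; push Not at hh; exact hp (funext hh)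
  obtain ⟨e, he⟩ : ∃ e : Fin 4 ⊕ Fin n ≃ Fin (r+1), e (Sum.inr i0) = Fin.last r := by
    let e0 : Fin 4 ⊕ Fin n ≃ Fin (r+1) := finSumFinEquiv.trans (finCongr hn)
    exact ⟨e0.trans (Equiv.swap (e0 (Sum.inr i0)) (Fin.last r)), by simp⟩
  have hB : ∀ s, s ≠ Sum.inr i0 → (X (e s) : PS K r) ∈
      (rename (Fin.castSucc : Fin r → Fin (r+1)) : _ →ₐ[K] PS K r).range := by
    intro s hs
    have : e s ≠ Fin.last r := fun hh => hs (e.injective (hh.trans he.symm))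
    obtain ⟨j, hj⟩ := Fin.exists_castSucc_eq.2 this
    exact ⟨X j, by rw [← hj]; exact rename_X _ _⟩
  let t : Fin n → K := fun i => p i / p i0
  let φ : PS K r ≃ₐ[K] PS K r := (Φ.symm.trans (shearE i0 t)).trans (renameEquiv K e)
  have hφ : ∀ y, φ y = rename e (shear i0 t (Φ.symm y)) := fun y => rfl
  have s1 : ∀ i, φ (x i) = X (e (Sum.inl i)) := fun i => by
    rw [hφ, ← h1, Φ.symm_apply_apply, shear, aeval_X, Sum.elim_inl, rename_X]
  have s2 : ∀ i, φ (l i) = X (e (Sum.inr i)) + C (if i = i0 then 0 else t i) * X (Fin.last r) := fun i => by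
    rw [hφ, ← h2, Φ.symm_apply_apply, shear, aeval_X, Sum.elim_inr, map_add, map_mul, rename_X, rename_X, rename_C, he]
  refine ⟨φ, ?_, ?_, ?_⟩
  · intro i
    rw [hφ]
    refine IsHomogeneous.rename_isHomogeneous ?_
    have := (h3 i).aeval (Sum.elim (fun i => X (Sum.inl i))
      (fun i => X (Sum.inr i) + C (if i = i0 then 0 else t i) * X (Sum.inr i0)) :
        _ → MvPolynomial (Fin 4 ⊕ Fin n) K) (n := 1) (by
      rintro (i | i)
      · exact isHomogeneous_X _ _
      · exact (isHomogeneous_X _ _).add ((isHomogeneous_X _ _).C_mul _))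
    simpa [shear] using this
  · intro i
    rw [s1]
    exact hB _ (by simp)
  · intro c hc hpc
    have hx := lin_expand hc
    set a : Fin n → K := fun i => coeff (Finsupp.single i 1) c with ha
    have hs : ∑ i, a i * p i = 0 := by
      rw [hx, map_sum] at hpc
      simpa using hpc
    have : φ (aeval l c) = ∑ i, C (a i) * (if i = i0 then 0 else X (e (Sum.inr i))) := by
      have e1 : φ (aeval l c) = ∑ i, C (a i) * φ (l i) := by
        conv_lhs => rw [hx]
        rw [map_sum, map_sum]
        refine Finset.sum_congr rfl fun i _ => ?_
        rw [map_mul, map_mul, aeval_C, aeval_X, AlgEquiv.commutes, algebraMap_eq]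
      have e2 : ∀ i, C (a i) * φ (l i) = C (a i) * (if i = i0 then 0 else X (e (Sum.inr i))) +
          C (a i * p i) * (C (p i0)⁻¹ * X (Fin.last r)) := by
        intro i
        rw [s2]
        by_cases h : i = i0
        · subst h
          have : (C (p i) * C (p i)⁻¹ : PS K r) = 1 := by rw [← C_mul, mul_inv_cancel₀ hi0, C_1]
          simp only [if_true, C_0, zero_mul, add_zero, mul_zero, zero_add, he, C_mul]
          linear_combination - C (a i) * X (Fin.last r) * this
        · simp only [if_neg h, t, div_eq_mul_inv, C_mul]; ring
      rw [e1, Finset.sum_congr rfl fun i _ => e2 i, Finset.sum_add_distrib, ← Finset.sum_mul, ← map_sum, hs, C_0,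
        zero_mul, add_zero]
    rw [this]
    refine Subalgebra.sum_mem _ fun i _ => Subalgebra.mul_mem _ (Subalgebra.algebraMap_mem _ (a i)) ?_
    split_ifs with h
    · exact Subalgebra.zero_mem _
    · exact hB _ (by simpa using h)

theorem Nice.noncone (hI : HomI I) (h : Nice I l x w E κ) (hn : 4 + n = r + 1)
    (Φ : MvPolynomial (Fin 4 ⊕ Fin n) K ≃ₐ[K] PS K r)
    (h1 : ∀ i, Φ (X (Sum.inl i)) = x i)
    (h2 : ∀ j, Φ (X (Sum.inr j)) = l j) (h3 : ∀ j, (Φ.symm (X j)).IsHomogeneous 1)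
    (hcone : ¬ AMD.IsConeIdeal K r I) (p : Fin n → K)
    (hp : ∀ i j k, eval p (E (x i * x j * x k)) = 0) : p = 0 := by
  by_contra hp0
  apply hcone
  obtain ⟨π, hπ⟩ := exists_Pr h.st.hx h.st.hl Φ h1 h2 h3
  obtain ⟨φ, hg, hx, hc⟩ := cone_of hn Φ h1 h2 h3 p hp0
  refine ⟨φ, hg, ?_⟩
  set B := (rename (Fin.castSucc : Fin r → Fin (r+1)) : MvPolynomial (Fin r) K →ₐ[K] PS K r).range with hB
  let A : Subalgebra K (MvPolynomial (Fin n) K) := B.comap (φ.toAlgHom.comp (aeval l))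
  have hA : ∀ c, c ∈ A ↔ φ (aeval l c) ∈ B := fun c => Iff.rfl
  have hC : ∀ c : K, C c ∈ B := fun c => B.algebraMap_mem c
  have hφC : ∀ c : K, φ (C c) = C c := fun c => φ.commutes c
  have hcA : ∀ i j k, E (x i * x j * x k) ∈ A := fun i j k => hc _ (h.cf_hom i j k) (hp i j k)
  obtain ⟨b00, b11, b01, b02, b13, b23, b22, b33, b03⟩ := (h.asc hI).mem A (A.algebraMap_mem κ) hcA
  rw [hA] at b00 b11 b01 b02 b13 b23 b22 b33 b03
  have T : ∀ i j, φ (tail l x w E κ i j) - φ (aeval l (bb x w E κ i j)) ∈ B := by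
    intro i j
    rw [tail, map_add, add_sub_cancel_right]
    simp only [map_add, map_mul, map_sub, hφC]
    refine B.add_mem (B.add_mem (B.add_mem ?_ ?_) ?_) ?_
    · exact B.mul_mem (hcA _ _ _) (B.sub_mem (hx _) (B.mul_mem (hC _) (hx _)))
    all_goals exact B.mul_mem (hcA _ _ _) (hx _)
  have P0 : ∀ i j, φ (Pp l x w E κ i j) + φ (aeval l (bb x w E κ i j)) ∈ B := by
    intro i j
    rw [Pp, map_sub, map_mul]
    have := B.sub_mem (B.mul_mem (hx i) (hx j)) (T i j)
    convert this using 1; ring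
  have P1 : ∀ i j, φ (aeval l (bb x w E κ i j)) ∈ B → φ (Pp l x w E κ i j) ∈ B := by
    intro i j hb
    have := B.sub_mem (P0 i j) hb
    rwa [add_sub_cancel_right] at this
  have G : ∀ j, φ (Gq l x w E κ j) ∈ B := by
    intro j
    fin_cases j
    · exact P1 _ _ b00
    · exact P1 _ _ b11
    · exact P1 _ _ b01
    · exact P1 _ _ b02
    · exact P1 _ _ b13
    · exact P1 _ _ b23
    · exact P1 _ _ b22
    · change φ (Pp l x w E κ 3 3 - C κ * Pp l x w E κ 0 3) ∈ B
      rw [map_sub, map_mul, aeval_C, algebraMap_eq, map_sub, map_mul, hφC] at b33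
      rw [map_sub, map_mul, hφC]
      have := B.sub_mem (B.sub_mem (P0 3 3) (B.mul_mem (hC κ) (P0 0 3))) b33
      convert this using 1; ring
    · change φ (Pp l x w E κ 0 3 - Pp l x w E κ 1 2) ∈ B
      rw [map_sub, map_sub] at b03
      rw [map_sub]
      have := B.sub_mem (B.sub_mem (P0 0 3) (P0 1 2)) b03
      convert this using 1; ring
  choose g hgg using G
  refine ⟨Ideal.span (Set.range g), ?_⟩
  rw [h.span_Gq hI hπ, Ideal.map_span, Ideal.map_span, ← Set.range_comp, ← Set.range_comp]
  congr 2
  funext j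
  exact (hgg j).symm

/-- evaluation of a linear form as a linear functional -/
def fnl (c : MvPolynomial (Fin n) K) : (Fin n → K) →ₗ[K] K :=
  ∑ i, coeff (Finsupp.single i 1) c • LinearMap.proj i

theorem fnl_apply {c : MvPolynomial (Fin n) K} (hc : c.IsHomogeneous 1) (v : Fin n → K) : fnl c v = eval v c := by
  conv_rhs => rw [lin_expand hc]
  rw [map_sum]
  simp [fnl]

theorem mm_hom {c : Fin 4 → Fin 4 → Fin 4 → MvPolynomial (Fin n) K} (hc : ∀ i j k, (c i j k).IsHomogeneous 1) (i j : Fin 4) :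
    (mm (C κ) c i j).IsHomogeneous 1 := by
  fin_cases i <;> fin_cases j <;> simp only [mm] <;>
    first
    | exact hc _ _ _
    | exact (hc _ _ _).add ((hc _ _ _).C_mul _)
    | exact (hc _ _ _).sub ((hc _ _ _).C_mul _)

theorem c_zero {k : K} {c : Fin 4 → Fin 4 → Fin 4 → K}
    (s1 : ∀ i j a, c i j a = c j i a) (s2 : ∀ i j a, c i j a = c i a j)
    (c012 : c 0 1 2 = 0) (c013 : c 0 1 3 = 0) (c023 : c 0 2 3 = 0) (c123 : c 1 2 3 = 0)
    (hm : ∀ i j, mm k c i j = 0) (i j a : Fin 4) : c i j a = 0 := by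
  have m00 : c 0 0 0 = 0 := hm 0 0
  have m01 : c 0 0 1 = 0 := hm 0 1
  have m02 : c 0 0 2 = 0 := hm 0 2
  have m03 : c 0 0 3 = 0 := hm 0 3
  have m10 : c 0 1 1 = 0 := hm 1 0
  have m11 : c 1 1 1 = 0 := hm 1 1
  have m12 := hm 1 2
  have m13 := hm 1 3
  have m20 : c 0 2 2 = 0 := hm 2 0
  have m21 := hm 2 1
  have m22 : c 2 2 2 = 0 := hm 2 2
  have m23 := hm 2 3
  have m30 := hm 3 0
  have m31 : c 1 3 3 = 0 := hm 3 1
  have m32 : c 2 3 3 = 0 := hm 3 2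
  have m33 := hm 3 3
  simp only [mm, Matrix.cons_val] at m12 m13 m21 m23 m30 m33
  simp only [m01, m02, m03, m10, m20, mul_zero, add_zero, sub_zero] at m12 m13 m21 m23 m30
  rw [m30, mul_zero, sub_zero] at m33
  have S : ∀ i j a : Fin 4, i ≤ j → j ≤ a → c i j a = 0 := by
    intro i j a h1 h2
    fin_cases i <;> fin_cases j <;> first
      | exact absurd h1 (by decide)
      | (fin_cases a <;> first
          | assumption
          | exact absurd h2 (by decide))
  rcases le_total i j with h1 | h1 <;> rcases le_total j a with h2 | h2 <;> rcases le_total i a with h3 | h3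
  · exact S _ _ _ h1 h2
  · exact S _ _ _ h1 h2
  · rw [s2]; exact S _ _ _ h3 h2
  · rw [s2, s1]; exact S _ _ _ h3 h1
  · rw [s1, s2]
    have := S j i a h1 h3
    rw [s2] at this
    exact this
  · rw [s1, s2]; exact S _ _ _ h2 h3
  · rw [s1, s2, s1]
    have := S a j i h2 h1
    rw [s1, s2, s1, s2] at this
    rw [s2]
    first | exact this | (rw [s1]; exact this) | (rw [s2]; exact this)
  · rw [s1, s2, s1]; exact S _ _ _ h2 h1

theorem Nice.dim (hI : HomI I) (h : Nice I l x w E κ) (hn : 4 + n = r + 1)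
    (Φ : MvPolynomial (Fin 4 ⊕ Fin n) K ≃ₐ[K] PS K r)
    (h1 : ∀ i, Φ (X (Sum.inl i)) = x i)
    (h2 : ∀ j, Φ (X (Sum.inr j)) = l j) (h3 : ∀ j, (Φ.symm (X j)).IsHomogeneous 1)
    (hcone : ¬ AMD.IsConeIdeal K r I) : n < 6 := by
  by_contra hn6
  set c : Fin 4 → Fin 4 → Fin 4 → MvPolynomial (Fin n) K := fun i j k => E (x i * x j * x k) with hc
  have hA : Asc (C κ) (E (w * w)) c (bb x w E κ) (fun i j a b => E (x i * x j * (x a * x b))) := h.asc hI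
  have hm : ∀ i j, (mm (C κ) c i j).IsHomogeneous 1 := mm_hom h.cf_hom
  have hv : ∀ i j v, fnl (mm (C κ) c i j) v = eval v (mm (C κ) c i j) := fun i j v => fnl_apply (hm i j) v
  obtain ⟨q1, q2, q3, q4, q5, q6, q7, q8, q9, q10⟩ := hA.spin
  refine Spin.false (K := K) (V := Fin n → K) (m := fun i j => fnl (mm (C κ) c i j)) (by simp; omega) ?_
  have ev : ∀ {p : MvPolynomial (Fin n) K}, p = 0 → ∀ v, eval v p = 0 := by
    rintro p rfl v; exact map_zero _
  constructor
  · intro v; have := ev q1 v; simp only [map_add, map_sub, map_neg, map_mul] at this; simp only [hv]; exact this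
  · intro v; have := ev q2 v; simp only [map_add, map_sub, map_neg, map_mul] at this; simp only [hv]; exact this
  · intro v; have := ev q3 v; simp only [map_add, map_sub, map_neg, map_mul] at this; simp only [hv]; exact this
  · intro v; have := ev q4 v; simp only [map_add, map_sub, map_neg, map_mul] at this; simp only [hv]; exact this
  · intro v; have := ev q5 v; simp only [map_add, map_sub, map_neg, map_mul] at this; simp only [hv]; exact this
  · intro v; have := ev q6 v; simp only [map_add, map_sub, map_neg, map_mul] at this; simp only [hv]; exact this
  · intro v; have := ev q7 v; simp only [map_add, map_sub, map_neg, map_mul] at this; simp only [hv]; exact this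
  · intro v; have := ev q8 v; simp only [map_add, map_sub, map_neg, map_mul] at this; simp only [hv]; exact this
  · intro v; have := ev q9 v; simp only [map_add, map_sub, map_neg, map_mul] at this; simp only [hv]; exact this
  · intro v; have := ev q10 v; simp only [map_add, map_sub, map_neg, map_mul] at this; simp only [hv]; exact this
  · intro v hz
    refine h.noncone hI hn Φ h1 h2 h3 hcone v ?_
    have e : ∀ i j, mm κ (fun i j k => eval v (c i j k)) i j = eval v (mm (C κ) c i j) := by
      intro i j
      fin_cases i <;> fin_cases j <;> simp [mm]
    refine c_zero (k := κ) (c := fun i j k => eval v (c i j k)) ?_ ?_ ?_ ?_ ?_ ?_ ?_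
    · intro i j a; simp only [hA.s1 i j a]
    · intro i j a; exact congrArg (eval v) (hA.s2 i j a)
    · exact ev hA.c012 v
    · exact ev hA.c013 v
    · exact ev hA.c023 v
    · exact ev hA.c123 v
    · intro i j
      rw [e, ← hv]
      exact hz i j

end
end SixFour

/-- **Theorem 2.4 (a).**  A non-degenerate arithmetically Cohen-Macaulay variety
`X ⊆ ℙ^r_K` of degree `6` and codimension `4` which is not a cone satisfies
`dim X ≤ 4`, is arithmetically Gorenstein, and its minimal free resolution has the
form `0 → S(-6) → S⁹(-4) → S¹⁶(-3) → S⁹(-2) → I_X → 0`. -/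
theorem degree_six_codim_four_ACM
    (K : Type) [Field K] [IsAlgClosed K] (r : ℕ)
    (I : Ideal (PS K r)) (hprime : I.IsPrime)
    (hhom : AMD.IsHomIdeal K r I) (hnd : AMD.Nondeg K r I)
    (d : ℕ) (hdim : AMD.DimEq K r I d) (hcodim : d + 4 = r)
    (hdeg : AMD.DegreeEq K r I d 6)
    (hcone : ¬ AMD.IsConeIdeal K r I)
    (hACM : AMD.IsACM K r I) :
    d ≤ 4 ∧ AMD.IsArithGorenstein K r I ∧
    AMD.HasBettiDiagram K r I (fun i j => match i, j with
      | 1, 1 => 9 | 2, 1 => 16 | 3, 1 => 9 | 4, 2 => 1 | _, _ => 0) := by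
  obtain ⟨l, hl, hr⟩ := SixFour.partA K r I d hdim hACM
  obtain ⟨x, w, hs⟩ := SixFour.partB K r d I hprime hhom hnd hcodim hdeg l hl hr
  obtain ⟨x, w, E, κ, h⟩ := SixFour.exists_nice hhom hprime hs
  have hn : 4 + (d + 1) = r + 1 := by omega
  obtain ⟨Φ, h1, h2, h3⟩ := SixFour.exists_Phi hhom hnd hn h.st
  obtain ⟨π, hπ⟩ := SixFour.exists_Pr h.st.hx h.st.hl Φ h1 h2 h3
  refine ⟨?_, SixFour.gorenstein d hhom hdim h, ?_⟩
  · have := h.dim hhom hn Φ h1 h2 h3 hcone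
    omega
  · have hb := h.betti hhom hπ
    have e : SixFour.bd = (fun i j => match i, j with
      | 1, 1 => 9 | 2, 1 => 16 | 3, 1 => 9 | 4, 2 => 1 | _, _ => 0) := by
      funext i j
      rcases i with _ | _ | _ | _ | _ | i <;> rcases j with _ | _ | _ | j <;> rfl
    rw [e] at hb
    exact hb
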